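/- Assume GRH: for every Dirichlet character χ, every zero s of the Dirichlet L-function L(s,χ) with 0 < Re s < 1 satisfies Re s = 1/2. Fix an integer k ≥ 2 and ε > 0. There is a constant C depending only on k and ε such that for all real S ≥ 2 and all positive integers q, Σ_{χ mod q, χ ≠ χ₀} ∫_0^S |L(1/2 + it, χ)|^{2k} dt ≤ C · φ(q) S (log(qS))^{k²+ε}, where the sum runs over non-principal Dirichlet characters χ modulo q. -/

import Mathlib

open MeasureTheory Complex
open scoped Classical

/-- `∑_{χ mod q, χ ≠ χ₀} ∫₀^S |L(1/2+it,χ)|^{2k} dt`. -/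
noncomputable def charMoment (k q : ℕ) (S : ℝ) : ℝ :=
  if h : q ≠ 0 then
    haveI : NeZero q := ⟨h⟩
    ∑' χ : DirichletCharacter ℂ q,
      (if χ ≠ 1 then
        ∫ t in (0 : ℝ)..S, ‖DirichletCharacter.LFunction χ (1/2 + t * Complex.I)‖^(2*k)
      else 0)
  else 0

/-- GRH: all nontrivial zeros of Dirichlet L-functions lie on the critical line. -/
def GRH : Prop :=
  ∀ (N : ℕ) [NeZero N] (χ : DirichletCharacter ℂ N) (s : ℂ),
    DirichletCharacter.LFunction χ s = 0 → 0 < s.re → s.re < 1 → s.re = 1/2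

open Filter Topology in
lemma norm_sum_range_char_le {q : ℕ} [NeZero q] {χ : DirichletCharacter ℂ q} (hχ : χ ≠ 1) (n : ℕ) :
    ‖∑ k ∈ Finset.range n, χ (k : ZMod q)‖ ≤ q := by
  induction n using Nat.strong_induction_on with
  | _ n ih =>
    rcases lt_or_ge n q with h | h
    · calc _ ≤ ∑ k ∈ Finset.range n, (1 : ℝ) :=
            norm_sum_le_of_le _ fun k _ => χ.norm_le_one (k : ZMod q)
        _ ≤ q := by simpa using h.le
    · obtain ⟨m, rfl⟩ := Nat.exists_eq_add_of_le h
      have hq : 0 < q := NeZero.pos q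
      have h0 : ∑ k ∈ Finset.range q, χ (k : ZMod q) = 0 := by
        rw [← MulChar.sum_eq_zero_of_ne_one hχ]
        refine Finset.sum_bij' (fun k _ => (k : ZMod q)) (fun a _ => a.val) ?_ ?_ ?_ ?_ ?_
        · simp
        · intro a _; simpa using ZMod.val_lt a
        · intro a ha; simpa using ZMod.val_cast_of_lt (by simpa using ha)
        · simp
        · simp
      rw [Finset.sum_range_add, h0, zero_add]
      simpa using ih m (by omega)

lemma sum_Icc_char_eq {q : ℕ} [NeZero q] (χ : DirichletCharacter ℂ q) (n : ℕ) :
    ∑ k ∈ Finset.Icc 1 n, χ (k : ZMod q) = ∑ k ∈ Finset.range (n + 1), χ (k : ZMod q) -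
      χ ((0 : ℕ) : ZMod q) := by
  rw [Finset.range_eq_Ico, Finset.sum_eq_sum_Ico_succ_bot (by omega)]
  simp only [add_sub_cancel_left, zero_add]
  rfl

lemma norm_sum_Icc_char_le {q : ℕ} [NeZero q] {χ : DirichletCharacter ℂ q} (hχ : χ ≠ 1) (n : ℕ) :
    ‖∑ k ∈ Finset.Icc 1 n, χ (k : ZMod q)‖ ≤ q := by
  have hq1 : q ≠ 1 := by
    rintro rfl
    exact hχ (Subsingleton.elim _ _)
  have : ∑ k ∈ Finset.Icc 1 n, χ (k : ZMod q) = ∑ k ∈ Finset.range (n + 1), χ (k : ZMod q) := by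
    have : Nontrivial (ZMod q) := ZMod.nontrivial_iff.2 hq1
    rw [sum_Icc_char_eq χ, Nat.cast_zero, MulChar.map_zero, sub_zero]
  rw [this]
  exact norm_sum_range_char_le hχ _

open Filter Topology in
lemma LFunction_eq_mul_mellin {q : ℕ} [NeZero q] {χ : DirichletCharacter ℂ q} (hχ : χ ≠ 1) {s : ℂ}
    (hs : 0 < s.re) : DirichletCharacter.LFunction χ s =
      s * mellin (fun t : ℝ => ∑ k ∈ Finset.Icc 1 ⌊t⌋₊, χ (k : ZMod q)) (-s) := by
  set A : ℝ → ℂ := fun t : ℝ => ∑ k ∈ Finset.Icc 1 ⌊t⌋₊, χ (k : ZMod q) with hA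
  have hAm : Measurable A := by
    have : A = (fun n : ℕ => ∑ k ∈ Finset.Icc 1 n, χ (k : ZMod q)) ∘ fun t : ℝ => ⌊t⌋₊ := rfl
    rw [this]
    exact (measurable_from_nat).comp Nat.measurable_floor
  have hAb : ∀ t, ‖A t‖ ≤ q := fun t => norm_sum_Icc_char_le hχ _
  have hA0 : ∀ t < 1, A t = 0 := by
    intro t ht
    have : ⌊t⌋₊ = 0 := Nat.floor_eq_zero.2 ht
    simp [hA, this]
  have hloc : LocallyIntegrableOn A (Set.Ioi 0) := by
    refine LocallyIntegrable.locallyIntegrableOn ?_ _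
    refine (locallyIntegrable_const (q : ℝ)).mono hAm.aestronglyMeasurable ?_
    exact Eventually.of_forall fun t => by simpa using hAb t
  have hd : ∀ s : ℂ, 0 < s.re → DifferentiableAt ℂ (fun s => s * mellin A (-s)) s := by
    intro s hs
    refine differentiableAt_id.mul ?_
    refine DifferentiableAt.comp s (g := mellin A) ?_ (differentiableAt_id.neg)
    refine mellin_differentiableAt_of_isBigO_rpow (a := 0) (b := (-s).re - 1) hloc ?_ (by simpa) ?_
      (by simp)
    · refine Asymptotics.IsBigO.of_bound q (Eventually.of_forall fun t => ?_)
      simpa using hAb t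
    · refine Asymptotics.IsBigO.of_bound 1 ?_
      filter_upwards [Ioo_mem_nhdsGT (show (0 : ℝ) < 1 by norm_num)] with t ht
      rw [hA0 t ht.2]; simp
  have hU : IsPreconnected {s : ℂ | 0 < s.re} := (convex_halfSpace_re_gt 0).isPreconnected
  have hUo : IsOpen {s : ℂ | 0 < s.re} := isOpen_lt continuous_const Complex.continuous_re
  have hL : AnalyticOnNhd ℂ (DirichletCharacter.LFunction χ) {s : ℂ | 0 < s.re} :=
    (DirichletCharacter.differentiable_LFunction hχ).differentiableOn.analyticOnNhd hUo
  have hR : AnalyticOnNhd ℂ (fun s => s * mellin A (-s)) {s : ℂ | 0 < s.re} :=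
    (DifferentiableOn.analyticOnNhd (fun s hs => (hd s hs).differentiableWithinAt) hUo)
  refine hL.eqOn_of_preconnected_of_eventuallyEq hR hU (z₀ := 2) (by simp) ?_ hs
  have hev : {s : ℂ | 1 < s.re} ∈ 𝓝 (2 : ℂ) :=
    (isOpen_lt continuous_const Complex.continuous_re).mem_nhds (by simp)
  filter_upwards [hev] with s hs
  have hs' : 1 < s.re := hs
  rw [DirichletCharacter.LFunction_eq_LSeries χ hs', LSeries_eq_mul_integral _ (le_refl 0)
    (by linarith) (DirichletCharacter.LSeriesSummable_of_one_lt_re χ hs')]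
  · congr 1
    rw [mellin, ← setIntegral_eq_of_subset_of_ae_sdiff_eq_zero
      measurableSet_Ioi.nullMeasurableSet
      (Set.Ioi_subset_Ioi (zero_le_one))]
    · refine setIntegral_congr_fun measurableSet_Ioi fun t _ => ?_
      simp only [hA, smul_eq_mul]
      rw [mul_comm, neg_add']
    · filter_upwards [Measure.ae_ne volume (1 : ℝ)] with t ht1 ht
      have h1 : t ≤ 1 := by simpa using ht.2
      change A t * _ = 0
      rw [hA0 t (lt_of_le_of_ne h1 ht1), zero_mul]
  · refine Asymptotics.IsBigO.of_bound q (Eventually.of_forall fun n => ?_)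
    simpa using norm_sum_Icc_char_le hχ n

lemma norm_LFunction_le {q : ℕ} [NeZero q] {χ : DirichletCharacter ℂ q} (hχ : χ ≠ 1) {s : ℂ}
    (hs : 0 < s.re) : ‖DirichletCharacter.LFunction χ s‖ ≤ q * ‖s‖ / s.re := by
  rw [LFunction_eq_mul_mellin hχ hs, norm_mul, mellin]
  have h1 : ‖∫ t in Set.Ioi (0 : ℝ), (t : ℂ) ^ (-s - 1) •
      ∑ k ∈ Finset.Icc 1 ⌊t⌋₊, χ (k : ZMod q)‖ ≤ ∫ t in Set.Ioi (0 : ℝ),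
        (Set.Ioi (1 : ℝ)).indicator (fun t => q * t ^ (-s.re - 1)) t := by
    refine norm_integral_le_of_norm_le ?_ ?_
    · refine Integrable.integrableOn ?_
      rw [integrable_indicator_iff measurableSet_Ioi]
      exact (integrableOn_Ioi_rpow_of_lt (by linarith) zero_lt_one).const_mul _
    · have h1 : ∀ᵐ t : ℝ ∂(volume.restrict (Set.Ioi 0)), t ≠ 1 :=
        ae_restrict_of_ae (Measure.ae_ne volume 1)
      filter_upwards [ae_restrict_mem measurableSet_Ioi, h1] with t ht ht1
      have ht' : 0 < t := ht
      rcases lt_or_gt_of_ne ht1 with h | h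
      · have : ⌊t⌋₊ = 0 := Nat.floor_eq_zero.2 h
        have h2 : t ∉ Set.Ioi (1 : ℝ) := by simpa using h.le
        simp [this, h2]
      · rw [Set.indicator_of_mem (show t ∈ Set.Ioi (1:ℝ) from h), norm_smul,
          Complex.norm_cpow_eq_rpow_re_of_pos ht', mul_comm]
        simp only [Complex.sub_re, Complex.neg_re, Complex.one_re]
        exact mul_le_mul_of_nonneg_right (norm_sum_Icc_char_le hχ _) (by positivity)
  have h2 : ∫ t in Set.Ioi (0 : ℝ),
        (Set.Ioi (1 : ℝ)).indicator (fun t => q * t ^ (-s.re - 1)) t = q / s.re := by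
    rw [setIntegral_indicator measurableSet_Ioi, Set.Ioi_inter_Ioi, integral_const_mul,
      integral_Ioi_rpow_of_lt (by linarith) (by simp)]
    simp
    field_simp
  rw [h2] at h1
  calc _ ≤ ‖s‖ * (q / s.re) := by gcongr
    _ = _ := by ring

lemma exists_log_of_ne_zero {f : ℂ → ℂ} {R : ℝ} (hR : 0 < R)
    (hf : DifferentiableOn ℂ f (Metric.ball 0 R)) (h0 : ∀ z ∈ Metric.ball (0 : ℂ) R, f z ≠ 0) :
    ∃ g : ℂ → ℂ, g 0 = 0 ∧ (∀ z ∈ Metric.ball (0 : ℂ) R, HasDerivAt g (deriv f z / f z) z) ∧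
      ∀ z ∈ Metric.ball (0 : ℂ) R, f z = f 0 * Complex.exp (g z) := by
  have hd : DifferentiableOn ℂ (fun z => deriv f z / f z) (Metric.ball 0 R) :=
    (hf.deriv Metric.isOpen_ball).div hf h0
  obtain ⟨g, hg0, hg⟩ := hd.isExactOn_ball.with_val_at 0 0
  refine ⟨g, hg0, hg, fun z hz => ?_⟩
  have hfd : ∀ z ∈ Metric.ball (0 : ℂ) R, HasDerivAt f (deriv f z) z := fun z hz =>
    (hf.differentiableAt (Metric.isOpen_ball.mem_nhds hz)).hasDerivAt
  have hh : ∀ z ∈ Metric.ball (0 : ℂ) R,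
      HasDerivAt (fun z => f z * Complex.exp (-g z)) 0 z := by
    intro z hz
    have := (hfd z hz).mul ((hg z hz).neg.cexp)
    refine this.congr_deriv ?_
    have := h0 z hz
    field_simp
    ring
  have hc := (convex_ball (0 : ℂ) R).is_const_of_fderivWithin_eq_zero (𝕜 := ℂ)
    (f := fun z => f z * Complex.exp (-g z))
    (fun z hz => (hh z hz).differentiableAt.differentiableWithinAt) (fun z hz => by
      rw [fderivWithin_of_isOpen Metric.isOpen_ball hz]
      ext
      simp [(hh z hz).hasFDerivAt.fderiv]) hz (Metric.mem_ball_self hR)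
  simp only [hg0, neg_zero, Complex.exp_zero, mul_one] at hc
  rw [← hc, mul_assoc, ← Complex.exp_add]
  simp

lemma norm_logDeriv_le_of_ne_zero {f : ℂ → ℂ} {K : ℝ} (hK : 0 ≤ K)
    (hf : DifferentiableOn ℂ f (Metric.ball 0 2))
    (hb : ∀ z ∈ Metric.closedBall (0 : ℂ) (7 / 4), ‖f z‖ ≤ ‖f 0‖ * Real.exp K)
    (h0 : ∀ z ∈ Metric.ball (0 : ℂ) (13 / 8), f z ≠ 0) {z : ℂ} (hz : ‖z‖ ≤ 3 / 2) :
    ‖deriv f z / f z‖ ≤ 800 * K := by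
  obtain ⟨g, hg0, hg, hfg⟩ := exists_log_of_ne_zero (by norm_num)
    (hf.mono (Metric.ball_subset_ball (by norm_num))) h0
  have hf0 : 0 < ‖f 0‖ := norm_pos_iff.2 (h0 0 (Metric.mem_ball_self (by norm_num)))
  have hre : ∀ w ∈ Metric.ball (0 : ℂ) (13 / 8), (g w).re ≤ K := by
    intro w hw
    have h1 := hb w (by simp only [Metric.mem_ball, Metric.mem_closedBall] at *; linarith)
    rw [hfg w hw, norm_mul, Complex.norm_exp] at h1
    exact Real.exp_le_exp.1 (le_of_mul_le_mul_left h1 hf0)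
  refine le_of_forall_pos_le_add fun δ hδ => ?_
  have hgd : DifferentiableOn ℂ g (Metric.ball 0 (13 / 8)) := fun w hw =>
    (hg w hw).differentiableAt.differentiableWithinAt
  have hbc : ∀ w ∈ Metric.closedBall z (1 / 16), ‖g w‖ ≤ 50 * (K + δ / 800) := by
    intro w hw
    have hw' : ‖w‖ ≤ 25 / 16 := by
      have := norm_le_norm_add_norm_sub' w z
      rw [Metric.mem_closedBall, dist_eq_norm] at hw
      linarith
    have h2 := Complex.borelCaratheodory_zero (M := K + δ / 800) (by positivity) hgd
      (fun w hw => by have := hre w hw; simp only [Set.mem_ofPred_eq]; linarith [div_pos hδ (by norm_num : (0:ℝ) < 800)])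
      (by norm_num) (z := w) (by simp only [Metric.mem_ball, dist_zero_right]; linarith) hg0
    refine h2.trans ?_
    rw [div_le_iff₀ (by linarith)]
    have hp : 0 < K + δ / 800 := by positivity
    nlinarith
  have hsub : Metric.closedBall z (1 / 16) ⊆ Metric.ball 0 (13 / 8) := by
    intro w hw
    have := norm_le_norm_add_norm_sub' w z
    rw [Metric.mem_closedBall, dist_eq_norm] at hw
    simp only [Metric.mem_ball, dist_zero_right]; linarith
  have hz' : z ∈ Metric.ball (0 : ℂ) (13 / 8) := hsub (Metric.mem_closedBall_self (by norm_num))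
  have hdd := Complex.norm_deriv_le_of_forall_mem_sphere_norm_le (f := g) (c := z) (R := 1 / 16)
    (C := 50 * (K + δ / 800)) (by norm_num)
    ((hgd.mono hsub).diffContOnCl_ball (le_refl _))
    (fun w hw => hbc w (Metric.sphere_subset_closedBall hw))
  rw [(hg z hz').deriv] at hdd
  refine hdd.trans (le_of_eq ?_)
  ring

lemma nonneg_of_norm_le_mul_exp {f : ℂ → ℂ} {K : ℝ} (hf0 : f 0 ≠ 0)
    (hb : ∀ z ∈ Metric.closedBall (0 : ℂ) (7 / 4), ‖f z‖ ≤ ‖f 0‖ * Real.exp K) : 0 ≤ K := by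
  have := hb 0 (by simp; norm_num)
  have h0 := norm_pos_iff.2 hf0
  have h2 : 1 ≤ Real.exp K := by
    by_contra! h; nlinarith
  exact Real.one_le_exp_iff.1 h2

lemma logDeriv_bounds_of_ne_zero {f : ℂ → ℂ} {K a : ℝ} (hK : 0 ≤ K)
    (hf : DifferentiableOn ℂ f (Metric.ball 0 2))
    (hb : ∀ z ∈ Metric.closedBall (0 : ℂ) (7 / 4), ‖f z‖ ≤ ‖f 0‖ * Real.exp K)
    (h0 : ∀ z ∈ Metric.ball (0 : ℂ) (13 / 8), f z ≠ 0) {z : ℂ} (hz : ‖z‖ ≤ 3 / 2)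
    (hza : a < z.re) :
    -(800 * K) ≤ (deriv f z / f z).re ∧
      ‖deriv f z / f z‖ ≤ 800 * (1 + 1 / (z.re - a)) * K := by
  have h := norm_logDeriv_le_of_ne_zero hK hf hb h0 hz
  have hp : 0 < 1 / (z.re - a) := one_div_pos.2 (by linarith)
  constructor
  · have := (abs_le.1 (Complex.abs_re_le_norm (deriv f z / f z))).1
    linarith
  · nlinarith [mul_nonneg hp.le hK]

lemma exists_div_zero {f : ℂ → ℂ} {K a : ℝ} {ρ : ℂ} (hρ : ‖ρ‖ < 13 / 8) (hfρ : f ρ = 0)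
    (hf0 : f 0 ≠ 0) (hf : DifferentiableOn ℂ f (Metric.ball 0 2))
    (hb : ∀ z ∈ Metric.closedBall (0 : ℂ) (7 / 4), ‖f z‖ ≤ ‖f 0‖ * Real.exp K)
    (hzero : ∀ z ∈ Metric.ball (0 : ℂ) (13 / 8), f z = 0 → z.re = a) :
    ∃ (f1 : ℂ → ℂ) (K1 : ℝ), K1 ≤ K - 1 / 14 ∧ 0 ≤ K1 ∧ f1 0 ≠ 0 ∧
      DifferentiableOn ℂ f1 (Metric.ball 0 2) ∧
      (∀ z ∈ Metric.closedBall (0 : ℂ) (7 / 4), ‖f1 z‖ ≤ ‖f1 0‖ * Real.exp K1) ∧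
      (∀ z ∈ Metric.ball (0 : ℂ) (13 / 8), f1 z = 0 → z.re = a) ∧
      ∀ z : ℂ, ‖z‖ ≤ 3 / 2 → f z ≠ 0 → ∃ c : ℂ, ‖c‖ ≤ 13 / 5 ∧
        deriv f z / f z = deriv f1 z / f1 z + 1 / (z - ρ) + c := by
  have hρ0 : ρ ≠ 0 := fun h => hf0 (h ▸ hfρ)
  have hρn : 0 < ‖ρ‖ := norm_pos_iff.2 hρ0
  have hρmem : ρ ∈ Metric.ball (0 : ℂ) 2 := by
    simp only [Metric.mem_ball, dist_zero_right]; linarith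
  have hds : DifferentiableOn ℂ (dslope f ρ) (Metric.ball 0 2) :=
    (Complex.differentiableOn_dslope (Metric.isOpen_ball.mem_nhds hρmem)).2 hf
  set E : ℂ → ℂ := fun z => (49 / 16 - (starRingEnd ℂ) ρ * z) / (7 / 4) with hE
  have hEd : Differentiable ℂ E := by
    intro z; simp only [hE]; fun_prop
  have hEn : ∀ z : ℂ, ‖z‖ ≤ 7 / 4 → 49 / 16 - ‖ρ‖ * ‖z‖ ≤ 7 / 4 * ‖E z‖ := by
    intro z hz
    have : ‖E z‖ = ‖(49 / 16 - (starRingEnd ℂ) ρ * z)‖ / (7 / 4) := by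
      simp only [hE, norm_div]; norm_num
    rw [this]
    have h2 := norm_sub_norm_le (49 / 16 : ℂ) ((starRingEnd ℂ) ρ * z)
    rw [norm_mul, RCLike.norm_conj] at h2
    have h3 : ‖(49 / 16 : ℂ)‖ = 49 / 16 := by norm_num
    rw [h3] at h2
    linarith
  have hEne : ∀ z : ℂ, ‖z‖ ≤ 7 / 4 → E z ≠ 0 := by
    intro z hz h
    have := hEn z hz
    rw [h, norm_zero] at this
    nlinarith [norm_nonneg z]
  have hfd : ∀ z, f z = (z - ρ) * dslope f ρ z := by
    intro z
    have := sub_smul_dslope f ρ z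
    rw [hfρ, sub_zero, smul_eq_mul] at this
    exact this.symm
  set f1 : ℂ → ℂ := fun z => dslope f ρ z * E z with hf1
  have hf1d : DifferentiableOn ℂ f1 (Metric.ball 0 2) := hds.mul hEd.differentiableOn
  have hE0 : E 0 = 7 / 4 := by simp only [hE]; norm_num
  have h0f : ‖f 0‖ = ‖ρ‖ * ‖dslope f ρ 0‖ := by rw [hfd 0]; simp
  have h0f1 : ‖f1 0‖ = 7 / 4 * ‖dslope f ρ 0‖ := by
    simp only [hf1, hE0, norm_mul]; norm_num; ring
  have hf0' : 0 < ‖f 0‖ := norm_pos_iff.2 hf0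
  have hds0 : 0 < ‖dslope f ρ 0‖ := by
    rw [h0f] at hf0'; exact pos_of_mul_pos_right hf0' (norm_nonneg _)
  have hf10 : 0 < ‖f1 0‖ := by rw [h0f1]; positivity
  set K1 := K - Real.log (7 / 4 / ‖ρ‖) with hK1
  have hexp : ‖f1 0‖ * Real.exp K1 = ‖f 0‖ * Real.exp K := by
    rw [hK1, Real.exp_sub, Real.exp_log (by positivity), h0f, h0f1]
    field_simp
  have hbd : ∀ z ∈ Metric.closedBall (0 : ℂ) (7 / 4), ‖f1 z‖ ≤ ‖f1 0‖ * Real.exp K1 := by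
    intro z hz
    refine Complex.norm_le_of_forall_mem_frontier_norm_le (U := Metric.ball 0 (7 / 4))
      Metric.isBounded_ball ?_ ?_ ?_
    · exact (hf1d.mono (Metric.closedBall_subset_ball (by norm_num))).diffContOnCl_ball
        (le_refl _)
    · rw [frontier_ball _ (by norm_num)]
      intro w hw
      rw [hexp]
      refine le_trans (le_of_eq ?_) (hb w (Metric.sphere_subset_closedBall hw))
      have hwn : ‖w‖ = 7 / 4 := by simpa using hw
      rw [hfd w]
      simp only [hf1, norm_mul]
      rw [mul_comm]
      congr 1
      have hw2 : w * (starRingEnd ℂ) w = 49 / 16 := by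
        rw [Complex.mul_conj, Complex.normSq_eq_norm_sq, hwn]; norm_num
      have : E w = w * (starRingEnd ℂ) (w - ρ) / (7 / 4) := by
        simp only [hE, map_sub, mul_sub, hw2]; ring
      rw [this, norm_div, norm_mul, RCLike.norm_conj, hwn]
      norm_num
    · rw [closure_ball _ (by norm_num)]; exact hz
  refine ⟨f1, K1, ?_, ?_, norm_pos_iff.1 hf10, hf1d, hbd, ?_, ?_⟩
  · have h1 : (14 : ℝ) / 13 ≤ 7 / 4 / ‖ρ‖ := by
      rw [le_div_iff₀ hρn]; linarith
    have h2 := Real.one_sub_inv_le_log_of_pos (x := 7 / 4 / ‖ρ‖) (by positivity)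
    have h3 : (7 / 4 / ‖ρ‖)⁻¹ ≤ 13 / 14 := by
      rw [inv_le_comm₀ (by positivity) (by norm_num)]; linarith
    rw [hK1]; linarith
  · have := hbd 0 (by simp; norm_num)
    have h2 : 1 ≤ Real.exp K1 := by
      by_contra! h; nlinarith
    exact Real.one_le_exp_iff.1 h2
  · intro z hz h
    have hz' : ‖z‖ ≤ 7 / 4 := by
      simp only [Metric.mem_ball, dist_zero_right] at hz; linarith
    have h1 : dslope f ρ z = 0 := (mul_eq_zero.1 h).resolve_right (hEne z hz')
    exact hzero z hz (by rw [hfd, h1, mul_zero])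
  · intro z hz hfz
    have hz' : ‖z‖ ≤ 7 / 4 := by linarith
    have hzm : z ∈ Metric.ball (0 : ℂ) 2 := by
      simp only [Metric.mem_ball, dist_zero_right]; linarith
    have hE1 := hEne z hz'
    have hzr : z - ρ ≠ 0 := fun h => hfz (by rw [hfd, h, zero_mul])
    have hd0 : dslope f ρ z ≠ 0 := fun h => hfz (by rw [hfd, h, mul_zero])
    have hdd := (hds.differentiableAt (Metric.isOpen_ball.mem_nhds hzm))
    have e1 : logDeriv f z = 1 / (z - ρ) + logDeriv (dslope f ρ) z := by
      have : f = fun z => (z - ρ) * dslope f ρ z := funext hfd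
      conv_lhs => rw [this]
      rw [logDeriv_mul z hzr hd0 (by fun_prop) hdd, logDeriv_apply]
      simp
    have e2 : logDeriv f1 z = logDeriv (dslope f ρ) z + logDeriv E z :=
      logDeriv_mul z hd0 hE1 hdd hEd.differentiableAt
    refine ⟨-logDeriv E z, ?_, ?_⟩
    · have hE' : deriv E z = -(starRingEnd ℂ) ρ / (7 / 4) := by
        have : HasDerivAt E ((0 - (starRingEnd ℂ) ρ * 1) / (7 / 4)) z := by
          refine HasDerivAt.div_const ?_ _
          exact (hasDerivAt_const z _).sub ((hasDerivAt_id z).const_mul _)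
        rw [this.deriv]; ring
      rw [norm_neg, logDeriv_apply, norm_div, hE', norm_div, norm_neg, RCLike.norm_conj]
      have := hEn z hz'
      have hpos : 0 < ‖E z‖ := norm_pos_iff.2 hE1
      rw [div_le_iff₀ hpos]
      have : ‖(7 / 4 : ℂ)‖ = 7 / 4 := by norm_num
      rw [this]
      nlinarith [norm_nonneg z]
    · rw [← logDeriv_apply, ← logDeriv_apply, e1, e2]; ring

lemma logDeriv_bounds_aux (a : ℝ) (n : ℕ) : ∀ (f : ℂ → ℂ) (K : ℝ), K ≤ n / 14 → f 0 ≠ 0 →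
    DifferentiableOn ℂ f (Metric.ball 0 2) →
    (∀ z ∈ Metric.closedBall (0 : ℂ) (7 / 4), ‖f z‖ ≤ ‖f 0‖ * Real.exp K) →
    (∀ z ∈ Metric.ball (0 : ℂ) (13 / 8), f z = 0 → z.re = a) →
    ∀ z : ℂ, ‖z‖ ≤ 3 / 2 → a < z.re →
      -(800 * K) ≤ (deriv f z / f z).re ∧ ‖deriv f z / f z‖ ≤ 800 * (1 + 1 / (z.re - a)) * K := by
  induction n with
  | zero => 
    intro f K hKn hf0 hf hb hzero z hz hza
    have hK : 0 ≤ K := nonneg_of_norm_le_mul_exp hf0 hb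
    by_cases hne : ∀ z ∈ Metric.ball (0 : ℂ) (13 / 8), f z ≠ 0
    · exact logDeriv_bounds_of_ne_zero hK hf hb hne hz hza
    · push Not at hne
      obtain ⟨ρ, hρ, hfρ⟩ := hne
      obtain ⟨f1, K1, h1, h2, -⟩ := exists_div_zero (by simpa using hρ) hfρ hf0 hf hb hzero
      norm_num at hKn
      linarith
  | succ n ih => 
    intro f K hKn hf0 hf hb hzero z hz hza
    have hK : 0 ≤ K := nonneg_of_norm_le_mul_exp hf0 hb
    by_cases hne : ∀ z ∈ Metric.ball (0 : ℂ) (13 / 8), f z ≠ 0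
    · exact logDeriv_bounds_of_ne_zero hK hf hb hne hz hza
    · push Not at hne
      obtain ⟨ρ, hρ, hfρ⟩ := hne
      obtain ⟨f1, K1, h1, h2, h3, h4, h5, h6, h7⟩ :=
        exists_div_zero (by simpa using hρ) hfρ hf0 hf hb hzero
      push_cast at hKn
      obtain ⟨i1, i2⟩ := ih f1 K1 (by linarith) h3 h4 h5 h6 z hz hza
      have hfz : f z ≠ 0 := fun h => by
        have := hzero z (by simp only [Metric.mem_ball, dist_zero_right]; linarith) h
        linarith
      obtain ⟨c, hc, he⟩ := h7 z hz hfz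
      have hρa := hzero ρ hρ hfρ
      have hzρ : (z - ρ).re = z.re - a := by rw [Complex.sub_re, hρa]
      have hpos : 0 < z.re - a := by linarith
      have hnorm : z.re - a ≤ ‖z - ρ‖ := hzρ ▸ Complex.re_le_norm _
      have hre : 0 ≤ (1 / (z - ρ)).re := by
        rw [one_div, Complex.inv_re, hzρ]
        exact div_nonneg hpos.le (Complex.normSq_nonneg _)
      have hcr := (abs_le.1 (Complex.abs_re_le_norm c)).1
      have hinv : ‖1 / (z - ρ)‖ ≤ 1 / (z.re - a) := by
        rw [norm_div, norm_one]
        exact one_div_le_one_div_of_le hpos hnorm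
      rw [he]
      constructor
      · rw [Complex.add_re, Complex.add_re]; linarith
      · refine (norm_add₃_le).trans ?_
        have hp : 0 < 1 / (z.re - a) := by positivity
        nlinarith

lemma logDeriv_bounds {a K : ℝ} {f : ℂ → ℂ} (hf0 : f 0 ≠ 0)
    (hf : DifferentiableOn ℂ f (Metric.ball 0 2))
    (hb : ∀ z ∈ Metric.closedBall (0 : ℂ) (7 / 4), ‖f z‖ ≤ ‖f 0‖ * Real.exp K)
    (hzero : ∀ z ∈ Metric.ball (0 : ℂ) (13 / 8), f z = 0 → z.re = a)
    {z : ℂ} (hz : ‖z‖ ≤ 3 / 2) (hza : a < z.re) :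
      -(800 * K) ≤ (deriv f z / f z).re ∧
        ‖deriv f z / f z‖ ≤ 800 * (1 + 1 / (z.re - a)) * K := by
  obtain ⟨n, hn⟩ := exists_nat_ge (K * 14)
  exact logDeriv_bounds_aux a n f K (by rw [le_div_iff₀ (by norm_num)]; exact hn) hf0 hf hb hzero
    z hz hza

lemma norm_LFunction_ge {q : ℕ} [NeZero q] (χ : DirichletCharacter ℂ q) {s : ℂ} (hs : 2 ≤ s.re) :
    1 / 4 ≤ ‖DirichletCharacter.LFunction χ s‖ := by
  have hs1 : 1 < s.re := by linarith
  rw [DirichletCharacter.LFunction_eq_LSeries χ hs1]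
  have hsum := DirichletCharacter.LSeriesSummable_of_one_lt_re χ hs1
  have h1 : LSeries (fun n => χ n) s = 1 + ∑' n, if n = 1 then 0 else
      LSeries.term (fun n => χ n) s n := by
    rw [LSeries, hsum.tsum_eq_add_tsum_ite 1]
    simp [LSeries.term]
  have h2 : HasSum (fun n : ℕ => if n = 1 then (0 : ℝ) else 1 / (n : ℝ) ^ 2)
      (Real.pi ^ 2 / 6 - 1) := by
    have := hasSum_zeta_two.sub (hasSum_ite_eq (1 : ℕ) (1 : ℝ))
    have he : (fun n : ℕ => if n = 1 then (0 : ℝ) else 1 / (n : ℝ) ^ 2) =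
        fun n : ℕ => 1 / (n : ℝ) ^ 2 - if n = 1 then (1 : ℝ) else 0 := by
      funext n
      split_ifs with h <;> simp [h]
    rw [he]
    exact this
  have h3 : ‖∑' n, (if n = 1 then 0 else LSeries.term (fun n => χ n) s n)‖ ≤
      Real.pi ^ 2 / 6 - 1 := by
    refine tsum_of_norm_bounded h2 fun n => ?_
    split_ifs with h
    · simp
    · rcases Nat.eq_zero_or_pos n with rfl | hn
      · simp
      · rw [LSeries.norm_term_eq, if_neg hn.ne']
        have : (n : ℝ) ^ 2 ≤ (n : ℝ) ^ s.re := by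
          rw [← Real.rpow_natCast]
          exact Real.rpow_le_rpow_of_exponent_le (by exact_mod_cast hn) (by exact_mod_cast hs)
        have hn' : (0 : ℝ) < n := by exact_mod_cast hn
        gcongr
        exact χ.norm_le_one _
  have h4 := norm_sub_le_norm_add (1 : ℂ) (∑' n, (if n = 1 then 0 else LSeries.term (fun n => χ n) s n))
  have hpi := Real.pi_lt_d2
  have hpi2 : Real.pi ^ 2 < 10 := by nlinarith [Real.pi_pos]
  rw [h1]
  rw [norm_one] at h4
  linarith

lemma LFunction_ne_zero_of_GRH (hGRH : GRH) {q : ℕ} [NeZero q] {χ : DirichletCharacter ℂ q}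
    (hχ : χ ≠ 1) {s : ℂ} (hs : 1 / 2 < s.re) : DirichletCharacter.LFunction χ s ≠ 0 := by
  intro h
  rcases lt_or_ge s.re 1 with h1 | h1
  · have := hGRH q χ s h (by linarith) h1
    linarith
  · exact DirichletCharacter.LFunction_ne_zero_of_one_le_re χ (Or.inl hχ) h1 h

lemma exists_norm_logDeriv_LFunction_le : ∃ C : ℝ, 0 < C ∧ ∀ (q : ℕ) [NeZero q]
    (χ : DirichletCharacter ℂ q) (s : ℂ), 2 ≤ s.re →
    ‖deriv (DirichletCharacter.LFunction χ) s / DirichletCharacter.LFunction χ s‖ ≤ C := by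
  have hs2 : Summable fun n => ‖LSeries.term (fun n => (ArithmeticFunction.vonMangoldt n : ℂ)) 2 n‖ := by
    have := (ArithmeticFunction.LSeriesSummable_vonMangoldt (s := 2) (by simp)).norm
    exact this
  refine ⟨(∑' n, ‖LSeries.term (fun n => (ArithmeticFunction.vonMangoldt n : ℂ)) 2 n‖) + 1, by positivity, ?_⟩
  intro q _ χ s hs
  have hs1 : 1 < s.re := by linarith
  have h := DirichletCharacter.LSeries_twist_vonMangoldt_eq χ hs1
  rw [DirichletCharacter.LFunction_eq_LSeries χ hs1,
    DirichletCharacter.deriv_LFunction_eq_deriv_LSeries χ hs1]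
  have h' : deriv (LSeries fun n => χ n) s / LSeries (fun n => χ n) s = - LSeries ((fun n : ℕ => χ n) *
    fun n : ℕ => (ArithmeticFunction.vonMangoldt n : ℂ)) s := by
    rw [h]; ring
  rw [h', norm_neg]
  refine le_trans (tsum_of_norm_bounded hs2.hasSum fun n => ?_) (by linarith)
  rw [LSeries.norm_term_eq, LSeries.norm_term_eq]
  rcases Nat.eq_zero_or_pos n with rfl | hn
  · simp
  · have hn' : (1 : ℝ) ≤ n := by exact_mod_cast hn
    rw [if_neg hn.ne', if_neg hn.ne', Pi.mul_apply, norm_mul]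
    have : ‖χ n‖ ≤ 1 := χ.norm_le_one _
    have h0 : (0 : ℝ) < n := by linarith
    have h5 : (n : ℝ) ^ (2 : ℂ).re ≤ (n : ℝ) ^ s.re :=
      Real.rpow_le_rpow_of_exponent_le hn' hs
    exact div_le_div₀ (norm_nonneg _) (mul_le_of_le_one_left (norm_nonneg _) this)
      (Real.rpow_pos_of_pos h0 _) h5

lemma exists_logDeriv_LFunction_bounds (hGRH : GRH) : ∃ C : ℝ, 0 < C ∧ ∀ (q : ℕ) [NeZero q]
    (χ : DirichletCharacter ℂ q), χ ≠ 1 → ∀ s : ℂ, 1 / 2 < s.re →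
    -(C * Real.log (q * (|s.im| + 3))) ≤
      (deriv (DirichletCharacter.LFunction χ) s / DirichletCharacter.LFunction χ s).re ∧
    ‖deriv (DirichletCharacter.LFunction χ) s / DirichletCharacter.LFunction χ s‖ ≤
      C * (1 + 1 / (s.re - 1 / 2)) * Real.log (q * (|s.im| + 3)) := by
  obtain ⟨C0, hC0, hC⟩ := exists_norm_logDeriv_LFunction_le
  refine ⟨4000 + C0, by positivity, ?_⟩
  intro q _ χ hχ s hs
  have hq : (1 : ℝ) ≤ q := by exact_mod_cast NeZero.one_le
  set X : ℝ := q * (|s.im| + 3) with hX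
  have hX3 : 3 ≤ X := by nlinarith [abs_nonneg s.im]
  have hlog : 1 ≤ Real.log X := by
    rw [Real.le_log_iff_exp_le (by linarith)]
    linarith [Real.exp_one_lt_d9]
  have hpos : 0 < 1 / (s.re - 1 / 2) := one_div_pos.2 (by linarith)
  rcases lt_or_ge s.re 2 with h2 | h2
  · set c : ℂ := 2 + s.im * I with hc
    set f : ℂ → ℂ := fun z => DirichletCharacter.LFunction χ (z + c) with hf
    have hfd : Differentiable ℂ f :=
      (DirichletCharacter.differentiable_LFunction hχ).comp (differentiable_id.add_const c)
    have hcre : c.re = 2 := by simp [hc]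
    have hf0 : 1 / 4 ≤ ‖f 0‖ := by
      simp only [hf, zero_add]
      exact norm_LFunction_ge χ (by simp [hcre])
    have hb : ∀ z ∈ Metric.closedBall (0 : ℂ) (7 / 4), ‖f z‖ ≤ ‖f 0‖ * Real.exp (5 * Real.log X) := by
      intro z hz
      have hz' : ‖z‖ ≤ 7 / 4 := by simpa using hz
      have hre : 1 / 4 ≤ (z + c).re := by
        rw [Complex.add_re, hcre]
        have := (abs_le.1 (Complex.abs_re_le_norm z)).1
        linarith
      have hn : ‖z + c‖ ≤ |s.im| + 4 := by
        have h1 : ‖c‖ ≤ 2 + |s.im| := by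
          refine (norm_add_le _ _).trans ?_
          simp
        have := norm_add_le z c
        linarith
      have h1 := norm_LFunction_le hχ (s := z + c) (by linarith)
      have h3 : q * ‖z + c‖ / (z + c).re ≤ 8 * X := by
        rw [div_le_iff₀ (by linarith)]
        have : q * ‖z + c‖ ≤ 2 * X := by
          rw [hX]; nlinarith [abs_nonneg s.im]
        nlinarith
      have h4 : Real.exp (5 * Real.log X) = X ^ 5 := by
        rw [mul_comm, Real.exp_mul, Real.exp_log (by linarith)]; norm_cast
      rw [h4]
      have h5 : 32 * X ≤ X ^ 5 := by
        have : (81 : ℝ) ≤ X ^ 4 := by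
          calc (81 : ℝ) = 3 ^ 4 := by norm_num
            _ ≤ X ^ 4 := by gcongr
        nlinarith
      have : 1 / 4 * (32 * X) ≤ ‖f 0‖ * X ^ 5 := by gcongr
      simp only [hf] at this ⊢
      linarith
    have hf0' : f 0 ≠ 0 := norm_pos_iff.1 (by linarith)
    have g1 : ∀ z ∈ Metric.ball (0 : ℂ) (13 / 8), f z = 0 → z.re = -3 / 2 := by
      intro z hz h
      have hz' : ‖z‖ < 13 / 8 := by simpa using hz
      have hre : 1 / 4 ≤ (z + c).re := by
        rw [Complex.add_re, hcre]
        have := (abs_le.1 (Complex.abs_re_le_norm z)).1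
        linarith
      have h1 : (z + c).re < 1 := by
        by_contra! h1
        exact DirichletCharacter.LFunction_ne_zero_of_one_le_re χ (Or.inl hχ) h1 h
      have := hGRH q χ (z + c) h (by linarith) h1
      rw [Complex.add_re, hcre] at this
      linarith
    have g2 : ‖s - c‖ ≤ 3 / 2 := by
      have : s - c = ((s.re - 2 : ℝ) : ℂ) := by
        apply Complex.ext <;> simp [hc]
      rw [this, Complex.norm_real, Real.norm_eq_abs, abs_le]
      constructor <;> linarith
    have g3 : -3 / 2 < (s - c).re := by
      rw [Complex.sub_re, hcre]; linarith
    obtain ⟨i1, i2⟩ := logDeriv_bounds hf0' hfd.differentiableOn hb g1 g2 g3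
    have hfs : f (s - c) = DirichletCharacter.LFunction χ s := by simp [hf]
    have hfs' : deriv f (s - c) = deriv (DirichletCharacter.LFunction χ) s := by
      simp only [hf]
      rw [deriv_comp_add_const]; simp
    rw [hfs, hfs'] at i1 i2
    rw [Complex.sub_re, hcre] at i2
    constructor
    · nlinarith
    · refine i2.trans ?_
      have : s.re - 2 - -3 / 2 = s.re - 1 / 2 := by ring
      rw [this]
      have : 0 < (1 + 1 / (s.re - 1 / 2)) * Real.log X := by positivity
      nlinarith
  · have h := hC q χ s h2
    constructor
    · have := (abs_le.1 (Complex.abs_re_le_norm (deriv (DirichletCharacter.LFunction χ) s /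
        DirichletCharacter.LFunction χ s))).1
      nlinarith
    · refine h.trans ?_
      have : 1 * 1 ≤ (1 + 1 / (s.re - 1 / 2)) * Real.log X := by gcongr; linarith
      nlinarith

lemma integral_tri_exp {a : ℂ} (ha : a ≠ 0) :
    ∫ x : ℝ, Complex.exp (a * x) * ((max 0 (1 - |x|) : ℝ) : ℂ) =
      (Complex.exp a + Complex.exp (-a) - 2) / a ^ 2 := by
  have hsupp : ∀ x : ℝ, x ∉ Set.Ioc (-1 : ℝ) 1 →
      Complex.exp (a * x) * ((max 0 (1 - |x|) : ℝ) : ℂ) = 0 := by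
    intro x hx
    have : 1 - |x| ≤ 0 := by
      rw [sub_nonpos]
      by_contra! h
      rw [abs_lt] at h
      exact hx ⟨h.1, h.2.le⟩
    simp [max_eq_left this]
  rw [← setIntegral_eq_integral_of_forall_compl_eq_zero hsupp,
    ← intervalIntegral.integral_of_le (by norm_num)]
  have hcont : Continuous fun x : ℝ => Complex.exp (a * x) * ((max 0 (1 - |x|) : ℝ) : ℂ) := by
    fun_prop
  rw [← intervalIntegral.integral_add_adjacent_intervals (b := 0)
    (hcont.intervalIntegrable _ _) (hcont.intervalIntegrable _ _)]
  have hx : ∀ x : ℝ, HasDerivAt (fun x : ℝ => (x : ℂ)) 1 x := fun x => Complex.ofRealCLM.hasDerivAt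
  have he : ∀ x : ℝ, HasDerivAt (fun x : ℝ => Complex.exp (a * x)) (Complex.exp (a * x) * (a * 1)) x :=
    fun x => ((hx x).const_mul a).cexp
  have h1 : ∫ x in (-1 : ℝ)..0, Complex.exp (a * x) * ((max 0 (1 - |x|) : ℝ) : ℂ) =
      1 / a - 1 / a ^ 2 + Complex.exp (-a) / a ^ 2 := by
    have : ∀ x : ℝ, HasDerivAt (fun x : ℝ => ((1 + x) / a - 1 / a ^ 2) * Complex.exp (a * x))
        (Complex.exp (a * x) * (1 + x)) x := by
      intro x
      refine (((((hx x).const_add 1).div_const a).sub_const _).mul (he x)).congr_deriv ?_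
      field_simp
      ring
    have h := intervalIntegral.integral_eq_sub_of_hasDerivAt (a := -1) (b := 0)
      (fun x _ => this x) (Continuous.intervalIntegrable (by fun_prop) _ _)
    rw [intervalIntegral.integral_congr (g := fun x : ℝ => Complex.exp (a * x) * (1 + x)), h]
    · simp; ring_nf
    · intro x hx
      rw [Set.uIcc_of_le (by norm_num)] at hx
      simp only
      rw [abs_of_nonpos hx.2, max_eq_right (by linarith [hx.1])]
      push_cast; ring
  have h2 : ∫ x in (0 : ℝ)..1, Complex.exp (a * x) * ((max 0 (1 - |x|) : ℝ) : ℂ) =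
      Complex.exp a / a ^ 2 - 1 / a - 1 / a ^ 2 := by
    have : ∀ x : ℝ, HasDerivAt (fun x : ℝ => ((1 - x) / a + 1 / a ^ 2) * Complex.exp (a * x))
        (Complex.exp (a * x) * (1 - x)) x := by
      intro x
      refine (((((hx x).const_sub 1).div_const a).add_const _).mul (he x)).congr_deriv ?_
      field_simp
      ring
    have h := intervalIntegral.integral_eq_sub_of_hasDerivAt (a := 0) (b := 1)
      (fun x _ => this x) (Continuous.intervalIntegrable (by fun_prop) _ _)
    rw [intervalIntegral.integral_congr (g := fun x : ℝ => Complex.exp (a * x) * (1 - x)), h]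
    · simp; ring_nf
    · intro x hx
      rw [Set.uIcc_of_le (by norm_num)] at hx
      simp only
      rw [abs_of_nonneg hx.1, max_eq_right (by linarith [hx.2])]
      push_cast; ring
  rw [h1, h2]
  field_simp
  ring

open FourierTransform in
lemma exists_fejer : ∃ K : ℝ → ℝ, Continuous K ∧ (∀ w, 0 ≤ K w) ∧
    (∀ w, K w ≤ 4 * (1 + w ^ 2)⁻¹) ∧
    ∀ x : ℝ, ∫ w : ℝ, Complex.exp (2 * Real.pi * w * x * I) * K w =
      ((max 0 (1 - |x|) : ℝ) : ℂ) := by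
  set tri : ℝ → ℂ := fun x => ((max 0 (1 - |x|) : ℝ) : ℂ) with htri
  have hc : Continuous tri := by simp only [htri]; fun_prop
  have hsupp : ∀ x : ℝ, x ∉ Set.Icc (-1 : ℝ) 1 → tri x = 0 := by
    intro x hx
    have : 1 - |x| ≤ 0 := by
      rw [sub_nonpos]
      by_contra! h
      rw [abs_lt] at h
      exact hx ⟨h.1.le, h.2.le⟩
    simp [htri, max_eq_left this]
  have hcs : HasCompactSupport tri := HasCompactSupport.intro isCompact_Icc hsupp
  have hint : Integrable tri := hc.integrable_of_hasCompactSupport hcs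
  have hF : Continuous (𝓕 tri) :=
    VectorFourier.fourierIntegral_continuous Real.continuous_fourierChar (by fun_prop) hint
  have hFb : ∀ w, ‖𝓕 tri w‖ ≤ 2 := by
    intro w
    refine (VectorFourier.norm_fourierIntegral_le_integral_norm _ _ _ tri w).trans ?_
    have : ∫ x, ‖tri x‖ = ∫ x in Set.Icc (-1 : ℝ) 1, ‖tri x‖ :=
      (setIntegral_eq_integral_of_forall_compl_eq_zero fun x hx => by rw [hsupp x hx, norm_zero]).symm
    rw [this]
    have h2 : ∫ x in Set.Icc (-1 : ℝ) 1, ‖tri x‖ ≤ ∫ x in Set.Icc (-1 : ℝ) 1, (1 : ℝ) := by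
      refine setIntegral_mono_on hint.norm.integrableOn (by simp) measurableSet_Icc fun x _ => ?_
      simp only [htri, Complex.norm_real, Real.norm_eq_abs]
      rw [abs_of_nonneg (le_max_left _ _)]
      exact max_le (by norm_num) (by linarith [abs_nonneg x])
    refine h2.trans ?_
    simp; norm_num
  have hFeq : ∀ w : ℝ, w ≠ 0 → 𝓕 tri w =
      (((1 - Real.cos (2 * Real.pi * w)) / (2 * Real.pi ^ 2 * w ^ 2) : ℝ) : ℂ) := by
    intro w hw
    rw [Real.fourier_real_eq_integral_exp_smul]
    have ha : (-(2 * Real.pi * w * I) : ℂ) ≠ 0 := by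
      have := Real.pi_ne_zero
      simp [hw]
    have h := integral_tri_exp ha
    have h3 : ∫ v : ℝ, Complex.exp (((-2 * Real.pi * v * w : ℝ) : ℂ) * I) • tri v =
      ∫ x : ℝ, Complex.exp (-(2 * Real.pi * w * I) * x) * ((max 0 (1 - |x|) : ℝ) : ℂ) := by
      refine integral_congr_ae (Filter.Eventually.of_forall fun x => ?_)
      simp only [htri, smul_eq_mul]
      congr 2
      push_cast; ring
    rw [h3, h]
    have hcos : Complex.exp (-(2 * Real.pi * w * I)) + Complex.exp (- -(2 * Real.pi * w * I)) =
        2 * Complex.cos (2 * Real.pi * w) := by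
      rw [Complex.two_cos, neg_neg]; ring_nf
    rw [hcos]
    push_cast
    have : (-(2 * Real.pi * w * I) : ℂ) ^ 2 = - (4 * Real.pi ^ 2 * w ^ 2) := by
      ring_nf; rw [I_sq]; ring
    rw [this]
    have hpi : (Real.pi : ℂ) ≠ 0 := by exact_mod_cast Real.pi_ne_zero
    have hw' : (w : ℂ) ≠ 0 := by exact_mod_cast hw
    field_simp
    ring
  have hFdense : ∀ w : ℝ, 𝓕 tri w = (((𝓕 tri w).re : ℝ) : ℂ) ∧ 0 ≤ (𝓕 tri w).re := by
    have hcl : IsClosed {w : ℝ | 𝓕 tri w = (((𝓕 tri w).re : ℝ) : ℂ) ∧ 0 ≤ (𝓕 tri w).re} := by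
      have hre : Continuous fun w => (𝓕 tri w).re := Complex.continuous_re.comp hF
      exact (isClosed_eq hF (Complex.continuous_ofReal.comp hre)).inter
        (isClosed_le continuous_const hre)
    have hsub : ({0}ᶜ : Set ℝ) ⊆
        {w : ℝ | 𝓕 tri w = (((𝓕 tri w).re : ℝ) : ℂ) ∧ 0 ≤ (𝓕 tri w).re} := by
      intro w hw
      simp only [Set.mem_ofPred_eq]
      rw [hFeq w hw, Complex.ofReal_re]
      refine ⟨rfl, div_nonneg ?_ (by positivity)⟩
      linarith [Real.cos_le_one (2 * Real.pi * w)]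
    have hd : Dense ({0}ᶜ : Set ℝ) := dense_compl_singleton 0
    intro w
    exact (hcl.closure_subset_iff.2 hsub) (hd w)
  have hbd : ∀ w, (𝓕 tri w).re ≤ 4 * (1 + w ^ 2)⁻¹ := by
    intro w
    rw [← div_eq_mul_inv, le_div_iff₀ (by positivity)]
    rcases le_or_gt (|w|) 1 with h | h
    · have h1 : (𝓕 tri w).re ≤ 2 := (Complex.re_le_norm _).trans (hFb w)
      have h2 : w ^ 2 ≤ 1 := by rw [← sq_abs]; nlinarith [abs_nonneg w]
      nlinarith [(hFdense w).2]
    · have hw : w ≠ 0 := by rintro rfl; simp at h; linarith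
      have h2 : 1 ≤ w ^ 2 := by rw [← sq_abs]; nlinarith [abs_nonneg w]
      rw [hFeq w hw, Complex.ofReal_re, div_mul_eq_mul_div, div_le_iff₀ (by positivity)]
      have h3 := Real.neg_one_le_cos (2 * Real.pi * w)
      have h4 : 9 < Real.pi ^ 2 := by nlinarith [Real.pi_gt_three]
      nlinarith [Real.cos_le_one (2 * Real.pi * w)]
  refine ⟨fun w => (𝓕 tri w).re, Complex.continuous_re.comp hF, fun w => (hFdense w).2, hbd, ?_⟩
  intro x
  have hFint : Integrable (𝓕 tri) := by
    refine (integrable_inv_one_add_sq.const_mul 4).mono' hF.aestronglyMeasurable ?_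
    refine Filter.Eventually.of_forall fun w => ?_
    rw [(hFdense w).1, Complex.norm_real, Real.norm_eq_abs, abs_of_nonneg (hFdense w).2]
    exact hbd w
  have h := congrFun (hc.fourierInv_fourier_eq hint hFint) x
  rw [Real.fourierInv_eq'] at h
  change _ = tri x
  rw [← h]
  refine integral_congr_ae (Filter.Eventually.of_forall fun w => ?_)
  simp only [smul_eq_mul]
  rw [← (hFdense w).1]
  congr 2
  simp
  ring

lemma integrable_sqrt_mul_inv_one_add_sq :
    Integrable fun w : ℝ => Real.sqrt (1 + |w|) * (1 + w ^ 2)⁻¹ := by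
  have h := (integrable_one_add_norm (E := ℝ) (μ := volume) (r := 3 / 2) (by norm_num)).const_mul 2
  refine h.mono' (Continuous.aestronglyMeasurable ?_) (Filter.Eventually.of_forall fun w => ?_)
  · exact (by fun_prop : Continuous fun w : ℝ => Real.sqrt (1 + |w|)).mul
      (Continuous.inv₀ (by fun_prop) fun w => by positivity)
  · have h1 : 0 < 1 + |w| := by positivity
    rw [Real.norm_eq_abs, abs_of_nonneg (by positivity), Real.norm_eq_abs,
      ← div_eq_mul_inv, div_le_iff₀ (by positivity)]
    have h2 : (1 + |w|) ^ (-(3 / 2) : ℝ) * (1 + |w|) ^ 2 = Real.sqrt (1 + |w|) := by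
      rw [Real.sqrt_eq_rpow, ← Real.rpow_natCast, ← Real.rpow_add h1]
      norm_num
    rw [← h2]
    have h3 : (1 + |w|) ^ 2 ≤ 2 * (1 + w ^ 2) := by
      rw [← sq_abs w]; nlinarith [sq_nonneg (1 - |w|)]
    have h4 : 0 ≤ (1 + |w|) ^ (-(3 / 2) : ℝ) := by positivity
    nlinarith

/-- Growth hypotheses used for shifting kernels along vertical lines. -/
structure HalfPlaneGrowth (G : ℂ → ℂ) (A : ℝ) : Prop where
  diff : DifferentiableOn ℂ G {s | 1 / 2 < s.re}
  nonneg : 0 ≤ A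
  bound : ∀ s : ℂ, 1 / 2 < s.re → ‖G s‖ ≤ A * (1 + 1 / (s.re - 1 / 2)) * Real.sqrt (1 + |s.im|)

lemma isOpen_halfPlane : IsOpen {s : ℂ | 1 / 2 < s.re} :=
  isOpen_lt continuous_const Complex.continuous_re

lemma re_sub_mul_I (s : ℂ) (u : ℝ) : (s - u * I).re = s.re := by simp

lemma im_sub_mul_I (s : ℂ) (u : ℝ) : (s - u * I).im = s.im - u := by simp

lemma sqrt_one_add_abs_sub_le (a c w : ℝ) :
    Real.sqrt (1 + |a - c * w|) ≤ Real.sqrt ((1 + |a|) * (1 + |c|)) * Real.sqrt (1 + |w|) := by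
  rw [← Real.sqrt_mul (by positivity)]
  apply Real.sqrt_le_sqrt
  have h1 := abs_sub a (c * w)
  rw [abs_mul] at h1
  have ha := abs_nonneg a
  have hc := abs_nonneg c
  have hw := abs_nonneg w
  nlinarith [mul_nonneg hc hw, mul_nonneg ha hc, mul_nonneg ha hw, mul_nonneg (mul_nonneg ha hc) hw]

lemma HalfPlaneGrowth.continuous {G : ℂ → ℂ} (hG : DifferentiableOn ℂ G {s | 1 / 2 < s.re}) {s : ℂ}
    (hs : 1 / 2 < s.re) (c : ℝ) : Continuous fun w : ℝ => G (s - (c * w : ℝ) * I) :=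
  hG.continuousOn.comp_continuous (by fun_prop) fun w => by
    simpa [re_sub_mul_I] using hs

lemma HalfPlaneGrowth.integrable {G : ℂ → ℂ} {A : ℝ} (hG : HalfPlaneGrowth G A) {K : ℝ → ℝ}
    (hK : Continuous K) (hK0 : ∀ w, 0 ≤ K w) (hKb : ∀ w, K w ≤ 4 * (1 + w ^ 2)⁻¹) {s : ℂ}
    (hs : 1 / 2 < s.re) (c : ℝ) :
    Integrable fun w : ℝ => (K w : ℂ) * G (s - (c * w : ℝ) * I) := by
  refine (integrable_sqrt_mul_inv_one_add_sq.const_mul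
    (4 * (A * (1 + 1 / (s.re - 1 / 2)) * Real.sqrt ((1 + |s.im|) * (1 + |c|))))).mono'
    (Continuous.aestronglyMeasurable ?_) (Filter.Eventually.of_forall fun w => ?_)
  · exact (Complex.continuous_ofReal.comp hK).mul (HalfPlaneGrowth.continuous hG.diff hs c)
  · rw [norm_mul, Complex.norm_real, Real.norm_eq_abs, abs_of_nonneg (hK0 w)]
    have h1 := hG.bound (s - (c * w : ℝ) * I) (by rwa [re_sub_mul_I])
    rw [re_sub_mul_I, im_sub_mul_I] at h1
    have h2 := sqrt_one_add_abs_sub_le s.im c w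
    have hp : 0 < 1 + 1 / (s.re - 1 / 2) := by
      have : 0 < 1 / (s.re - 1 / 2) := one_div_pos.2 (by linarith)
      linarith
    have hA := hG.nonneg
    calc K w * ‖G (s - (c * w : ℝ) * I)‖ ≤ (4 * (1 + w ^ 2)⁻¹) *
          (A * (1 + 1 / (s.re - 1 / 2)) *
            (Real.sqrt ((1 + |s.im|) * (1 + |c|)) * Real.sqrt (1 + |w|))) := by
          refine mul_le_mul (hKb w) (h1.trans ?_) (norm_nonneg _) (by positivity)
          gcongr
      _ = _ := by ring

lemma HalfPlaneGrowth.differentiableOn_integral {G : ℂ → ℂ} {A : ℝ} (hG : HalfPlaneGrowth G A)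
    {K : ℝ → ℝ} (hK : Continuous K) (hK0 : ∀ w, 0 ≤ K w) (hKb : ∀ w, K w ≤ 4 * (1 + w ^ 2)⁻¹)
    (c : ℝ) :
    DifferentiableOn ℂ (fun s => ∫ w : ℝ, (K w : ℂ) * G (s - (c * w : ℝ) * I))
      {s | 1 / 2 < s.re} := by
  intro s hs
  have hs' : 1 / 2 < s.re := hs
  refine DifferentiableAt.differentiableWithinAt ?_
  set δ : ℝ := (s.re - 1 / 2) / 3 with hδ
  have hδ0 : 0 < δ := by rw [hδ]; linarith
  have hA := hG.nonneg
  have hball : ∀ x ∈ Metric.ball s δ, 1 / 2 + 2 * δ ≤ x.re ∧ |x.im| ≤ |s.im| + δ := by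
    intro x hx
    rw [Metric.mem_ball, dist_eq_norm] at hx
    have h1 := (abs_le.1 (Complex.abs_re_le_norm (x - s))).1
    have h2 := Complex.abs_im_le_norm (x - s)
    rw [Complex.sub_re] at h1
    rw [Complex.sub_im] at h2
    constructor
    · have : s.re = 1 / 2 + 3 * δ := by rw [hδ]; ring
      linarith
    · have := abs_sub_abs_le_abs_sub x.im s.im
      linarith
  have hder : ∀ x ∈ Metric.ball s δ, ∀ w : ℝ, ‖deriv G (x - (c * w : ℝ) * I)‖ ≤
      A * (1 + 1 / δ) * Real.sqrt ((1 + (|s.im| + 2 * δ)) * (1 + |c|)) * Real.sqrt (1 + |w|) / δ := by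
    intro x hx w
    obtain ⟨hx1, hx2⟩ := hball x hx
    refine Complex.norm_deriv_le_of_forall_mem_sphere_norm_le hδ0 ?_ ?_
    · refine (hG.diff.mono ?_).diffContOnCl_ball (le_refl _)
      intro z hz
      rw [Metric.mem_closedBall, dist_eq_norm] at hz
      have h1 := (abs_le.1 (Complex.abs_re_le_norm (z - (x - (c * w : ℝ) * I)))).1
      rw [Complex.sub_re, re_sub_mul_I] at h1
      simp only [Set.mem_ofPred_eq]
      linarith
    · intro z hz
      rw [mem_sphere_iff_norm] at hz
      have h1 := (abs_le.1 (Complex.abs_re_le_norm (z - (x - (c * w : ℝ) * I)))).1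
      have h2 := Complex.abs_im_le_norm (z - (x - (c * w : ℝ) * I))
      rw [Complex.sub_re, re_sub_mul_I] at h1
      rw [Complex.sub_im, im_sub_mul_I] at h2
      have hz1 : δ ≤ z.re - 1 / 2 := by linarith
      have h3 := hG.bound z (by linarith)
      have hzd : 1 + 1 / (z.re - 1 / 2) ≤ 1 + 1 / δ := by
        have := one_div_le_one_div_of_le hδ0 hz1
        linarith
      refine h3.trans ?_
      rw [mul_assoc (A * (1 + 1 / δ))]
      refine mul_le_mul (mul_le_mul_of_nonneg_left hzd hA) ?_ (Real.sqrt_nonneg _) (by positivity)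
      have h5 := sqrt_one_add_abs_sub_le (|s.im| + 2 * δ) (-|c|) (|w|)
      rw [abs_neg, abs_abs, abs_abs, abs_of_nonneg (show 0 ≤ |s.im| + 2 * δ by positivity)] at h5
      refine le_trans (Real.sqrt_le_sqrt ?_) h5
      rw [abs_of_nonneg (show 0 ≤ |s.im| + 2 * δ - -|c| * |w| by
        have := mul_nonneg (abs_nonneg c) (abs_nonneg w)
        have := abs_nonneg s.im
        linarith)]
      have h6 := abs_add_le (z.im - (x.im - c * w)) (x.im - c * w)
      have h7 := abs_sub x.im (c * w)
      rw [abs_mul] at h7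
      rw [sub_add_cancel] at h6
      linarith
  have hre : ∀ x ∈ Metric.ball s δ, 1 / 2 < x.re := fun x hx => by linarith [(hball x hx).1]
  refine (hasDerivAt_integral_of_dominated_loc_of_deriv_le (μ := volume)
    (F := fun (s : ℂ) (w : ℝ) => (K w : ℂ) * G (s - (c * w : ℝ) * I))
    (F' := fun (s : ℂ) (w : ℝ) => (K w : ℂ) * deriv G (s - (c * w : ℝ) * I))
    (bound := fun w => (4 * (A * (1 + 1 / δ) *
      Real.sqrt ((1 + (|s.im| + 2 * δ)) * (1 + |c|)) / δ)) * (Real.sqrt (1 + |w|) * (1 + w ^ 2)⁻¹))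
    (Metric.ball_mem_nhds s hδ0) ?_ (hG.integrable hK hK0 hKb hs' c) ?_ ?_ ?_ ?_).2.differentiableAt
  · filter_upwards [Metric.ball_mem_nhds s hδ0] with x hx
    exact ((Complex.continuous_ofReal.comp hK).mul
      (HalfPlaneGrowth.continuous hG.diff (hre x hx) c)).aestronglyMeasurable
  · exact ((Complex.continuous_ofReal.comp hK).mul
      (HalfPlaneGrowth.continuous (hG.diff.deriv isOpen_halfPlane) hs' c)).aestronglyMeasurable
  · refine Filter.Eventually.of_forall fun w x hx => ?_
    rw [norm_mul, Complex.norm_real, Real.norm_eq_abs, abs_of_nonneg (hK0 w)]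
    refine (mul_le_mul (hKb w) (hder x hx w) (norm_nonneg _) (by positivity)).trans (le_of_eq ?_)
    ring
  · exact integrable_sqrt_mul_inv_one_add_sq.const_mul _
  · refine Filter.Eventually.of_forall fun w x hx => ?_
    refine HasDerivAt.const_mul _ ?_
    have h1 : HasDerivAt G (deriv G (x - (c * w : ℝ) * I)) (x - (c * w : ℝ) * I) :=
      (hG.diff.differentiableAt (isOpen_halfPlane.mem_nhds (by
        simp only [Set.mem_ofPred_eq]; rw [re_sub_mul_I]; exact hre x hx))).hasDerivAt
    exact (h1.comp x ((hasDerivAt_id x).sub_const _)).congr_deriv (by simp)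

/-- The Dirichlet polynomial for `-L'/L` with Fejér weights, of length `exp Y`. -/
noncomputable def logDerivSum {q : ℕ} (χ : DirichletCharacter ℂ q) (Y : ℝ) (s : ℂ) : ℂ :=
  ∑ n ∈ Finset.range (⌊Real.exp Y⌋₊ + 1), ((max 0 (1 - Real.log n / Y) : ℝ) : ℂ) *
    LSeries.term (fun n : ℕ => χ n * (ArithmeticFunction.vonMangoldt n : ℂ)) s n

lemma log_mul_abs_sub_add_three_le {q : ℕ} (hq : 1 ≤ q) {S a c w : ℝ} (hS : 2 ≤ S) (ha : |a| ≤ S)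
    (hc : |c| ≤ 7) :
    Real.log (q * (|a - c * w| + 3)) ≤ 6 * Real.log (q * S) * Real.sqrt (1 + |w|) := by
  have hq' : (1 : ℝ) ≤ q := by exact_mod_cast hq
  have h1 := abs_sub a (c * w)
  rw [abs_mul] at h1
  have hw := abs_nonneg w
  have h2 : |c| * |w| ≤ 7 * |w| := by gcongr
  have h3 : |a - c * w| + 3 ≤ S * (4 * (1 + |w|)) := by nlinarith
  have h4 : Real.log (q * (|a - c * w| + 3)) ≤ Real.log (q * S) + Real.log 4 + Real.log (1 + |w|) := by
    rw [← Real.log_mul (by positivity) (by norm_num), ← Real.log_mul (by positivity) (by positivity)]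
    apply Real.log_le_log (by positivity)
    calc (q : ℝ) * (|a - c * w| + 3) ≤ q * (S * (4 * (1 + |w|))) := by gcongr
      _ = _ := by ring
  have h5 : Real.log 2 ≤ Real.log (q * S) := Real.log_le_log (by norm_num) (by nlinarith)
  have h6 : Real.log 4 = 2 * Real.log 2 := by
    rw [show (4 : ℝ) = 2 ^ 2 by norm_num, Real.log_pow]; norm_num
  have h7 : Real.log (1 + |w|) ≤ 2 * Real.sqrt (1 + |w|) := by
    have h8 : 1 + |w| = Real.sqrt (1 + |w|) ^ 2 := (Real.sq_sqrt (by positivity)).symm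
    have h9 := Real.log_le_sub_one_of_pos (x := Real.sqrt (1 + |w|)) (by positivity)
    have : Real.log (1 + |w|) = 2 * Real.log (Real.sqrt (1 + |w|)) := by
      rw [Real.log_sqrt (by positivity)]; ring
    linarith
  have h10 : 1 ≤ Real.sqrt (1 + |w|) := Real.one_le_sqrt.2 (by linarith)
  have h11 := Real.log_two_gt_d9
  nlinarith

lemma term_sub_mul_I (f : ℕ → ℂ) (s : ℂ) (Y w : ℝ) (n : ℕ) :
    LSeries.term f (s - (2 * Real.pi / Y * w : ℝ) * I) n =
      LSeries.term f s n * Complex.exp (2 * Real.pi * w * (Real.log n / Y : ℝ) * I) := by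
  rcases eq_or_ne n 0 with rfl | hn
  · simp
  rw [LSeries.term_of_ne_zero hn, LSeries.term_of_ne_zero hn, Complex.cpow_sub _ _ (by exact_mod_cast hn),
    Complex.cpow_def_of_ne_zero (y := (2 * Real.pi / Y * w : ℝ) * I) (by exact_mod_cast hn),
    ← Complex.natCast_log, div_div_eq_mul_div]
  rw [show (Real.log n : ℂ) * ((2 * Real.pi / Y * w : ℝ) * I) =
    2 * Real.pi * w * (Real.log n / Y : ℝ) * I by push_cast; ring]
  ring

lemma integral_kernel_mul_LSeries {K : ℝ → ℝ} (hK : Continuous K) (hK0 : ∀ w, 0 ≤ K w)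
    (hKb : ∀ w, K w ≤ 4 * (1 + w ^ 2)⁻¹)
    (hKF : ∀ x : ℝ, ∫ w : ℝ, Complex.exp (2 * Real.pi * w * x * I) * K w =
      ((max 0 (1 - |x|) : ℝ) : ℂ))
    {f : ℕ → ℂ} {s : ℂ} (hf : LSeriesSummable f s) {Y : ℝ} (hY : 0 < Y) :
    ∫ w : ℝ, (K w : ℂ) * LSeries f (s - (2 * Real.pi / Y * w : ℝ) * I) =
      ∑ n ∈ Finset.range (⌊Real.exp Y⌋₊ + 1), ((max 0 (1 - Real.log n / Y) : ℝ) : ℂ) *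
        LSeries.term f s n := by
  have hKi : Integrable K := (integrable_inv_one_add_sq.const_mul 4).mono'
    hK.aestronglyMeasurable (Filter.Eventually.of_forall fun w => by
      rw [Real.norm_eq_abs, abs_of_nonneg (hK0 w)]; exact hKb w)
  have hne : ∀ (n : ℕ) (w : ℝ), ‖Complex.exp (2 * Real.pi * w * (Real.log n / Y : ℝ) * I)‖ = 1 := by
    intro n w
    rw [show (2 * Real.pi * w * (Real.log n / Y : ℝ) * I : ℂ) =
      (2 * Real.pi * w * (Real.log n / Y) : ℝ) * I by push_cast; ring]
    exact Complex.norm_exp_ofReal_mul_I _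
  have hnorm : ∀ (n : ℕ) (w : ℝ), ‖(K w : ℂ) * LSeries.term f (s - (2 * Real.pi / Y * w : ℝ) * I) n‖ =
      K w * ‖LSeries.term f s n‖ := by
    intro n w
    rw [term_sub_mul_I, norm_mul, norm_mul, hne, mul_one, Complex.norm_real, Real.norm_eq_abs,
      abs_of_nonneg (hK0 w)]
  have hcont : ∀ n : ℕ, Continuous fun w : ℝ =>
      (K w : ℂ) * LSeries.term f (s - (2 * Real.pi / Y * w : ℝ) * I) n := by
    intro n
    simp only [term_sub_mul_I]
    exact (Complex.continuous_ofReal.comp hK).mul (by fun_prop)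
  have hint : ∀ n : ℕ, Integrable fun w : ℝ =>
      (K w : ℂ) * LSeries.term f (s - (2 * Real.pi / Y * w : ℝ) * I) n := by
    intro n
    refine (hKi.mul_const ‖LSeries.term f s n‖).mono' (hcont n).aestronglyMeasurable
      (Filter.Eventually.of_forall fun w => (hnorm n w).le)
  have hsum := hasSum_integral_of_summable_integral_norm hint (by
    simp only [hnorm, integral_mul_const]
    exact hf.norm.mul_left _)
  simp only [tsum_mul_left] at hsum
  have hterm : ∀ n : ℕ, ∫ w : ℝ, (K w : ℂ) * LSeries.term f (s - (2 * Real.pi / Y * w : ℝ) * I) n =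
      ((max 0 (1 - Real.log n / Y) : ℝ) : ℂ) * LSeries.term f s n := by
    intro n
    have h1 := hKF (Real.log n / Y)
    rw [abs_of_nonneg (div_nonneg (Real.log_natCast_nonneg n) hY.le)] at h1
    rw [← h1, ← integral_mul_const]
    refine integral_congr_ae (Filter.Eventually.of_forall fun w => ?_)
    simp only [term_sub_mul_I]
    ring
  simp only [hterm] at hsum
  refine hsum.unique (hasSum_sum_of_ne_finset_zero fun n hn => ?_)
  rw [Finset.mem_range, not_lt, Nat.add_one_le_iff, Nat.floor_lt (by positivity)] at hn
  have : 1 - Real.log n / Y ≤ 0 := by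
    rw [sub_nonpos, one_le_div hY, Real.le_log_iff_exp_le (lt_trans (Real.exp_pos _) hn)]
    exact hn.le
  rw [max_eq_left this]
  simp

lemma exists_logDerivSum_bounds (hGRH : GRH) : ∃ C : ℝ, 0 < C ∧ ∀ (q : ℕ) [NeZero q]
    (χ : DirichletCharacter ℂ q), χ ≠ 1 → ∀ (S Y : ℝ) (s : ℂ), 2 ≤ S → 1 ≤ Y → 1 / 2 < s.re →
      |s.im| ≤ S → (logDerivSum χ Y s).re ≤ C * Real.log (q * S) ∧
        ‖logDerivSum χ Y s‖ ≤ C * (1 + 1 / (s.re - 1 / 2)) * Real.log (q * S) := by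
  obtain ⟨C, hC, hCb⟩ := exists_logDeriv_LFunction_bounds hGRH
  obtain ⟨K, hK, hK0, hKb, hKF⟩ := exists_fejer
  have hJ0 : 0 ≤ ∫ w : ℝ, Real.sqrt (1 + |w|) * (1 + w ^ 2)⁻¹ :=
    integral_nonneg fun w => by positivity
  set J : ℝ := ∫ w : ℝ, Real.sqrt (1 + |w|) * (1 + w ^ 2)⁻¹ with hJ
  refine ⟨24 * C * J + 1, by positivity, fun q _ χ hχ S Y s hS hY hs ht => ?_⟩
  have hq : 1 ≤ q := NeZero.one_le
  set G : ℂ → ℂ := fun s => deriv (DirichletCharacter.LFunction χ) s / DirichletCharacter.LFunction χ s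
    with hGdef
  have hLd : Differentiable ℂ (DirichletCharacter.LFunction χ) :=
    DirichletCharacter.differentiable_LFunction hχ
  have hG : HalfPlaneGrowth G (C * (6 * Real.log (q * 2))) := by
    have hlog : 0 ≤ Real.log (q * 2) := Real.log_nonneg (by
      have : (1 : ℝ) ≤ q := by exact_mod_cast hq
      linarith)
    refine ⟨?_, by positivity, fun z hz => ?_⟩
    · exact fun z hz => ((hLd.deriv z).div (hLd z)
        (LFunction_ne_zero_of_GRH hGRH hχ hz)).differentiableWithinAt
    · have h1 := (hCb q χ hχ z hz).2
      have h2 := log_mul_abs_sub_add_three_le (a := 0) (c := 1) (w := z.im) hq le_rfl (by simp)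
        (by norm_num)
      rw [zero_sub, one_mul, abs_neg] at h2
      have h3 : 0 < 1 / (z.re - 1 / 2) := one_div_pos.2 (by linarith)
      calc ‖G z‖ ≤ C * (1 + 1 / (z.re - 1 / 2)) * Real.log (q * (|z.im| + 3)) := h1
        _ ≤ C * (1 + 1 / (z.re - 1 / 2)) * (6 * Real.log (q * 2) * Real.sqrt (1 + |z.im|)) :=
          mul_le_mul_of_nonneg_left h2 (by positivity)
        _ = _ := by ring
  have hY0 : 0 < Y := by linarith
  have heq : ∀ z : ℂ, 1 / 2 < z.re →
      logDerivSum χ Y z = -∫ w : ℝ, (K w : ℂ) * G (z - (2 * Real.pi / Y * w : ℝ) * I) := by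
    have hpre : IsPreconnected {z : ℂ | 1 / 2 < z.re} := (convex_halfSpace_re_gt _).isPreconnected
    have hA1 : AnalyticOnNhd ℂ (logDerivSum χ Y) {z : ℂ | 1 / 2 < z.re} := by
      refine DifferentiableOn.analyticOnNhd (Differentiable.differentiableOn ?_) isOpen_halfPlane
      unfold logDerivSum
      refine Differentiable.fun_sum fun n _ => Differentiable.const_mul ?_ _
      rcases eq_or_ne n 0 with rfl | hn
      · simp
      · simp only [LSeries.term_of_ne_zero hn]
        exact (differentiable_const _).div (differentiable_id.const_cpow (Or.inl (by exact_mod_cast hn)))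
          (fun z => by simp [Complex.cpow_eq_zero_iff, hn])
    have hA2 : AnalyticOnNhd ℂ (fun z => -∫ w : ℝ, (K w : ℂ) * G (z - (2 * Real.pi / Y * w : ℝ) * I))
        {z : ℂ | 1 / 2 < z.re} :=
      DifferentiableOn.analyticOnNhd (hG.differentiableOn_integral hK hK0 hKb _).neg isOpen_halfPlane
    have := hA1.eqOn_of_preconnected_of_eventuallyEq hA2 hpre (z₀ := 2) (by norm_num) ?_
    · exact fun z hz => this hz
    filter_upwards [(isOpen_lt continuous_const Complex.continuous_re).mem_nhds
      (show (1 : ℝ) < (2 : ℂ).re by norm_num)] with z hz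
    have hz1 : 1 < z.re := hz
    have hsum : LSeriesSummable (fun n : ℕ => χ n * (ArithmeticFunction.vonMangoldt n : ℂ)) z :=
      DirichletCharacter.LSeriesSummable_twist_vonMangoldt χ hz1
    rw [logDerivSum, ← integral_kernel_mul_LSeries hK hK0 hKb hKF hsum hY0, ← integral_neg]
    refine integral_congr_ae (Filter.Eventually.of_forall fun w => ?_)
    simp only
    have hz2 : 1 < (z - (2 * Real.pi / Y * w : ℝ) * I).re := by rwa [re_sub_mul_I]
    have h1 := DirichletCharacter.LSeries_twist_vonMangoldt_eq χ hz2
    rw [← mul_neg]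
    congr 1
    refine Eq.trans h1 ?_
    simp only [hGdef]
    rw [DirichletCharacter.deriv_LFunction_eq_deriv_LSeries χ hz2,
      DirichletCharacter.LFunction_eq_LSeries χ hz2, neg_div]
  set c : ℝ := 2 * Real.pi / Y with hc
  have hc7 : |c| ≤ 7 := by
    rw [hc, abs_of_nonneg (by positivity)]
    have := Real.pi_lt_d2
    rw [div_le_iff₀ hY0]
    nlinarith [Real.pi_pos]
  have hlog0 : 0 ≤ Real.log (q * S) := Real.log_nonneg (by
    have : (1 : ℝ) ≤ q := by exact_mod_cast hq
    nlinarith)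
  have hi := hG.integrable hK hK0 hKb hs c
  have hd0 : 0 < 1 / (s.re - 1 / 2) := one_div_pos.2 (by linarith)
  have hbd : ∀ w : ℝ, K w * Real.log (q * (|s.im - c * w| + 3)) ≤
      24 * Real.log (q * S) * (Real.sqrt (1 + |w|) * (1 + w ^ 2)⁻¹) := by
    intro w
    have h2 := log_mul_abs_sub_add_three_le (w := w) hq hS ht hc7
    calc K w * Real.log (q * (|s.im - c * w| + 3)) ≤
        K w * (6 * Real.log (q * S) * Real.sqrt (1 + |w|)) := mul_le_mul_of_nonneg_left h2 (hK0 w)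
      _ ≤ (4 * (1 + w ^ 2)⁻¹) * (6 * Real.log (q * S) * Real.sqrt (1 + |w|)) :=
        mul_le_mul_of_nonneg_right (hKb w) (by positivity)
      _ = _ := by ring
  rw [heq s hs]
  constructor
  · have hre : (-∫ w : ℝ, (K w : ℂ) * G (s - (c * w : ℝ) * I)).re =
        ∫ w : ℝ, -((K w : ℂ) * G (s - (c * w : ℝ) * I)).re := by
      rw [integral_neg, Complex.neg_re]
      congr 1
      exact (integral_re hi).symm
    rw [hre]
    refine (integral_mono (g := fun w : ℝ => C * (24 * Real.log (q * S) *
      (Real.sqrt (1 + |w|) * (1 + w ^ 2)⁻¹))) hi.re.neg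
      ((integrable_sqrt_mul_inv_one_add_sq.const_mul _).const_mul _) fun w => ?_).trans ?_
    · have h1 := (hCb q χ hχ (s - (c * w : ℝ) * I) (by rwa [re_sub_mul_I])).1
      rw [im_sub_mul_I] at h1
      have h2 := mul_le_mul_of_nonneg_left h1 (hK0 w)
      have h3 := mul_le_mul_of_nonneg_left (hbd w) hC.le
      change -((K w : ℂ) * G (s - (c * w : ℝ) * I)).re ≤ _
      rw [Complex.re_ofReal_mul]
      simp only [hGdef]
      linarith
    · rw [integral_const_mul, integral_const_mul, ← hJ]
      nlinarith
  · rw [norm_neg]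
    refine (norm_integral_le_integral_norm _).trans ?_
    refine (integral_mono (g := fun w : ℝ => C * (1 + 1 / (s.re - 1 / 2)) * (24 * Real.log (q * S) *
      (Real.sqrt (1 + |w|) * (1 + w ^ 2)⁻¹))) hi.norm
      ((integrable_sqrt_mul_inv_one_add_sq.const_mul _).const_mul _) fun w => ?_).trans ?_
    · have h1 := (hCb q χ hχ (s - (c * w : ℝ) * I) (by rwa [re_sub_mul_I])).2
      rw [im_sub_mul_I, re_sub_mul_I] at h1
      have h2 := mul_le_mul_of_nonneg_left h1 (hK0 w)
      have h3 := mul_le_mul_of_nonneg_left (hbd w) (by positivity : 0 ≤ C * (1 + 1 / (s.re - 1 / 2)))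
      simp only [norm_mul, Complex.norm_real, Real.norm_eq_abs, abs_of_nonneg (hK0 w)]
      refine h2.trans (le_trans (le_of_eq ?_) h3)
      ring
    · rw [integral_const_mul, integral_const_mul, ← hJ]
      have := mul_nonneg (add_nonneg zero_le_one hd0.le) hlog0
      nlinarith

/-- The Dirichlet polynomial for `log L` with squared Fejér weights, of length `exp Y`. -/
noncomputable def logSum {q : ℕ} (χ : DirichletCharacter ℂ q) (Y : ℝ) (s : ℂ) : ℂ :=
  ∑ n ∈ Finset.range (⌊Real.exp Y⌋₊ + 1),
    (((max 0 (1 - Real.log n / Y)) ^ 2 / Real.log n : ℝ) : ℂ) *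
      LSeries.term (fun n : ℕ => χ n * (ArithmeticFunction.vonMangoldt n : ℂ)) s n

lemma max_zero_one_sub_log_div_eq_zero {Y : ℝ} (hY : 0 < Y) {n : ℕ} (hn : ⌊Real.exp Y⌋₊ + 1 ≤ n) :
    max 0 (1 - Real.log n / Y) = 0 := by
  rw [Nat.add_one_le_iff, Nat.floor_lt (by positivity)] at hn
  refine max_eq_left ?_
  rw [sub_nonpos, one_le_div hY, Real.le_log_iff_exp_le (lt_trans (Real.exp_pos _) hn)]
  exact hn.le

lemma logDerivSum_eq_sum_range {q : ℕ} (χ : DirichletCharacter ℂ q) {Y : ℝ} (hY : 0 < Y) (s : ℂ)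
    {M : ℕ} (hM : ⌊Real.exp Y⌋₊ + 1 ≤ M) :
    logDerivSum χ Y s = ∑ n ∈ Finset.range M, ((max 0 (1 - Real.log n / Y) : ℝ) : ℂ) *
      LSeries.term (fun n : ℕ => χ n * (ArithmeticFunction.vonMangoldt n : ℂ)) s n := by
  refine Finset.sum_subset (Finset.range_mono hM) fun n _ hn => ?_
  rw [Finset.mem_range, not_lt] at hn
  rw [max_zero_one_sub_log_div_eq_zero hY hn]
  simp

lemma logSum_eq_sum_range {q : ℕ} (χ : DirichletCharacter ℂ q) {Y : ℝ} (hY : 0 < Y) (s : ℂ)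
    {M : ℕ} (hM : ⌊Real.exp Y⌋₊ + 1 ≤ M) :
    logSum χ Y s = ∑ n ∈ Finset.range M, (((max 0 (1 - Real.log n / Y)) ^ 2 / Real.log n : ℝ) : ℂ) *
      LSeries.term (fun n : ℕ => χ n * (ArithmeticFunction.vonMangoldt n : ℂ)) s n := by
  refine Finset.sum_subset (Finset.range_mono hM) fun n _ hn => ?_
  rw [Finset.mem_range, not_lt] at hn
  rw [max_zero_one_sub_log_div_eq_zero hY hn]
  simp

lemma logSum_eq_tsum {q : ℕ} (χ : DirichletCharacter ℂ q) {Y : ℝ} (hY : 0 < Y) (s : ℂ) :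
    logSum χ Y s = ∑' n : ℕ, (((max 0 (1 - Real.log n / Y)) ^ 2 / Real.log n : ℝ) : ℂ) *
      LSeries.term (fun n : ℕ => χ n * (ArithmeticFunction.vonMangoldt n : ℂ)) s n := by
  refine (tsum_eq_sum fun n hn => ?_).symm
  rw [Finset.mem_range, not_lt] at hn
  rw [max_zero_one_sub_log_div_eq_zero hY hn]
  simp

lemma differentiable_logSum {q : ℕ} (χ : DirichletCharacter ℂ q) (Y : ℝ) :
    Differentiable ℂ (logSum χ Y) := by
  unfold logSum
  refine Differentiable.fun_sum fun n _ => Differentiable.const_mul ?_ _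
  rcases eq_or_ne n 0 with rfl | hn
  · simp
  · simp only [LSeries.term_of_ne_zero hn]
    exact (differentiable_const _).div (differentiable_id.const_cpow (Or.inl (by exact_mod_cast hn)))
      (fun z => by simp [Complex.cpow_eq_zero_iff, hn])

lemma hasDerivAt_max_zero_sq (x : ℝ) : HasDerivAt (fun x : ℝ => (max 0 x) ^ 2) (2 * max 0 x) x := by
  rcases lt_trichotomy x 0 with h | rfl | h
  · rw [max_eq_left h.le, mul_zero]
    refine (hasDerivAt_const x (0 : ℝ)).congr_of_eventuallyEq ?_
    filter_upwards [gt_mem_nhds h] with y hy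
    simp [max_eq_left hy.le]
  · rw [max_self, mul_zero, hasDerivAt_iff_isLittleO]
    have h1 : (fun x : ℝ => (max 0 x) ^ 2) =O[nhds 0] fun x : ℝ => x ^ 2 := by
      refine Asymptotics.IsBigO.of_bound 1 (Filter.Eventually.of_forall fun x => ?_)
      rw [one_mul, Real.norm_eq_abs, Real.norm_eq_abs, abs_of_nonneg (by positivity),
        abs_of_nonneg (by positivity), ← sq_abs x]
      gcongr
      exact max_le (abs_nonneg x) (le_abs_self x)
    simpa using h1.trans_isLittleO (Asymptotics.isLittleO_pow_id (n := 2) (by norm_num))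
  · rw [max_eq_right h.le]
    refine ((hasDerivAt_pow 2 x).congr_of_eventuallyEq ?_).congr_deriv (by simp)
    filter_upwards [lt_mem_nhds h] with y hy
    simp [max_eq_right hy.le]

lemma hasDerivAt_logSum {q : ℕ} (χ : DirichletCharacter ℂ q) (s : ℂ) {Y : ℝ} (hY : 0 < Y) :
    HasDerivAt (fun Y : ℝ => logSum χ Y s) ((2 / Y ^ 2 : ℝ) * logDerivSum χ Y s) Y := by
  set M := ⌊Real.exp (Y + 1)⌋₊ + 1 with hM
  have hmono : ∀ Z ≤ Y + 1, ⌊Real.exp Z⌋₊ + 1 ≤ M := fun Z hZ => by rw [hM]; gcongr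
  have hev : (fun Z : ℝ => logSum χ Z s) =ᶠ[nhds Y] fun Z : ℝ => ∑ n ∈ Finset.range M,
      (((max 0 (1 - Real.log n / Z)) ^ 2 / Real.log n : ℝ) : ℂ) *
      LSeries.term (fun n : ℕ => χ n * (ArithmeticFunction.vonMangoldt n : ℂ)) s n := by
    filter_upwards [lt_mem_nhds hY, gt_mem_nhds (lt_add_one Y)] with Z h1 h2
    exact logSum_eq_sum_range χ h1 s (hmono Z h2.le)
  refine HasDerivAt.congr_of_eventuallyEq ?_ hev
  rw [logDerivSum_eq_sum_range χ hY s (hmono Y (by linarith)), Finset.mul_sum]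
  refine HasDerivAt.fun_sum fun n _ => ?_
  have h1 : HasDerivAt (fun Z : ℝ => 1 - Real.log n / Z) (Real.log n / Y ^ 2) Y := by
    refine ((((hasDerivAt_inv hY.ne').const_mul (Real.log n)).const_sub 1)).congr_deriv ?_
    rw [mul_neg, neg_neg, div_eq_mul_inv]
  have h2 := ((hasDerivAt_max_zero_sq _).comp Y h1).div_const (Real.log n)
  have h3 := (h2.ofReal_comp).mul_const
    (LSeries.term (fun n : ℕ => χ n * (ArithmeticFunction.vonMangoldt n : ℂ)) s n)
  refine h3.congr_deriv ?_
  rcases eq_or_ne (Real.log n) 0 with h0 | h0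
  · have : LSeries.term (fun n : ℕ => χ n * (ArithmeticFunction.vonMangoldt n : ℂ)) s n = 0 := by
      rcases eq_or_ne n 0 with rfl | hn
      · simp
      · rw [LSeries.term_of_ne_zero hn]
        have : n = 1 := by
          have h5 : (1 : ℝ) ≤ n := by exact_mod_cast Nat.one_le_iff_ne_zero.2 hn
          rcases Real.log_eq_zero.1 h0 with h | h | h
          · simp_all
          · exact_mod_cast h
          · linarith
        simp [this]
    rw [this]; simp
  · rw [show 2 * max 0 (1 - Real.log n / Y) * (Real.log n / Y ^ 2) / Real.log n =
      2 / Y ^ 2 * max 0 (1 - Real.log n / Y) by field_simp]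
    push_cast
    ring

lemma antitoneOn_logSum {q : ℕ} (χ : DirichletCharacter ℂ q) {s : ℂ} {B : ℝ}
    (hB : ∀ Y : ℝ, 1 ≤ Y → (logDerivSum χ Y s).re ≤ B) :
    AntitoneOn (fun Y : ℝ => (logSum χ Y s).re + 2 * B / Y) (Set.Ici 1) := by
  have hd : ∀ Y : ℝ, 1 ≤ Y → HasDerivAt (fun Y : ℝ => (logSum χ Y s).re + 2 * B / Y)
      (2 / Y ^ 2 * ((logDerivSum χ Y s).re - B)) Y := by
    intro Y hY
    have hY0 : 0 < Y := by linarith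
    have h1 : HasDerivAt (fun Y : ℝ => (logSum χ Y s).re)
        ((2 / Y ^ 2 : ℝ) * logDerivSum χ Y s : ℂ).re Y :=
      (Complex.reCLM.hasFDerivAt.comp_hasDerivAt Y (hasDerivAt_logSum χ s hY0))
    refine (h1.add ((hasDerivAt_inv hY0.ne').const_mul (2 * B))).congr_deriv ?_
    rw [Complex.re_ofReal_mul]
    field_simp
    ring
  refine antitoneOn_of_hasDerivWithinAt_nonpos (convex_Ici 1)
    (fun Y hY => (hd Y hY).continuousAt.continuousWithinAt)
    (f' := fun Y => 2 / Y ^ 2 * ((logDerivSum χ Y s).re - B)) ?_ ?_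
  · intro Y hY
    exact (hd Y (interior_subset hY)).hasDerivWithinAt
  · intro Y hY
    have := hB Y (interior_subset hY)
    exact mul_nonpos_of_nonneg_of_nonpos (by positivity) (by linarith)

lemma norm_logSum_sub_le {q : ℕ} (χ : DirichletCharacter ℂ q) {s : ℂ} {M : ℝ}
    (hM : ∀ Y : ℝ, 1 ≤ Y → ‖logDerivSum χ Y s‖ ≤ M) (n : ℕ) :
    ‖logSum χ (n + 2) s - logSum χ (n + 1) s‖ ≤ 2 * M / (n + 1) ^ 2 := by
  have hn : (0 : ℝ) ≤ n := n.cast_nonneg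
  have := Convex.norm_image_sub_le_of_norm_hasDerivWithin_le (s := Set.Ici ((n : ℝ) + 1))
    (f := fun Y : ℝ => logSum χ Y s) (C := 2 * M / (n + 1) ^ 2)
    (f' := fun Y : ℝ => ((2 / Y ^ 2 : ℝ) : ℂ) * logDerivSum χ Y s) (x := (n : ℝ) + 1)
    (y := (n : ℝ) + 2)
    (fun Y hY => (hasDerivAt_logSum χ s (by
      have : (n : ℝ) + 1 ≤ Y := hY
      linarith)).hasDerivWithinAt) ?_ (convex_Ici _) (Set.mem_Ici.2 le_rfl)
      (Set.mem_Ici.2 (by linarith))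
  · refine this.trans (le_of_eq ?_)
    rw [show (n : ℝ) + 2 - (n + 1) = 1 by ring]
    simp
  · intro Y hY
    have hY : (n : ℝ) + 1 ≤ Y := hY
    rw [norm_mul, Complex.norm_real, Real.norm_eq_abs, abs_of_nonneg (by positivity)]
    have h1 := hM Y (by linarith)
    have h0 : 0 ≤ M := (norm_nonneg _).trans h1
    calc 2 / Y ^ 2 * ‖logDerivSum χ Y s‖ ≤ 2 / (n + 1) ^ 2 * M := by gcongr
      _ = _ := by ring

/-- The limit of `logSum χ Y s` as `Y → ∞`. -/
noncomputable def logSumLimit {q : ℕ} (χ : DirichletCharacter ℂ q) (s : ℂ) : ℂ :=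
  logSum χ 1 s + ∑' n : ℕ, (logSum χ (n + 2) s - logSum χ (n + 1) s)

lemma tendsto_logSum {q : ℕ} (χ : DirichletCharacter ℂ q) {s : ℂ} {M : ℝ}
    (hM : ∀ Y : ℝ, 1 ≤ Y → ‖logDerivSum χ Y s‖ ≤ M) :
    Filter.Tendsto (fun n : ℕ => logSum χ (n + 1) s) Filter.atTop (nhds (logSumLimit χ s)) := by
  have hs : Summable fun n : ℕ => logSum χ (n + 2) s - logSum χ (n + 1) s := by
    refine Summable.of_norm_bounded (g := fun n : ℕ => 2 * M / ((n : ℝ) + 1) ^ 2) ?_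
      (norm_logSum_sub_le χ hM)
    have h := ((summable_nat_add_iff 1).2 (Real.summable_one_div_nat_pow.2 (one_lt_two))).mul_left (2 * M)
    refine h.congr fun n => ?_
    push_cast
    ring
  have h1 := (hs.hasSum.tendsto_sum_nat).const_add (logSum χ 1 s)
  refine h1.congr fun n => ?_
  have h2 := Finset.sum_range_sub (fun n : ℕ => logSum χ ((n : ℝ) + 1) s) n
  simp only [Nat.cast_zero, zero_add] at h2
  rw [← add_sub_cancel (logSum χ 1 s) (logSum χ (n + 1) s), ← h2]
  congr 1
  refine Finset.sum_congr rfl fun i _ => ?_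
  rw [Nat.cast_add, Nat.cast_one, add_assoc]
  norm_num

lemma re_logSumLimit_le {q : ℕ} (χ : DirichletCharacter ℂ q) {s : ℂ} {M B : ℝ}
    (hM : ∀ Y : ℝ, 1 ≤ Y → ‖logDerivSum χ Y s‖ ≤ M)
    (hB : ∀ Y : ℝ, 1 ≤ Y → (logDerivSum χ Y s).re ≤ B) {y : ℝ} (hy : 1 ≤ y) :
    (logSumLimit χ s).re ≤ (logSum χ y s).re + 2 * B / y := by
  have h1 : Filter.Tendsto (fun n : ℕ => (logSum χ (n + 1) s).re + 2 * B / ((n : ℝ) + 1))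
      Filter.atTop (nhds ((logSumLimit χ s).re + 0)) :=
    ((Complex.continuous_re.tendsto _).comp (tendsto_logSum χ hM)).add
      (tendsto_const_nhds.div_atTop
        (Filter.tendsto_atTop_add_const_right _ _ tendsto_natCast_atTop_atTop))
  rw [add_zero] at h1
  refine le_of_tendsto h1 ?_
  filter_upwards [Filter.eventually_ge_atTop ⌈y⌉₊] with n hn
  have hn1 : y ≤ n := (Nat.le_ceil y).trans (by exact_mod_cast hn)
  exact antitoneOn_logSum χ hB (Set.mem_Ici.2 hy) (Set.mem_Ici.2 (by linarith)) (by linarith)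

lemma differentiableAt_logSumLimit {q : ℕ} (χ : DirichletCharacter ℂ q) {U : Set ℂ} (hU : IsOpen U)
    {M : ℝ} (hM : ∀ s ∈ U, ∀ Y : ℝ, 1 ≤ Y → ‖logDerivSum χ Y s‖ ≤ M) {s : ℂ} (hs : s ∈ U) :
    DifferentiableAt ℂ (logSumLimit χ) s := by
  refine (differentiable_logSum χ 1).differentiableAt.add ?_
  refine (differentiableOn_tsum_of_summable_norm (u := fun n : ℕ => 2 * M / ((n : ℝ) + 1) ^ 2) ?_
    (fun n => ((differentiable_logSum χ _).sub (differentiable_logSum χ _)).differentiableOn) hU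
    fun n z hz => norm_logSum_sub_le χ (hM z hz) n).differentiableAt (hU.mem_nhds hs)
  have h := ((summable_nat_add_iff 1).2 (Real.summable_one_div_nat_pow.2 (one_lt_two))).mul_left (2 * M)
  refine h.congr fun n => ?_
  push_cast
  ring

lemma tendsto_logSum_LSeries {q : ℕ} (χ : DirichletCharacter ℂ q) {s : ℂ} (hs : 1 < s.re) :
    Filter.Tendsto (fun n : ℕ => logSum χ (n + 1) s) Filter.atTop
      (nhds (LSeries (fun n : ℕ => χ n * (ArithmeticFunction.vonMangoldt n : ℂ) / Real.log n) s)) := by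
  have hsum : LSeriesSummable (fun n : ℕ => χ n * (ArithmeticFunction.vonMangoldt n : ℂ)) s :=
    DirichletCharacter.LSeriesSummable_twist_vonMangoldt χ hs
  have heq : ∀ n : ℕ, logSum χ (n + 1) s = ∑' m : ℕ,
      (((max 0 (1 - Real.log m / ((n : ℝ) + 1))) ^ 2 / Real.log m : ℝ) : ℂ) *
      LSeries.term (fun n : ℕ => χ n * (ArithmeticFunction.vonMangoldt n : ℂ)) s m := fun n =>
    logSum_eq_tsum χ (by positivity) s
  simp only [heq]
  rw [LSeries]
  refine tendsto_tsum_of_dominated_convergence (hsum.norm.mul_left 2) (fun m => ?_)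
    (Filter.Eventually.of_forall fun n m => ?_)
  · have h1 : LSeries.term (fun n : ℕ => χ n * (ArithmeticFunction.vonMangoldt n : ℂ) / Real.log n) s m =
        ((1 / Real.log m : ℝ) : ℂ) *
        LSeries.term (fun n : ℕ => χ n * (ArithmeticFunction.vonMangoldt n : ℂ)) s m := by
      rcases eq_or_ne m 0 with rfl | hm
      · simp
      · rw [LSeries.term_of_ne_zero hm, LSeries.term_of_ne_zero hm]
        push_cast
        ring
    rw [h1]
    refine Filter.Tendsto.mul_const _ ((Complex.continuous_ofReal.tendsto _).comp ?_)
    refine Filter.Tendsto.div_const ?_ _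
    have h2 : Filter.Tendsto (fun n : ℕ => max 0 (1 - Real.log m / ((n : ℝ) + 1))) Filter.atTop
        (nhds (max 0 (1 - 0))) :=
      (tendsto_const_nhds).max (tendsto_const_nhds.sub (tendsto_const_nhds.div_atTop
        (Filter.tendsto_atTop_add_const_right _ _ tendsto_natCast_atTop_atTop)))
    simpa using h2.pow 2
  · rcases le_or_gt m 1 with hm | hm
    · have : Real.log m = 0 := by interval_cases m <;> simp
      rw [this]
      simp
    · rw [norm_mul, Complex.norm_real, Real.norm_eq_abs]
      refine mul_le_mul_of_nonneg_right ?_ (norm_nonneg _)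
      have hlog : 1 / 2 ≤ Real.log m := by
        have h2 : (2 : ℝ) ≤ m := by exact_mod_cast hm
        have := Real.log_le_log (by norm_num) h2
        have := Real.log_two_gt_d9
        linarith
      have h3 : 0 ≤ max 0 (1 - Real.log m / ((n : ℝ) + 1)) := le_max_left _ _
      have h4 : max 0 (1 - Real.log m / ((n : ℝ) + 1)) ≤ 1 := by
        refine max_le zero_le_one ?_
        have : 0 ≤ Real.log m / ((n : ℝ) + 1) := by positivity
        linarith
      rw [abs_of_nonneg (by positivity), div_le_iff₀ (by linarith)]
      nlinarith

lemma LFunction_eq_exp_logSumLimit (hGRH : GRH) {q : ℕ} [NeZero q] {χ : DirichletCharacter ℂ q}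
    (hχ : χ ≠ 1) {s : ℂ} (hs : 1 / 2 < s.re) :
    DirichletCharacter.LFunction χ s = Complex.exp (logSumLimit χ s) := by
  obtain ⟨C, hC, hCb⟩ := exists_logDerivSum_bounds hGRH
  have hdiff : ∀ z : ℂ, 1 / 2 < z.re → DifferentiableAt ℂ (logSumLimit χ) z := by
    intro z hz
    set δ := (z.re - 1 / 2) / 2 with hδ
    have hδ0 : 0 < δ := by rw [hδ]; linarith
    have hU : IsOpen {x : ℂ | 1 / 2 + δ < x.re ∧ |x.im| < |z.im| + 2} :=
      (isOpen_lt continuous_const Complex.continuous_re).inter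
        (isOpen_lt (continuous_abs.comp Complex.continuous_im) continuous_const)
    refine differentiableAt_logSumLimit χ hU
      (M := C * (1 + 1 / δ) * Real.log (q * (|z.im| + 2))) ?_ ⟨by rw [hδ]; linarith, by linarith⟩
    intro x hx Y hY
    refine (hCb q χ hχ (|z.im| + 2) Y x (by linarith [abs_nonneg z.im]) hY (by linarith [hx.1])
      hx.2.le).2.trans ?_
    have h1 : 1 / (x.re - 1 / 2) ≤ 1 / δ := one_div_le_one_div_of_le hδ0 (by linarith [hx.1])
    have hlog : 0 ≤ Real.log (q * (|z.im| + 2)) := Real.log_nonneg (by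
      have : (1 : ℝ) ≤ q := by exact_mod_cast NeZero.one_le
      nlinarith [abs_nonneg z.im])
    gcongr
  have hM : ∀ z : ℂ, 1 / 2 < z.re → ∃ M : ℝ, ∀ Y : ℝ, 1 ≤ Y → ‖logDerivSum χ Y z‖ ≤ M := fun z hz =>
    ⟨_, fun Y hY => (hCb q χ hχ (|z.im| + 2) Y z (by linarith [abs_nonneg z.im]) hY hz
      (by linarith)).2⟩
  set g : ℕ → ℂ := fun n : ℕ => χ n * (ArithmeticFunction.vonMangoldt n : ℂ) / Real.log n with hg
  have heq1 : ∀ z : ℂ, 1 < z.re → logSumLimit χ z = LSeries g z := by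
    intro z hz
    obtain ⟨M, hMz⟩ := hM z (by linarith)
    exact tendsto_nhds_unique (tendsto_logSum χ hMz) (tendsto_logSum_LSeries χ hz)
  have hgl : LSeries.logMul g = fun n : ℕ => χ n * (ArithmeticFunction.vonMangoldt n : ℂ) := by
    funext n
    rw [LSeries.logMul, hg, ← Complex.natCast_log]
    rcases le_or_gt n 1 with hn | hn
    · interval_cases n <;> simp
    · have : (Real.log n : ℂ) ≠ 0 := by
        have := Real.log_pos (show (1 : ℝ) < n by exact_mod_cast hn)
        exact_mod_cast this.ne'
      field_simp
  have habs : LSeries.abscissaOfAbsConv g ≤ (1 : ℝ) := by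
    rw [← LSeries.abscissaOfAbsConv_logMul, hgl]
    refine LSeries.abscissaOfAbsConv_le_of_forall_lt_LSeriesSummable fun y hy => ?_
    exact DirichletCharacter.LSeriesSummable_twist_vonMangoldt χ (by simpa using hy)
  have hder : ∀ z : ℂ, 1 < z.re → HasDerivAt (logSumLimit χ)
      (deriv (DirichletCharacter.LFunction χ) z / DirichletCharacter.LFunction χ z) z := by
    intro z hz
    have h1 : HasDerivAt (LSeries g) (-LSeries (LSeries.logMul g) z) z :=
      LSeries_hasDerivAt (lt_of_le_of_lt habs (by exact_mod_cast hz))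
    rw [hgl] at h1
    have h2 : LSeries (fun n : ℕ => χ n * (ArithmeticFunction.vonMangoldt n : ℂ)) z =
      -deriv (LSeries fun n : ℕ => χ n) z / LSeries (fun n : ℕ => χ n) z :=
      DirichletCharacter.LSeries_twist_vonMangoldt_eq χ hz
    rw [h2, ← DirichletCharacter.deriv_LFunction_eq_deriv_LSeries χ hz,
      ← DirichletCharacter.LFunction_eq_LSeries χ hz, neg_div, neg_neg] at h1
    refine h1.congr_of_eventuallyEq ?_
    filter_upwards [(isOpen_lt continuous_const Complex.continuous_re).mem_nhds
      (show (1 : ℝ) < z.re from hz)] with x hx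
    exact heq1 x hx
  have hLd : Differentiable ℂ (DirichletCharacter.LFunction χ) :=
    DirichletCharacter.differentiable_LFunction hχ
  set F : ℂ → ℂ := fun z => DirichletCharacter.LFunction χ z * Complex.exp (-logSumLimit χ z) with hF
  have hFd : ∀ z : ℂ, 1 / 2 < z.re → DifferentiableAt ℂ F z := fun z hz =>
    (hLd z).mul (hdiff z hz).neg.cexp
  have hFder : ∀ z : ℂ, 1 < z.re → HasDerivAt F 0 z := by
    intro z hz
    refine ((hLd z).hasDerivAt.mul (hder z hz).neg.cexp).congr_deriv ?_
    have h0 := LFunction_ne_zero_of_GRH hGRH hχ (s := z) (by linarith)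
    simp only [Pi.neg_apply]
    field_simp
    ring
  have hopen1 : IsOpen {z : ℂ | 1 < z.re} := isOpen_lt continuous_const Complex.continuous_re
  obtain ⟨a, ha⟩ := hopen1.exists_is_const_of_deriv_eq_zero (f := F)
    (convex_halfSpace_re_gt 1).isPreconnected
    (fun z hz => (hFder z hz).differentiableAt.differentiableWithinAt)
    (fun z hz => (hFder z hz).deriv)
  have hlim : Filter.Tendsto (fun x : ℝ => F x) Filter.atTop (nhds (1 * Complex.exp (-0))) := by
    have h1 : Filter.Tendsto (fun x : ℝ => LSeries (fun n : ℕ => χ n) x) Filter.atTop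
        (nhds (χ ((1 : ℕ) : ZMod q))) :=
      LSeries.tendsto_atTop (lt_of_le_of_lt (LSeries.abscissaOfAbsConv_le_of_forall_lt_LSeriesSummable
        (x := 1) fun y hy => DirichletCharacter.LSeriesSummable_of_one_lt_re χ (by simpa using hy))
        (EReal.coe_lt_top _))
    have h2 : Filter.Tendsto (fun x : ℝ => LSeries g x) Filter.atTop (nhds (g 1)) :=
      LSeries.tendsto_atTop (lt_of_le_of_lt habs (EReal.coe_lt_top _))
    have h3 : g 1 = 0 := by simp [hg]
    rw [h3] at h2
    rw [Nat.cast_one, map_one] at h1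
    refine (h1.mul h2.neg.cexp).congr' ?_
    filter_upwards [Filter.eventually_gt_atTop 1] with x hx
    rw [hF]
    simp only
    rw [heq1 x (by simpa using hx), DirichletCharacter.LFunction_eq_LSeries χ (by simpa using hx)]
  have ha1 : a = 1 := by
    have h1 : Filter.Tendsto (fun x : ℝ => F x) Filter.atTop (nhds a) := by
      refine tendsto_const_nhds.congr' ?_
      filter_upwards [Filter.eventually_gt_atTop 1] with x hx
      exact (ha x (by simpa using hx)).symm
    simpa using tendsto_nhds_unique h1 hlim
  have hall : Set.EqOn F (fun _ => 1) {z : ℂ | 1 / 2 < z.re} := by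
    refine AnalyticOnNhd.eqOn_of_preconnected_of_eventuallyEq (z₀ := 2)
      (DifferentiableOn.analyticOnNhd (fun z hz => (hFd z hz).differentiableWithinAt)
        isOpen_halfPlane) analyticOnNhd_const (convex_halfSpace_re_gt _).isPreconnected
      (by norm_num) ?_
    filter_upwards [hopen1.mem_nhds (show (1 : ℝ) < (2 : ℂ).re by norm_num)] with z hz
    rw [ha z hz, ha1]
  have h5 : F s = 1 := hall hs
  rw [hF] at h5
  simp only [Complex.exp_neg] at h5
  rwa [mul_inv_eq_one₀ (Complex.exp_ne_zero _)] at h5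

lemma exists_norm_LFunction_le_exp (hGRH : GRH) : ∃ C : ℝ, 0 < C ∧ ∀ (q : ℕ) [NeZero q]
    (χ : DirichletCharacter ℂ q), χ ≠ 1 → ∀ (S y t : ℝ), 2 ≤ S → 1 ≤ y → |t| ≤ S →
      ‖DirichletCharacter.LFunction χ (1 / 2 + t * I)‖ ≤
        Real.exp ((logSum χ y (1 / 2 + t * I)).re + C * Real.log (q * S) / y) := by
  obtain ⟨C, hC, hCb⟩ := exists_logDerivSum_bounds hGRH
  refine ⟨2 * C, by positivity, fun q _ χ hχ S y t hS hy ht => ?_⟩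
  have hLd : Differentiable ℂ (DirichletCharacter.LFunction χ) :=
    DirichletCharacter.differentiable_LFunction hχ
  have hLc : Continuous (DirichletCharacter.LFunction χ) := hLd.continuous
  have h1 : Filter.Tendsto (fun x : ℝ => ‖DirichletCharacter.LFunction χ (x + t * I)‖)
      (nhdsWithin (1 / 2) (Set.Ioi (1 / 2)))
      (nhds ‖DirichletCharacter.LFunction χ ((1 / 2 : ℝ) + t * I)‖) :=
    (Continuous.tendsto (by fun_prop) _).mono_left nhdsWithin_le_nhds
  have h2 : Filter.Tendsto (fun x : ℝ => Real.exp ((logSum χ y (x + t * I)).re +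
      2 * C * Real.log (q * S) / y)) (nhdsWithin (1 / 2) (Set.Ioi (1 / 2)))
      (nhds (Real.exp ((logSum χ y ((1 / 2 : ℝ) + t * I)).re + 2 * C * Real.log (q * S) / y))) := by
    have := (differentiable_logSum χ y).continuous
    exact (Continuous.tendsto (by fun_prop) _).mono_left nhdsWithin_le_nhds
  have h3 := le_of_tendsto_of_tendsto h1 h2 (by
    filter_upwards [self_mem_nhdsWithin] with x hx
    have hx : 1 / 2 < x := hx
    have hre : ((x : ℂ) + t * I).re = x := by simp
    have him : ((x : ℂ) + t * I).im = t := by simp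
    rw [LFunction_eq_exp_logSumLimit hGRH hχ (by rwa [hre]), Complex.norm_exp]
    refine Real.exp_le_exp.2 ?_
    have hb := fun (Y : ℝ) (hY : 1 ≤ Y) => hCb q χ hχ S Y (x + t * I) hS hY (by rwa [hre]) (by rwa [him])
    refine (re_logSumLimit_le χ (fun Y hY => (hb Y hY).2) (fun Y hY => (hb Y hY).1) hy).trans
      (le_of_eq ?_)
    ring)
  push_cast at h3
  exact h3

lemma norm_sum_char_mul_conj_le {q : ℕ} [NeZero q] (m n : ℕ) :
    ‖∑ χ : DirichletCharacter ℂ q, χ m * starRingEnd ℂ (χ n)‖ ≤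
      if m ≡ n [MOD q] then (Nat.totient q : ℝ) else 0 := by
  by_cases hn : IsUnit (n : ZMod q)
  · have h1 : ∀ χ : DirichletCharacter ℂ q, starRingEnd ℂ (χ n) = χ (n : ZMod q)⁻¹ := by
      intro χ
      have h2 : χ n * χ (n : ZMod q)⁻¹ = 1 := by
        rw [← map_mul, ZMod.mul_inv_of_unit _ hn, map_one]
      have h3 : starRingEnd ℂ (χ n) = (χ n)⁻¹ := by
        rw [starRingEnd_apply, MulChar.star_apply', MulChar.inv_apply_eq_inv']
      rw [h3]
      exact inv_eq_of_mul_eq_one_right h2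
    simp only [h1]
    rw [Finset.sum_congr rfl fun χ _ => mul_comm _ _, DirichletCharacter.sum_char_inv_mul_char_eq ℂ hn]
    have h4 : ((n : ZMod q) = m) ↔ m ≡ n [MOD q] := by
      rw [ZMod.natCast_eq_natCast_iff]
      exact ⟨Nat.ModEq.symm, Nat.ModEq.symm⟩
    by_cases h : m ≡ n [MOD q]
    · rw [if_pos (h4.2 h), if_pos h]; simp
    · rw [if_neg (fun hh => h (h4.1 hh)), if_neg h]; simp
  · have : ∀ χ : DirichletCharacter ℂ q, χ n = 0 := fun χ => χ.map_nonunit hn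
    simp only [this, map_zero, mul_zero, Finset.sum_const_zero, norm_zero]
    split_ifs <;> positivity

lemma norm_integral_exp_le {u S : ℝ} (hu : u ≠ 0) :
    ‖∫ t in (0 : ℝ)..S, Complex.exp (u * I * t)‖ ≤ 2 / |u| := by
  rw [integral_exp_mul_complex (by simp [hu])]
  rw [norm_div, norm_mul, Complex.norm_real, Complex.norm_I, mul_one, Real.norm_eq_abs]
  refine div_le_div_of_nonneg_right ?_ (abs_nonneg u)
  refine (norm_sub_le _ _).trans ?_
  have h : ∀ t : ℝ, ‖Complex.exp (u * I * t)‖ = 1 := by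
    intro t
    rw [show (u * I * t : ℂ) = (u * t : ℝ) * I by push_cast; ring]
    exact Complex.norm_exp_ofReal_mul_I _
  rw [h, h]; norm_num

lemma abs_log_sub_log_ge {q m n N : ℕ} (hm : 1 ≤ m) (hn : 1 ≤ n) (hmN : m ≤ N)
    (hnN : n ≤ N) (hmod : m ≡ n [MOD q]) (hne : m ≠ n) :
    (q : ℝ) / N ≤ |Real.log m - Real.log n| := by
  wlog hlt : n < m generalizing m n
  · rw [abs_sub_comm]
    exact this hn hm hnN hmN hmod.symm hne.symm (by omega)
  have h1 : q ∣ m - n := (Nat.modEq_iff_dvd' hlt.le).1 hmod.symm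
  have h2 : q ≤ m - n := Nat.le_of_dvd (by omega) h1
  have h3 : (q : ℝ) ≤ m - n := by
    rw [← Nat.cast_sub hlt.le]; exact_mod_cast h2
  have hm0 : (0 : ℝ) < m := by exact_mod_cast hm
  have hn0 : (0 : ℝ) < n := by exact_mod_cast hn
  have hmN' : (m : ℝ) ≤ N := by exact_mod_cast hmN
  have h4 := Real.one_sub_inv_le_log_of_pos (div_pos hm0 hn0)
  rw [Real.log_div hm0.ne' hn0.ne', inv_div] at h4
  refine le_trans ?_ (le_abs_self _)
  refine le_trans ?_ h4
  rw [div_le_iff₀ (by linarith)]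
  rw [one_sub_div hm0.ne', div_mul_eq_mul_div, le_div_iff₀ hm0]
  have : (q : ℝ) * m ≤ (m - n) * N := by gcongr; linarith
  exact this

lemma card_filter_modEq_le {ι : Type*} (s : Finset ι) (ν : ι → ℕ) (hν : Set.InjOn ν s) {q N : ℕ}
    (hN : ∀ i ∈ s, ν i ≤ N) {i : ι} (hi : i ∈ s) :
    (((s.filter fun j => ν j ≡ ν i [MOD q] ∧ ν j ≠ ν i).card : ℕ) : ℝ) ≤ N / q := by
  have h1 : (s.filter fun j => ν j ≡ ν i [MOD q]).card ≤ (Finset.range (N / q + 1)).card := by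
    refine Finset.card_le_card_of_injOn (fun j => ν j / q) (fun j hj => ?_) fun j hj k hk hjk => ?_
    · rw [Finset.mem_coe, Finset.mem_filter] at hj
      rw [Finset.mem_coe, Finset.mem_range, Nat.lt_add_one_iff]
      exact Nat.div_le_div_right (hN j hj.1)
    · rw [Finset.mem_coe, Finset.mem_filter] at hj hk
      refine hν hj.1 hk.1 ?_
      have h2 : ν j % q = ν k % q := hj.2.trans hk.2.symm
      have h3 : ν j / q = ν k / q := hjk
      rw [← Nat.div_add_mod (ν j) q, ← Nat.div_add_mod (ν k) q, h2, h3]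
  have h2 : (s.filter fun j => ν j ≡ ν i [MOD q] ∧ ν j ≠ ν i).card + 1 ≤
      (s.filter fun j => ν j ≡ ν i [MOD q]).card := by
    refine Finset.card_lt_card ((Finset.ssubset_iff_of_subset ?_).2 ⟨i, ?_, ?_⟩)
    · intro j hj
      rw [Finset.mem_filter] at hj ⊢
      exact ⟨hj.1, hj.2.1⟩
    · rw [Finset.mem_filter]; exact ⟨hi, rfl⟩
    · simp
  rw [Finset.card_range] at h1
  have h3 : (s.filter fun j => ν j ≡ ν i [MOD q] ∧ ν j ≠ ν i).card ≤ N / q := by omega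
  calc _ ≤ ((N / q : ℕ) : ℝ) := by exact_mod_cast h3
    _ ≤ N / q := Nat.cast_div_le

/-- `χ(n) n^{-it}`. -/
noncomputable def charTwist {q : ℕ} (χ : DirichletCharacter ℂ q) (t : ℝ) (n : ℕ) : ℂ :=
  χ n * Complex.exp (-(Real.log n : ℂ) * I * t)

lemma continuous_charTwist {q : ℕ} (χ : DirichletCharacter ℂ q) (n : ℕ) :
    Continuous fun t : ℝ => charTwist χ t n := by
  unfold charTwist; fun_prop

/-- Large sieve type mean value estimate for short Dirichlet polynomials. -/
lemma sum_integral_norm_sq_le {q : ℕ} [NeZero q] {ι : Type*} (s : Finset ι) (ν : ι → ℕ)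
    (hν : Set.InjOn ν s) {N : ℕ} {S : ℝ} (h1 : ∀ i ∈ s, 1 ≤ ν i) (hN : ∀ i ∈ s, ν i ≤ N)
    (hS : 0 ≤ S) (hNS : (N : ℝ) ^ 2 ≤ q * S) (a : ι → ℂ) :
    ∑ χ : DirichletCharacter ℂ q, ∫ t in (0 : ℝ)..S, ‖∑ i ∈ s, a i * charTwist χ t (ν i)‖ ^ 2 ≤
      3 * Nat.totient q * S * ∑ i ∈ s, ‖a i‖ ^ 2 := by
  have hq : 0 < q := NeZero.pos q
  have hq1 : (1 : ℝ) ≤ q := by exact_mod_cast hq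
  set W : ι → ι → ℝ := fun i j => if ν i = ν j then S else
    if ν i ≡ ν j [MOD q] then 2 * N / q else 0 with hW
  have hWsymm : ∀ i j, W i j = W j i := by
    intro i j
    simp only [hW, eq_comm (a := ν i), Nat.ModEq.comm (a := ν i)]
  have hW0 : ∀ i j, 0 ≤ W i j := by
    intro i j
    simp only [hW]
    split_ifs <;> positivity
  have hrow : ∀ i ∈ s, ∑ j ∈ s, W j i ≤ 3 * S := by
    intro i hi
    have h2 : ∀ j ∈ s, W j i ≤ (if j = i then S else 0) +
        (if ν j ≡ ν i [MOD q] ∧ ν j ≠ ν i then 2 * (N : ℝ) / q else 0) := by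
      intro j hj
      simp only [hW]
      by_cases hji : ν j = ν i
      · rw [if_pos hji, if_pos (hν hj hi hji)]
        simp [hji]
      · rw [if_neg hji, if_neg (fun h : j = i => hji (by rw [h]))]
        by_cases hm : ν j ≡ ν i [MOD q]
        · simp [hm, hji]
        · simp [hm]
    refine (Finset.sum_le_sum h2).trans ?_
    rw [Finset.sum_add_distrib, Finset.sum_ite_eq' s i, if_pos hi, ← Finset.sum_filter,
      Finset.sum_const, nsmul_eq_mul]
    have h3 := card_filter_modEq_le (q := q) s ν hν hN hi
    have h4 : (((s.filter fun j => ν j ≡ ν i [MOD q] ∧ ν j ≠ ν i).card : ℕ) : ℝ) * (2 * N / q) ≤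
        N / q * (2 * N / q) := by gcongr
    have h5 : (N : ℝ) / q * (2 * N / q) ≤ 2 * S := by
      rw [div_mul_div_comm, div_le_iff₀ (by positivity)]
      have : (q : ℝ) * S ≤ q * S * q := le_mul_of_one_le_right (by positivity) hq1
      nlinarith
    linarith
  have hint : ∀ i ∈ s, ∀ j ∈ s, ‖(∑ χ : DirichletCharacter ℂ q, χ (ν i) * starRingEnd ℂ (χ (ν j))) *
      ∫ t in (0 : ℝ)..S, Complex.exp ((Real.log (ν j) - Real.log (ν i) : ℝ) * I * t)‖ ≤
      Nat.totient q * W i j := by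
    intro i hi j hj
    rw [norm_mul]
    have hc := norm_sum_char_mul_conj_le (q := q) (ν i) (ν j)
    simp only [hW]
    by_cases hij : ν i = ν j
    · rw [if_pos hij]
      refine mul_le_mul (hc.trans ?_) ?_ (norm_nonneg _) (by positivity)
      · split_ifs <;> simp
      · rw [hij]
        simp [abs_of_nonneg hS]
    · rw [if_neg hij]
      by_cases hm : ν i ≡ ν j [MOD q]
      · rw [if_pos hm]
        rw [if_pos hm] at hc
        have h3 := abs_log_sub_log_ge (h1 j hj) (h1 i hi) (hN j hj) (hN i hi) hm.symm (Ne.symm hij)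
        have hN0 : (0 : ℝ) < N := by
          have := (h1 i hi).trans (hN i hi)
          exact_mod_cast this
        have hqN : 0 < (q : ℝ) / N := by positivity
        refine mul_le_mul hc ((norm_integral_exp_le ?_).trans ?_) (norm_nonneg _) (by positivity)
        · exact abs_pos.1 (hqN.trans_le h3)
        · calc 2 / |Real.log (ν j) - Real.log (ν i)| ≤ 2 / ((q : ℝ) / N) := by gcongr
            _ = _ := by field_simp
      · rw [if_neg hm] at hc ⊢
        rw [le_antisymm hc (norm_nonneg _)]
        simp
  have hexp : ((∑ χ : DirichletCharacter ℂ q,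
      ∫ t in (0 : ℝ)..S, ‖∑ i ∈ s, a i * charTwist χ t (ν i)‖ ^ 2 : ℝ) : ℂ) =
      ∑ i ∈ s, ∑ j ∈ s, a i * starRingEnd ℂ (a j) *
        ((∑ χ : DirichletCharacter ℂ q, χ (ν i) * starRingEnd ℂ (χ (ν j))) *
          ∫ t in (0 : ℝ)..S, Complex.exp ((Real.log (ν j) - Real.log (ν i) : ℝ) * I * t)) := by
    have hpt : ∀ (χ : DirichletCharacter ℂ q) (t : ℝ),
        ((‖∑ i ∈ s, a i * charTwist χ t (ν i)‖ ^ 2 : ℝ) : ℂ) =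
        ∑ i ∈ s, ∑ j ∈ s, a i * starRingEnd ℂ (a j) * (χ (ν i) * starRingEnd ℂ (χ (ν j))) *
          Complex.exp ((Real.log (ν j) - Real.log (ν i) : ℝ) * I * t) := by
      intro χ t
      rw [Complex.ofReal_pow, ← Complex.mul_conj', map_sum, Finset.sum_mul_sum]
      refine Finset.sum_congr rfl fun i _ => Finset.sum_congr rfl fun j _ => ?_
      simp only [charTwist, map_mul, ← Complex.exp_conj, map_neg, Complex.conj_I, Complex.conj_ofReal]
      rw [Complex.ofReal_sub, show ((Real.log (ν j) : ℂ) - Real.log (ν i)) * I * t =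
        -(Real.log (ν i) : ℂ) * I * t + -(Real.log (ν j) : ℂ) * -I * t by ring, Complex.exp_add]
      ring
    rw [Complex.ofReal_sum]
    simp only [← intervalIntegral.integral_ofReal, hpt]
    have hI : ∀ χ : DirichletCharacter ℂ q, ∫ t in (0 : ℝ)..S, ∑ i ∈ s, ∑ j ∈ s,
        a i * starRingEnd ℂ (a j) * (χ (ν i) * starRingEnd ℂ (χ (ν j))) *
          Complex.exp ((Real.log (ν j) - Real.log (ν i) : ℝ) * I * t) =
        ∑ i ∈ s, ∑ j ∈ s, a i * starRingEnd ℂ (a j) * (χ (ν i) * starRingEnd ℂ (χ (ν j))) *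
          ∫ t in (0 : ℝ)..S, Complex.exp ((Real.log (ν j) - Real.log (ν i) : ℝ) * I * t) := by
      intro χ
      rw [intervalIntegral.integral_finsetSum fun i _ =>
        Continuous.intervalIntegrable (by fun_prop) _ _]
      refine Finset.sum_congr rfl fun i _ => ?_
      rw [intervalIntegral.integral_finsetSum fun i _ =>
        Continuous.intervalIntegrable (by fun_prop) _ _]
      exact Finset.sum_congr rfl fun j _ => intervalIntegral.integral_const_mul _ _
    simp only [hI]
    rw [Finset.sum_comm]
    refine Finset.sum_congr rfl fun i _ => ?_
    rw [Finset.sum_comm]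
    refine Finset.sum_congr rfl fun j _ => ?_
    rw [Finset.sum_mul, Finset.mul_sum]
    exact Finset.sum_congr rfl fun χ _ => by ring
  have hfin : ∑ χ : DirichletCharacter ℂ q,
      ∫ t in (0 : ℝ)..S, ‖∑ i ∈ s, a i * charTwist χ t (ν i)‖ ^ 2 ≤
      ∑ i ∈ s, ∑ j ∈ s, ‖a i‖ * ‖a j‖ * (Nat.totient q * W i j) := by
    refine (le_abs_self _).trans ?_
    rw [← Real.norm_eq_abs, ← Complex.norm_real, hexp]
    refine (norm_sum_le _ _).trans (Finset.sum_le_sum fun i hi => ?_)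
    refine (norm_sum_le _ _).trans (Finset.sum_le_sum fun j hj => ?_)
    rw [norm_mul, norm_mul, RCLike.norm_conj]
    exact mul_le_mul_of_nonneg_left (hint i hi j hj) (by positivity)
  refine hfin.trans ?_
  have hamgm : ∀ i ∈ s, ∀ j ∈ s, ‖a i‖ * ‖a j‖ * (Nat.totient q * W i j) ≤
      Nat.totient q * (‖a i‖ ^ 2 / 2 * W j i) + Nat.totient q * (‖a j‖ ^ 2 / 2 * W i j) := by
    intro i _ j _
    rw [hWsymm j i]
    have h2 : ‖a i‖ * ‖a j‖ ≤ ‖a i‖ ^ 2 / 2 + ‖a j‖ ^ 2 / 2 := by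
      nlinarith [sq_nonneg (‖a i‖ - ‖a j‖)]
    have := mul_le_mul_of_nonneg_right h2 (mul_nonneg (Nat.cast_nonneg (Nat.totient q)) (hW0 i j))
    refine this.trans (le_of_eq ?_)
    ring
  refine (Finset.sum_le_sum fun i hi => Finset.sum_le_sum (hamgm i hi)).trans ?_
  simp only [Finset.sum_add_distrib]
  rw [Finset.sum_comm (f := fun i j => (Nat.totient q : ℝ) * (‖a j‖ ^ 2 / 2 * W i j))]
  rw [← Finset.sum_add_distrib, Finset.mul_sum]
  refine Finset.sum_le_sum fun i hi => ?_
  rw [← Finset.mul_sum, ← Finset.mul_sum]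
  have h2 : (Nat.totient q : ℝ) * (‖a i‖ ^ 2 / 2 * ∑ j ∈ s, W j i) ≤
      Nat.totient q * (‖a i‖ ^ 2 / 2 * (3 * S)) := by gcongr; exact hrow i hi
  linarith

/-- Expansion of the `m`-th power of a prime sum, with an `ℓ²` bound for the coefficients. -/
lemma exists_prime_sum_pow_eq (P : Finset ℕ) (hP : ∀ p ∈ P, p.Prime) {X : ℕ} (hX : ∀ p ∈ P, p ≤ X)
    (c : ℕ → ℂ) (m : ℕ) : ∃ (A : Finset ℕ) (a : ℕ → ℂ),
      (∀ n ∈ A, n ≠ 0 ∧ n ≤ X ^ m ∧ n.primeFactorsList.length = m) ∧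
      (∀ ψ : ℕ → ℂ, (∀ m n, m ≠ 0 → n ≠ 0 → ψ (m * n) = ψ m * ψ n) → ψ 1 = 1 →
        (∑ p ∈ P, c p * ψ p) ^ m = ∑ n ∈ A, a n * ψ n) ∧
      ∑ n ∈ A, ‖a n‖ ^ 2 ≤ m.factorial * (∑ p ∈ P, ‖c p‖ ^ 2) ^ m := by
  induction m with
  | zero => exact ⟨{1}, fun _ => 1, by simp, fun ψ _ h => by simp [h], by simp⟩
  | succ m ih =>
    obtain ⟨A, a, hA, hψ, ha⟩ := ih
    set f : ℕ × ℕ → ℕ := fun x => x.1 * x.2 with hf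
    set b : ℕ → ℂ := fun k => ∑ x ∈ (P ×ˢ A).filter (fun x => f x = k), c x.1 * a x.2 with hb
    have hmaps : ∀ x ∈ P ×ˢ A, f x ∈ (P ×ˢ A).image f := fun x hx => Finset.mem_image_of_mem _ hx
    have hB : ∀ k ∈ (P ×ˢ A).image f,
        k ≠ 0 ∧ k ≤ X ^ (m + 1) ∧ k.primeFactorsList.length = m + 1 := by
      intro k hk
      obtain ⟨x, hx, rfl⟩ := Finset.mem_image.1 hk
      rw [Finset.mem_product] at hx
      obtain ⟨h1, h2, h3⟩ := hA _ hx.2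
      have hp := hP _ hx.1
      refine ⟨mul_ne_zero hp.ne_zero h1, ?_, ?_⟩
      · rw [pow_succ, mul_comm (X ^ m)]
        exact Nat.mul_le_mul (hX _ hx.1) h2
      · rw [(Nat.perm_primeFactorsList_mul hp.ne_zero h1).length_eq, List.length_append,
          Nat.primeFactorsList_prime hp, h3]
        simp [add_comm]
    refine ⟨(P ×ˢ A).image f, b, hB, fun ψ hmul hone => ?_, ?_⟩
    · rw [pow_succ, hψ ψ hmul hone, mul_comm, Finset.sum_mul_sum, ← Finset.sum_product',
        ← Finset.sum_fiberwise_of_maps_to hmaps]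
      refine Finset.sum_congr rfl fun k _ => ?_
      rw [hb, Finset.sum_mul]
      refine Finset.sum_congr rfl fun x hx => ?_
      rw [Finset.mem_filter, Finset.mem_product] at hx
      rw [← hx.2, hf]
      simp only
      rw [hmul _ _ (hP _ hx.1.1).ne_zero (hA _ hx.1.2).1]
      ring
    · have hcard : ∀ k ∈ (P ×ˢ A).image f, ((P ×ˢ A).filter fun x => f x = k).card ≤ m + 1 := by
        intro k hk
        obtain ⟨h1, -, h3⟩ := hB k hk
        have h4 : ((P ×ˢ A).filter fun x => f x = k).card ≤ k.primeFactors.card := by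
          refine Finset.card_le_card_of_injOn Prod.fst (fun x hx => ?_) fun x hx y hy hxy => ?_
          · rw [Finset.mem_coe, Finset.mem_filter, Finset.mem_product] at hx
            rw [Finset.mem_coe, Nat.mem_primeFactors]
            exact ⟨hP _ hx.1.1, ⟨x.2, hx.2.symm⟩, h1⟩
          · rw [Finset.mem_coe, Finset.mem_filter, Finset.mem_product] at hx hy
            refine Prod.ext hxy ?_
            have h5 : x.1 * x.2 = y.1 * y.2 := hx.2.trans hy.2.symm
            rw [hxy] at h5
            exact Nat.eq_of_mul_eq_mul_left (hP _ hy.1.1).pos h5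
        refine h4.trans ?_
        rw [← h3]
        exact List.toFinset_card_le _
      have hle : ∀ k ∈ (P ×ˢ A).image f, ‖b k‖ ^ 2 ≤
          (m + 1) * ∑ x ∈ (P ×ˢ A).filter (fun x => f x = k), (‖c x.1‖ ^ 2 * ‖a x.2‖ ^ 2) := by
        intro k hk
        have h1 : ‖b k‖ ≤ ∑ x ∈ (P ×ˢ A).filter (fun x => f x = k), ‖c x.1‖ * ‖a x.2‖ := by
          refine (norm_sum_le _ _).trans (le_of_eq ?_)
          simp only [norm_mul]
        calc ‖b k‖ ^ 2 ≤ (∑ x ∈ (P ×ˢ A).filter (fun x => f x = k), ‖c x.1‖ * ‖a x.2‖) ^ 2 := by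
              gcongr
          _ ≤ _ := sq_sum_le_card_mul_sum_sq
          _ ≤ (m + 1) * ∑ x ∈ (P ×ˢ A).filter (fun x => f x = k), (‖c x.1‖ * ‖a x.2‖) ^ 2 := by
              gcongr
              exact_mod_cast hcard k hk
          _ = _ := by simp only [mul_pow]
      refine (Finset.sum_le_sum hle).trans ?_
      have hprod : ∑ x ∈ P ×ˢ A, ‖c x.1‖ ^ 2 * ‖a x.2‖ ^ 2 =
          (∑ p ∈ P, ‖c p‖ ^ 2) * ∑ n ∈ A, ‖a n‖ ^ 2 := by
        rw [Finset.sum_product, Finset.sum_mul_sum]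
      rw [← Finset.mul_sum, Finset.sum_fiberwise_of_maps_to hmaps, hprod, Nat.factorial_succ, pow_succ]
      have hs : 0 ≤ ∑ p ∈ P, ‖c p‖ ^ 2 := Finset.sum_nonneg fun _ _ => by positivity
      calc ((m : ℝ) + 1) * ((∑ p ∈ P, ‖c p‖ ^ 2) * ∑ n ∈ A, ‖a n‖ ^ 2) ≤
          (m + 1) * ((∑ p ∈ P, ‖c p‖ ^ 2) * (m.factorial * (∑ p ∈ P, ‖c p‖ ^ 2) ^ m)) := by gcongr
        _ = _ := by push_cast; ring

lemma charTwist_one {q : ℕ} (χ : DirichletCharacter ℂ q) (t : ℝ) : charTwist χ t 1 = 1 := by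
  simp [charTwist]

lemma charTwist_mul {q : ℕ} (χ : DirichletCharacter ℂ q) (t : ℝ) {m n : ℕ} (hm : m ≠ 0)
    (hn : n ≠ 0) : charTwist χ t (m * n) = charTwist χ t m * charTwist χ t n := by
  rw [charTwist, Nat.cast_mul, map_mul, Nat.cast_mul, Real.log_mul (by exact_mod_cast hm)
    (by exact_mod_cast hn), charTwist, charTwist, Complex.ofReal_add,
    show -((Real.log m : ℂ) + Real.log n) * I * t = -(Real.log m : ℂ) * I * t +
      -(Real.log n : ℂ) * I * t by ring, Complex.exp_add]
  ring

lemma charTwist_pow {q : ℕ} (χ : DirichletCharacter ℂ q) (t : ℝ) {n : ℕ} (hn : n ≠ 0) (e : ℕ) :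
    charTwist χ t (n ^ e) = charTwist χ t n ^ e := by
  induction e with
  | zero => simp [charTwist_one]
  | succ e ih => rw [pow_succ, charTwist_mul χ t (pow_ne_zero _ hn) hn, ih, pow_succ]

/-- Even moments of prime sums. -/
lemma sum_integral_norm_prime_sum_pow_le {q : ℕ} [NeZero q] (P : Finset ℕ) (hP : ∀ p ∈ P, p.Prime)
    {X : ℕ} (hX : ∀ p ∈ P, p ≤ X) (c : ℕ → ℂ) {e m : ℕ} (he : e ≠ 0) {S : ℝ} (hS : 0 ≤ S)
    (hXS : ((X : ℝ) ^ (m * e)) ^ 2 ≤ q * S) :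
    ∑ χ : DirichletCharacter ℂ q,
        ∫ t in (0 : ℝ)..S, ‖∑ p ∈ P, c p * charTwist χ t p ^ e‖ ^ (2 * m) ≤
      3 * Nat.totient q * S * (m.factorial * (∑ p ∈ P, ‖c p‖ ^ 2) ^ m) := by
  obtain ⟨A, a, hA, hψ, ha⟩ := exists_prime_sum_pow_eq P hP hX c m
  have h1 : ∀ (χ : DirichletCharacter ℂ q) (t : ℝ),
      ‖∑ p ∈ P, c p * charTwist χ t p ^ e‖ ^ (2 * m) =
      ‖∑ n ∈ A, a n * charTwist χ t (n ^ e)‖ ^ 2 := by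
    intro χ t
    rw [mul_comm 2 m, pow_mul, ← norm_pow, hψ (fun n => charTwist χ t n ^ e)
      (fun m n hm hn => by rw [charTwist_mul χ t hm hn, mul_pow])
      (by simp [charTwist_one])]
    congr 2
    exact Finset.sum_congr rfl fun n hn => by rw [charTwist_pow χ t (hA n hn).1]
  simp only [h1]
  refine (sum_integral_norm_sq_le A (fun n => n ^ e)
    (fun x _ y _ h => Nat.pow_left_injective he h) (N := X ^ (m * e))
    (fun n hn => Nat.one_le_pow _ _ (Nat.pos_of_ne_zero (hA n hn).1)) (fun n hn => ?_) hS
    (by push_cast; exact hXS) a).trans ?_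
  · rw [pow_mul]
    exact Nat.pow_le_pow_left (hA n hn).2.1 e
  · gcongr

lemma sum_log_div_prime_le {N : ℕ} (hN : 1 ≤ N) :
    ∑ p ∈ Finset.Ioc 0 N with p.Prime, Real.log p / p ≤ Real.log N + Real.log 4 := by
  have hN0 : (0 : ℝ) < N := by exact_mod_cast hN
  have hfac : Real.log (N.factorial) ≤ N * Real.log N := by
    rw [← Real.log_pow]
    apply Real.log_le_log (by exact_mod_cast N.factorial_pos)
    exact_mod_cast Nat.factorial_le_pow N
  have hlog : ∀ M : ℕ, Real.log (M.factorial) = ∑ n ∈ Finset.range M, Real.log ((n + 1 : ℕ) : ℝ) := by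
    intro M
    induction M with
    | zero => simp
    | succ M ih =>
      rw [Finset.sum_range_succ, ← ih, Nat.factorial_succ, Nat.cast_mul, Real.log_mul
        (by positivity) (by positivity), add_comm]
  have hdiv : ∀ n : ℕ, ∑ p ∈ Finset.Ioc 0 N with p.Prime, (if p ∣ n + 1 then Real.log p else 0)
      ≤ Real.log ((n + 1 : ℕ) : ℝ) := by
    intro n
    rw [← Finset.sum_filter]
    calc _ ≤ ∑ p ∈ (n + 1).primeFactors, Real.log p := by
          apply Finset.sum_le_sum_of_subset_of_nonneg
          · intro p hp
            simp only [Finset.mem_filter] at hp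
            exact Nat.mem_primeFactors.2 ⟨hp.1.2, hp.2, by omega⟩
          · intro p _ _
            exact Real.log_natCast_nonneg p
      _ = Real.log ((∏ p ∈ (n + 1).primeFactors, p : ℕ) : ℝ) := by
          rw [Nat.cast_prod, Real.log_prod]
          intro p hp
          have := (Nat.prime_of_mem_primeFactors hp).pos
          positivity
      _ ≤ _ := by
          have hd := Nat.prod_primeFactors_dvd (n + 1)
          apply Real.log_le_log
          · have := Nat.pos_of_dvd_of_pos hd (by omega)
            exact_mod_cast this
          · exact_mod_cast Nat.le_of_dvd (by omega) hd
  have hsum : ∑ p ∈ Finset.Ioc 0 N with p.Prime, ((N / p : ℕ) : ℝ) * Real.log p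
      ≤ N * Real.log N := by
    refine le_trans (le_of_eq ?_) ((Finset.sum_le_sum fun n (_ : n ∈ Finset.range N) =>
      hdiv n).trans ((hlog N).symm.le.trans hfac))
    rw [Finset.sum_comm]
    refine Finset.sum_congr rfl fun p _ => ?_
    rw [← Finset.sum_filter, Finset.sum_const, Nat.card_multiples, nsmul_eq_mul]
  have htheta : ∑ p ∈ Finset.Ioc 0 N with p.Prime, Real.log p ≤ Real.log 4 * N := by
    have := Chebyshev.theta_le_log4_mul_x (x := N) (by positivity)
    rwa [Chebyshev.theta, Nat.floor_natCast] at this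
  have hfloor : ∀ p ∈ (Finset.Ioc 0 N).filter Nat.Prime,
      (N : ℝ) * (Real.log p / p) - Real.log p ≤ ((N / p : ℕ) : ℝ) * Real.log p := by
    intro p hp
    simp only [Finset.mem_filter] at hp
    have hp0 : (0 : ℝ) < p := by exact_mod_cast hp.2.pos
    have h1 : (N : ℝ) / p - 1 ≤ ((N / p : ℕ) : ℝ) := by
      rw [← Nat.floor_div_eq_div (K := ℝ)]
      exact (Nat.sub_one_lt_floor _).le
    have := mul_le_mul_of_nonneg_right h1 (Real.log_natCast_nonneg p)
    calc _ = ((N : ℝ) / p - 1) * Real.log p := by field_simp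
      _ ≤ _ := this
  have h2 := (Finset.sum_le_sum hfloor).trans hsum
  rw [Finset.sum_sub_distrib, ← Finset.mul_sum] at h2
  have h3 : (N : ℝ) * ∑ p ∈ Finset.Ioc 0 N with p.Prime, Real.log p / p
      ≤ N * (Real.log N + Real.log 4) := by linarith
  exact le_of_mul_le_mul_left h3 hN0

lemma sum_inv_prime_Ioc_le {M N : ℕ} (hM : 2 ≤ M) (hMN : M ≤ N) :
    ∑ p ∈ Finset.Ioc M N with p.Prime, (1 : ℝ) / p
      ≤ Real.log (Real.log N) - Real.log (Real.log M) + 5 := by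
  have hlog2 : 0 < Real.log 2 := Real.log_pos (by norm_num)
  have hlogle : ∀ n : ℕ, 2 ≤ n → Real.log 2 ≤ Real.log n := fun n hn =>
    Real.log_le_log (by norm_num) (by exact_mod_cast hn)
  have h4 : Real.log 4 = 2 * Real.log 2 := by
    rw [show (4 : ℝ) = 2 ^ 2 by norm_num, Real.log_pow]; norm_num
  set A : ℕ → ℝ := fun n => ∑ p ∈ Finset.Ioc 0 n with p.Prime, Real.log p / p with hA
  have hA0 : ∀ n, 0 ≤ A n := fun n => Finset.sum_nonneg fun p _ =>
    div_nonneg (Real.log_natCast_nonneg p) (Nat.cast_nonneg p)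
  have key : ∑ p ∈ Finset.Ioc M N with p.Prime, (1 : ℝ) / p
      ≤ A N / Real.log N - A M / Real.log M + (Real.log (Real.log N) - Real.log (Real.log M))
        + Real.log 4 * (1 / Real.log M - 1 / Real.log N) := by
    induction N, hMN using Nat.le_induction with
    | base => simp
    | succ N hMN ih =>
      have hN2 : 2 ≤ N := hM.trans hMN
      have hLN : 0 < Real.log N := hlog2.trans_le (hlogle N hN2)
      have hLN1 : 0 < Real.log ((N + 1 : ℕ) : ℝ) := hlog2.trans_le (hlogle _ (by omega))
      have hmono : Real.log N ≤ Real.log ((N + 1 : ℕ) : ℝ) :=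
        Real.log_le_log (by positivity) (by push_cast; linarith)
      have hstep : ∀ (a : ℕ) (_ : a ≤ N) (f : ℕ → ℝ),
          ∑ p ∈ Finset.Ioc a (N + 1) with p.Prime, f p
            = ∑ p ∈ Finset.Ioc a N with p.Prime, f p + if (N + 1).Prime then f (N + 1) else 0 := by
        intro a ha f
        rw [Finset.sum_filter, Finset.sum_filter, Finset.sum_Ioc_succ_top ha]
      have hAs : A (N + 1) = A N + if (N + 1).Prime then
          Real.log ((N + 1 : ℕ) : ℝ) / ((N + 1 : ℕ) : ℝ) else 0 := hstep 0 (by omega) _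
      have hinv : 1 / Real.log ((N + 1 : ℕ) : ℝ) ≤ 1 / Real.log N :=
        one_div_le_one_div_of_le hLN hmono
      have hAN : A N ≤ Real.log N + Real.log 4 := sum_log_div_prime_le (by omega)
      have h1 : A N * (1 / Real.log N - 1 / Real.log ((N + 1 : ℕ) : ℝ))
          ≤ (Real.log N + Real.log 4) * (1 / Real.log N - 1 / Real.log ((N + 1 : ℕ) : ℝ)) :=
        mul_le_mul_of_nonneg_right hAN (by linarith)
      have h2 : 1 - Real.log N / Real.log ((N + 1 : ℕ) : ℝ)
          ≤ Real.log (Real.log ((N + 1 : ℕ) : ℝ)) - Real.log (Real.log N) := by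
        rw [← Real.log_div hLN1.ne' hLN.ne']
        have := Real.one_sub_inv_le_log_of_pos (div_pos hLN1 hLN)
        rwa [inv_div] at this
      have h3 : (if (N + 1).Prime then (1 : ℝ) / ((N + 1 : ℕ) : ℝ) else 0)
          = (A (N + 1) - A N) / Real.log ((N + 1 : ℕ) : ℝ) := by
        rw [hAs]
        split_ifs
        · field_simp; ring
        · simp
      rw [hstep M hMN, h3]
      have h4 : Real.log N * (1 / Real.log N - 1 / Real.log ((N + 1 : ℕ) : ℝ))
          = 1 - Real.log N / Real.log ((N + 1 : ℕ) : ℝ) := by field_simp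
      have h5 : (A (N + 1) - A N) / Real.log ((N + 1 : ℕ) : ℝ)
          = A (N + 1) / Real.log ((N + 1 : ℕ) : ℝ) - A N / Real.log N
            + A N * (1 / Real.log N - 1 / Real.log ((N + 1 : ℕ) : ℝ)) := by
        field_simp; ring
      rw [h5]
      linarith [ih, h1, h2, h4]
  have hLM : 0 < Real.log M := hlog2.trans_le (hlogle M hM)
  have hLN : 0 < Real.log N := hlog2.trans_le (hlogle N (hM.trans hMN))
  have h1 : A N / Real.log N ≤ 3 := by
    rw [div_le_iff₀ hLN]
    have := sum_log_div_prime_le (N := N) (by omega)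
    have := hlogle N (hM.trans hMN)
    simp only [hA]
    linarith
  have h2 : 0 ≤ A M / Real.log M := div_nonneg (hA0 M) hLM.le
  have h3 : Real.log 4 * (1 / Real.log M - 1 / Real.log N) ≤ 2 := by
    have h0 : 0 ≤ 1 / Real.log N := by positivity
    have h6 : 1 / Real.log M ≤ 1 / Real.log 2 := one_div_le_one_div_of_le hlog2 (hlogle M hM)
    calc Real.log 4 * (1 / Real.log M - 1 / Real.log N) ≤ Real.log 4 * (1 / Real.log 2) :=
          mul_le_mul_of_nonneg_left (by linarith) (by linarith)
      _ = 2 := by rw [h4]; field_simp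
  linarith

lemma sum_inv_prime_le {N : ℕ} (hN : 2 ≤ N) :
    ∑ p ∈ Finset.Ioc 0 N with p.Prime, (1 : ℝ) / p ≤ Real.log (Real.log N) + 6 := by
  have h1 := sum_inv_prime_Ioc_le le_rfl hN
  have h2 : ∑ p ∈ Finset.Ioc 0 N with p.Prime, (1 : ℝ) / p
      = 1 / 2 + ∑ p ∈ Finset.Ioc 2 N with p.Prime, (1 : ℝ) / p := by
    simp only [Finset.sum_filter]
    rw [← Finset.sum_Ioc_consecutive _ (Nat.zero_le 2) hN]
    congr 1
    rw [Finset.sum_Ioc_succ_top (by norm_num), Finset.sum_Ioc_succ_top (by norm_num)]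
    norm_num [Nat.prime_two]
  have h3 : -(1 / 2 : ℝ) ≤ Real.log (Real.log ((2 : ℕ) : ℝ)) := by
    have h4 : (0.69 : ℝ) < Real.log 2 := by linarith [Real.log_two_gt_d9]
    have h5 := Real.one_sub_inv_le_log_of_pos (x := Real.log 2) (by linarith)
    have h6 : (Real.log 2)⁻¹ ≤ 0.69⁻¹ := inv_anti₀ (by norm_num) h4.le
    push_cast
    norm_num at h6 ⊢
    linarith
  linarith

noncomputable def primePoly {q : ℕ} (χ : DirichletCharacter ℂ q) (y : ℝ) (e : ℕ) (P : Finset ℕ)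
    (t : ℝ) : ℂ :=
  ∑ p ∈ P, (((max 0 (1 - Real.log ((p ^ e : ℕ) : ℝ) / y)) ^ 2 / e * (p : ℝ) ^ (-(e / 2 : ℝ)) : ℝ) : ℂ)
    * charTwist χ t p ^ e

lemma logSum_term_prime_pow {q : ℕ} (χ : DirichletCharacter ℂ q) (y t : ℝ) {p e : ℕ} (hp : p.Prime)
    (he : e ≠ 0) :
    (((max 0 (1 - Real.log ((p ^ e : ℕ) : ℝ) / y)) ^ 2 / Real.log ((p ^ e : ℕ) : ℝ) : ℝ) : ℂ) *
      LSeries.term (fun n : ℕ => χ n * (ArithmeticFunction.vonMangoldt n : ℂ)) (1 / 2 + t * I) (p ^ e)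
    = (((max 0 (1 - Real.log ((p ^ e : ℕ) : ℝ) / y)) ^ 2 / e * (p : ℝ) ^ (-(e / 2 : ℝ)) : ℝ) : ℂ)
      * charTwist χ t p ^ e := by
  have hp0 : (0 : ℝ) < p := by exact_mod_cast hp.pos
  have hlp : 0 < Real.log p := Real.log_pos (by exact_mod_cast hp.one_lt)
  have he0 : (0 : ℝ) < e := by exact_mod_cast Nat.pos_of_ne_zero he
  have hn0 : p ^ e ≠ 0 := pow_ne_zero _ hp.ne_zero
  have hlog : Real.log ((p ^ e : ℕ) : ℝ) = e * Real.log p := by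
    rw [Nat.cast_pow, Real.log_pow]
  have hcpow : χ ((p ^ e : ℕ) : ZMod q) / ((p ^ e : ℕ) : ℂ) ^ (1 / 2 + t * I : ℂ)
      = (((p : ℝ) ^ (-(e / 2 : ℝ)) : ℝ) : ℂ) * charTwist χ t p ^ e := by
    rw [← charTwist_pow χ t hp.ne_zero, charTwist, Complex.cpow_def_of_ne_zero
      (by exact_mod_cast hn0), Real.rpow_def_of_pos hp0, Complex.ofReal_exp, div_eq_mul_inv,
      ← Complex.exp_neg, mul_left_comm, ← Complex.exp_add, hlog, ← Complex.natCast_log, hlog]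
    congr 2
    push_cast
    ring
  rw [LSeries.term_of_ne_zero hn0, ArithmeticFunction.vonMangoldt_apply_pow he,
    ArithmeticFunction.vonMangoldt_apply_prime hp, mul_div_right_comm, hcpow, hlog]
  have : (Real.log p : ℂ) ≠ 0 := by exact_mod_cast hlp.ne'
  have : (e : ℂ) ≠ 0 := by exact_mod_cast he
  simp only [Complex.ofReal_mul, Complex.ofReal_div, Complex.ofReal_natCast]
  field_simp

lemma max_zero_one_sub_log_div_le_one {y : ℝ} (hy : 0 < y) (n : ℕ) :
    (max 0 (1 - Real.log n / y)) ^ 2 ≤ 1 := by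
  have : 0 ≤ Real.log n / y := div_nonneg (Real.log_natCast_nonneg n) hy.le
  exact pow_le_one₀ (le_max_left _ _) (max_le zero_le_one (by linarith))

lemma norm_charTwist_le_one {q : ℕ} (χ : DirichletCharacter ℂ q) (t : ℝ) (n : ℕ) :
    ‖charTwist χ t n‖ ≤ 1 := by
  rw [charTwist, norm_mul, show -(Real.log n : ℂ) * I * t = ((-(Real.log n) * t : ℝ) : ℂ) * I by
    simp only [Complex.ofReal_mul, Complex.ofReal_neg]; ring, Complex.norm_exp_ofReal_mul_I, mul_one]
  exact χ.norm_le_one _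

lemma exists_norm_logSum_sub_primePoly_le : ∃ K : ℝ, 0 ≤ K ∧ ∀ (q : ℕ)
    (χ : DirichletCharacter ℂ q) (y t : ℝ), 0 < y → ∀ M₁ M₂ : ℕ, Real.exp y < M₁ + 1 →
    Real.exp (y / 2) < M₂ + 1 →
    ‖logSum χ y (1 / 2 + t * I) - primePoly χ y 1 ((Finset.Ioc 0 M₁).filter Nat.Prime) t
      - primePoly χ y 2 ((Finset.Ioc 0 M₂).filter Nat.Prime) t‖ ≤ K := by
  have hsumm : Summable fun p : Nat.Primes => 4 * (p : ℝ) ^ (-(3 / 2) : ℝ) :=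
    (Nat.Primes.summable_rpow.2 (by norm_num)).mul_left 4
  refine ⟨∑' p : Nat.Primes, 4 * (p : ℝ) ^ (-(3 / 2) : ℝ), tsum_nonneg fun p => by positivity, ?_⟩
  intro q χ y t hy M₁ M₂ hM₁ hM₂
  set f : ℕ → ℂ := fun n => (((max 0 (1 - Real.log n / y)) ^ 2 / Real.log n : ℝ) : ℂ) *
      LSeries.term (fun n : ℕ => χ n * (ArithmeticFunction.vonMangoldt n : ℂ)) (1 / 2 + t * I) n
    with hf
  have hzero : ∀ n : ℕ, ⌊Real.exp y⌋₊ + 1 ≤ n → f n = 0 := by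
    intro n hn
    simp only [hf]
    rw [max_zero_one_sub_log_div_eq_zero hy hn]
    simp
  have hfs : Summable f := summable_of_ne_finset_zero (s := Finset.range (⌊Real.exp y⌋₊ + 1))
    fun n hn => hzero n (by simpa using hn)
  have hsupp : Function.support f ⊆ {n | IsPrimePow n} := by
    intro n hn
    by_contra h
    apply hn
    simp only [hf]
    rcases eq_or_ne n 0 with rfl | hn0
    · simp
    · rw [LSeries.term_of_ne_zero hn0, ArithmeticFunction.vonMangoldt_eq_zero_iff.2 h]
      simp
  have htail : ∀ p : Nat.Primes, ‖∑' k : ℕ, f (p ^ (k + 3))‖ ≤ 4 * (p : ℝ) ^ (-(3 / 2) : ℝ) := by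
    intro p
    have hp0 : (0 : ℝ) < (p : ℕ) := by exact_mod_cast p.2.pos
    have hg : HasSum (fun k : ℕ => ((p : ℕ) : ℝ) ^ (-(3 / 2) : ℝ) * (3 / 4 : ℝ) ^ k)
        (4 * ((p : ℕ) : ℝ) ^ (-(3 / 2) : ℝ)) := by
      have := (hasSum_geometric_of_lt_one (r := (3 / 4 : ℝ)) (by norm_num) (by norm_num)).mul_left
        (((p : ℕ) : ℝ) ^ (-(3 / 2) : ℝ))
      rwa [show (1 - 3 / 4 : ℝ)⁻¹ = 4 by norm_num, mul_comm _ (4 : ℝ)] at this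
    refine tsum_of_norm_bounded hg fun k => ?_
    have hterm := logSum_term_prime_pow χ y t p.2 (Nat.succ_ne_zero (k + 2))
    simp only [hf]
    rw [hterm, norm_mul, Complex.norm_real, norm_pow, Real.norm_eq_abs, abs_of_nonneg (by positivity)]
    have h1 : ‖charTwist χ t p‖ ^ (k + 3) ≤ 1 :=
      pow_le_one₀ (norm_nonneg _) (norm_charTwist_le_one χ t p)
    have h2 : ((p : ℕ) : ℝ) ^ (-(((k + 2).succ : ℕ) / 2 : ℝ))
        = ((p : ℕ) : ℝ) ^ (-(3 / 2) : ℝ) * (((p : ℕ) : ℝ) ^ (-(1 / 2) : ℝ)) ^ k := by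
      rw [← Real.rpow_mul_natCast hp0.le, ← Real.rpow_add hp0]
      congr 1
      push_cast
      ring
    have h3 : ((p : ℕ) : ℝ) ^ (-(1 / 2) : ℝ) ≤ 3 / 4 := by
      rw [Real.rpow_neg hp0.le, ← Real.sqrt_eq_rpow]
      have : (4 / 3 : ℝ) ≤ Real.sqrt (p : ℕ) := by
        apply Real.le_sqrt_of_sq_le
        have : (2 : ℝ) ≤ (p : ℕ) := by exact_mod_cast p.2.two_le
        norm_num
        linarith
      calc _ ≤ (4 / 3 : ℝ)⁻¹ := inv_anti₀ (by norm_num) this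
        _ = 3 / 4 := by norm_num
    have h4 := max_zero_one_sub_log_div_le_one hy ((p : ℕ) ^ (k + 2).succ)
    have h5 : (max 0 (1 - Real.log (((p : ℕ) ^ (k + 2).succ : ℕ) : ℝ) / y)) ^ 2 / ((k + 2).succ : ℕ) ≤ (1 : ℝ) := by
      rw [div_le_one (by positivity)]
      refine h4.trans ?_
      exact_mod_cast Nat.succ_pos _
    calc _ ≤ (1 * ((p : ℕ) : ℝ) ^ (-(((k + 2).succ : ℕ) / 2 : ℝ))) * 1 :=
          mul_le_mul (mul_le_mul_of_nonneg_right h5 (by positivity)) h1 (by positivity)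
            (by positivity)
      _ ≤ _ := by
          rw [h2, one_mul, mul_one]
          exact mul_le_mul_of_nonneg_left (pow_le_pow_left₀ (by positivity) h3 k) (by positivity)
  have hprime : ∀ (e : ℕ) (_ : e ≠ 0) (M : ℕ) (_ : Real.exp (y / e) < M + 1),
      ∑' p : Nat.Primes, f (p ^ e) = primePoly χ y e ((Finset.Ioc 0 M).filter Nat.Prime) t := by
    intro e he M hM
    have he0 : (0 : ℝ) < e := by exact_mod_cast Nat.pos_of_ne_zero he
    have h1 : ∑' p : Nat.Primes, f (p ^ e) = ∑' n : ℕ, Set.indicator {p : ℕ | p.Prime} (fun n => f (n ^ e)) n :=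
      tsum_subtype {p : ℕ | p.Prime} (fun n => f (n ^ e))
    rw [h1, tsum_eq_sum (s := (Finset.Ioc 0 M).filter Nat.Prime)]
    · rw [primePoly]
      refine Finset.sum_congr rfl fun p hp => ?_
      rw [Finset.mem_filter] at hp
      rw [Set.indicator_of_mem (show p ∈ {p : ℕ | p.Prime} from hp.2)]
      exact logSum_term_prime_pow χ y t hp.2 he
    · intro n hn
      by_cases hnp : n.Prime
      · rw [Set.indicator_of_mem (show n ∈ {p : ℕ | p.Prime} from hnp)]
        apply hzero
        have hMn : M + 1 ≤ n := by
          by_contra h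
          exact hn (Finset.mem_filter.2 ⟨Finset.mem_Ioc.2 ⟨hnp.pos, by omega⟩, hnp⟩)
        rw [Nat.succ_le_iff, Nat.floor_lt (Real.exp_pos y).le]
        have hMn' : (M : ℝ) + 1 ≤ n := by exact_mod_cast hMn
        calc Real.exp y = Real.exp (y / e) ^ e := by
              rw [← Real.exp_nat_mul]; congr 1; field_simp
          _ < (n : ℝ) ^ e := pow_lt_pow_left₀ (hM.trans_le hMn') (Real.exp_pos _).le he
          _ = _ := by push_cast; rfl
      · exact Set.indicator_of_notMem (show n ∉ {p : ℕ | p.Prime} from hnp) _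
  have hinj : Function.Injective fun p : Nat.Primes => (p : ℕ) ^ 2 := fun a b hab =>
    Subtype.ext (Nat.pow_left_injective two_ne_zero hab)
  have hs2 : Summable fun p : Nat.Primes => f (p ^ 2) := hfs.comp_injective hinj
  have hs3 : Summable fun p : Nat.Primes => ∑' k : ℕ, f (p ^ (k + 3)) :=
    Summable.of_norm_bounded hsumm htail
  have hsplit : ∀ p : Nat.Primes, ∑' k : ℕ, f (p ^ (k + 2)) = f (p ^ 2) + ∑' k : ℕ, f (p ^ (k + 3)) := by
    intro p
    have hi : Function.Injective fun k : ℕ => (p : ℕ) ^ (k + 2) := fun a b hab => by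
      simpa using Nat.pow_right_injective p.2.two_le hab
    have : Summable fun k : ℕ => f (p ^ (k + 2)) := hfs.comp_injective hi
    rw [this.tsum_eq_zero_add]
  have hmain : logSum χ y (1 / 2 + t * I) = ∑' p : Nat.Primes, f (p ^ 1) + (∑' p : Nat.Primes, f (p ^ 2)
      + ∑' p : Nat.Primes, ∑' k : ℕ, f (p ^ (k + 3))) := by
    rw [logSum_eq_tsum χ hy, tsum_eq_tsum_primes_add_tsum_primes_of_support_subset_prime_powers hfs hsupp,
      ← hs2.tsum_add hs3]
    simp only [pow_one, hsplit]
  rw [hmain, hprime 1 one_ne_zero M₁ (by simpa using hM₁),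
    hprime 2 two_ne_zero M₂ (by exact_mod_cast hM₂), add_sub_cancel_left, add_sub_cancel_left]
  exact tsum_of_norm_bounded hsumm.hasSum htail

def MeanLE (q : ℕ) [NeZero q] (S : ℝ) (f : DirichletCharacter ℂ q → ℝ → ℝ) (B : ℝ) : Prop :=
  (∀ χ, Continuous (f χ)) ∧
    ∑ χ : DirichletCharacter ℂ q, ∫ t in (0 : ℝ)..S, f χ t ≤ B * (Nat.totient q * S)

namespace MeanLE

variable {q : ℕ} [NeZero q] {S : ℝ} {f g : DirichletCharacter ℂ q → ℝ → ℝ} {B B' : ℝ}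

lemma add (hf : MeanLE q S f B) (hg : MeanLE q S g B') :
    MeanLE q S (fun χ t => f χ t + g χ t) (B + B') := by
  refine ⟨fun χ => (hf.1 χ).add (hg.1 χ), ?_⟩
  rw [Finset.sum_congr rfl fun χ _ => intervalIntegral.integral_add
    ((hf.1 χ).intervalIntegrable 0 S) ((hg.1 χ).intervalIntegrable 0 S), Finset.sum_add_distrib,
    add_mul]
  exact add_le_add hf.2 hg.2

lemma const_mul (hf : MeanLE q S f B) {c : ℝ} (hc : 0 ≤ c) :
    MeanLE q S (fun χ t => c * f χ t) (c * B) := by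
  refine ⟨fun χ => (hf.1 χ).const_mul c, ?_⟩
  simp only [intervalIntegral.integral_const_mul]
  rw [← Finset.mul_sum, mul_assoc]
  exact mul_le_mul_of_nonneg_left hf.2 hc

lemma mono (hf : MeanLE q S f B) (hS : 0 ≤ S) (h : B ≤ B') : MeanLE q S f B' :=
  ⟨hf.1, hf.2.trans (mul_le_mul_of_nonneg_right h (by positivity))⟩

lemma zero : MeanLE q S (fun _ _ => 0) 0 := ⟨fun _ => continuous_const, by simp⟩

lemma sum {ι : Type*} (s : Finset ι) {F : ι → DirichletCharacter ℂ q → ℝ → ℝ} {b : ι → ℝ}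
    (h : ∀ i ∈ s, MeanLE q S (F i) (b i)) :
    MeanLE q S (fun χ t => ∑ i ∈ s, F i χ t) (∑ i ∈ s, b i) := by
  induction s using Finset.induction_on with
  | empty => simpa using zero
  | insert a s ha ih =>
    simp only [Finset.sum_insert ha]
    exact (h a (Finset.mem_insert_self a s)).add (ih fun i hi => h i (Finset.mem_insert_of_mem hi))

lemma one : MeanLE q S (fun _ _ => 1) 1 := by
  refine ⟨fun _ => continuous_const, ?_⟩
  simp only [intervalIntegral.integral_const, sub_zero, smul_eq_mul, mul_one, Finset.sum_const,
    Finset.card_univ, nsmul_eq_mul, one_mul]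
  rw [← Nat.card_eq_fintype_card, DirichletCharacter.card_eq_totient_of_hasEnoughRootsOfUnity]

end MeanLE

lemma norm_primePoly_coeff_sq_le {y : ℝ} (hy : 0 < y) {e p : ℕ} (he : e ≠ 0) (hp : p.Prime) :
    ‖(((max 0 (1 - Real.log ((p ^ e : ℕ) : ℝ) / y)) ^ 2 / e * (p : ℝ) ^ (-(e / 2 : ℝ)) : ℝ) : ℂ)‖ ^ 2
      ≤ 1 / (p : ℝ) ^ e := by
  have hp0 : (0 : ℝ) < p := by exact_mod_cast hp.pos
  have he1 : (1 : ℝ) ≤ e := by exact_mod_cast Nat.pos_of_ne_zero he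
  rw [Complex.norm_real, Real.norm_eq_abs, abs_of_nonneg (by positivity), mul_pow,
    ← Real.rpow_mul_natCast hp0.le, show (-(e / 2 : ℝ)) * ((2 : ℕ) : ℝ) = -(e : ℝ) by push_cast; ring,
    Real.rpow_neg hp0.le, Real.rpow_natCast, one_div]
  have h1 : (max 0 (1 - Real.log ((p ^ e : ℕ) : ℝ) / y)) ^ 2 / e ≤ 1 := by
    rw [div_le_one (by positivity)]
    exact (max_zero_one_sub_log_div_le_one hy _).trans he1
  have h2 := pow_le_one₀ (n := 2) (by positivity) h1
  exact mul_le_of_le_one_left (by positivity) h2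

lemma continuous_primePoly {q : ℕ} (χ : DirichletCharacter ℂ q) (y : ℝ) (e : ℕ) (P : Finset ℕ) :
    Continuous (primePoly χ y e P) := by
  unfold primePoly
  exact continuous_finsetSum _ fun p _ => continuous_const.mul ((continuous_charTwist χ p).pow e)

lemma meanLE_primePoly {q : ℕ} [NeZero q] {S y u σ : ℝ} (hS : 0 < S) (hy : 0 < y) {e m a : ℕ}
    (he : e ≠ 0)
    (hσ : ∑ p ∈ Finset.Ioc a ⌊Real.exp u⌋₊ with p.Prime, 1 / (p : ℝ) ^ e ≤ σ)
    (hu : 2 * m * (e * u) ≤ Real.log (q * S)) :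
    MeanLE q S (fun χ t => ‖primePoly χ y e ((Finset.Ioc a ⌊Real.exp u⌋₊).filter Nat.Prime) t‖ ^ (2 * m))
      (3 * (m.factorial * σ ^ m)) := by
  have hq : (0 : ℝ) < q := by exact_mod_cast Nat.pos_of_ne_zero (NeZero.ne q)
  refine ⟨fun χ => (continuous_primePoly χ y e _).norm.pow _, ?_⟩
  refine (sum_integral_norm_prime_sum_pow_le (q := q) ((Finset.Ioc a ⌊Real.exp u⌋₊).filter Nat.Prime)
    (fun p hp => (Finset.mem_filter.1 hp).2) (X := ⌊Real.exp u⌋₊)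
    (fun p hp => (Finset.mem_Ioc.1 (Finset.mem_filter.1 hp).1).2)
    (fun p => (((max 0 (1 - Real.log ((p ^ e : ℕ) : ℝ) / y)) ^ 2 / e * (p : ℝ) ^ (-(e / 2 : ℝ)) : ℝ) : ℂ))
    (e := e) (m := m) he hS.le ?_).trans ?_
  · calc (((⌊Real.exp u⌋₊ : ℝ)) ^ (m * e)) ^ 2 ≤ (Real.exp u ^ (m * e)) ^ 2 := by
          have := Nat.floor_le (Real.exp_pos u).le
          gcongr
      _ = Real.exp (2 * m * (e * u)) := by
          rw [← pow_mul, ← Real.exp_nat_mul]; congr 1; push_cast; ring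
      _ ≤ q * S := by
          rwa [← Real.le_log_iff_exp_le (by positivity)]
  · have h1 := (Finset.sum_le_sum fun p (hp : p ∈ (Finset.Ioc a ⌊Real.exp u⌋₊).filter Nat.Prime) =>
      norm_primePoly_coeff_sq_le hy he (Finset.mem_filter.1 hp).2).trans hσ
    have h2 := pow_le_pow_left₀ (Finset.sum_nonneg fun p _ => by positivity) h1 m
    rw [show 3 * ((m.factorial : ℝ) * σ ^ m) * (Nat.totient q * S)
      = 3 * Nat.totient q * S * (m.factorial * σ ^ m) by ring]
    exact mul_le_mul_of_nonneg_left (mul_le_mul_of_nonneg_left h2 (by positivity)) (by positivity)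

lemma sum_inv_prime_sq_le (M : ℕ) :
    ∑ p ∈ Finset.Ioc 0 M with p.Prime, 1 / (p : ℝ) ^ 2 ≤ 1 := by
  calc _ ≤ ∑ p ∈ Finset.Ioc 1 (M + 1), ((p : ℝ) ^ 2)⁻¹ := by
        simp only [one_div]
        apply Finset.sum_le_sum_of_subset_of_nonneg
        · intro p hp
          simp only [Finset.mem_filter, Finset.mem_Ioc] at hp ⊢
          exact ⟨hp.2.one_lt, by omega⟩
        · intros; positivity
    _ ≤ (((1 : ℕ) : ℝ))⁻¹ - (((M + 1 : ℕ) : ℝ))⁻¹ := sum_Ioc_inv_sq_le_sub one_ne_zero (by omega)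
    _ ≤ 1 := by
        have : 0 ≤ (((M + 1 : ℕ) : ℝ))⁻¹ := by positivity
        rw [Nat.cast_one, inv_one]
        linarith

lemma two_le_floor_exp {u : ℝ} (hu : 1 ≤ u) : 2 ≤ ⌊Real.exp u⌋₊ := by
  apply Nat.le_floor
  have := Real.add_one_le_exp u
  push_cast
  linarith

lemma log_log_floor_exp_le {u : ℝ} (hu : 1 ≤ u) :
    Real.log (Real.log ⌊Real.exp u⌋₊) ≤ Real.log u := by
  have h2 := two_le_floor_exp hu
  have h2' : (2 : ℝ) ≤ ⌊Real.exp u⌋₊ := by exact_mod_cast h2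
  apply Real.log_le_log (Real.log_pos (by linarith))
  calc Real.log ⌊Real.exp u⌋₊ ≤ Real.log (Real.exp u) :=
        Real.log_le_log (by linarith) (Nat.floor_le (Real.exp_pos u).le)
    _ = u := Real.log_exp u

lemma log_sub_two_le_log_log_floor_exp {u : ℝ} (hu : 1 ≤ u) :
    Real.log u - 2 ≤ Real.log (Real.log ⌊Real.exp u⌋₊) := by
  have h1 : Real.exp u / 2 ≤ ⌊Real.exp u⌋₊ := by
    have h3 := Nat.lt_floor_add_one (Real.exp u)
    have h2' : (2 : ℝ) ≤ ⌊Real.exp u⌋₊ := by exact_mod_cast two_le_floor_exp hu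
    linarith
  have h2 : u / 4 ≤ Real.log ⌊Real.exp u⌋₊ := by
    have := Real.log_le_log (by positivity) h1
    rw [Real.log_div (Real.exp_pos u).ne' (by norm_num), Real.log_exp] at this
    linarith [Real.log_two_lt_d9]
  have h3 := Real.log_le_log (by positivity) h2
  have h4 : Real.log 4 = 2 * Real.log 2 := by
    rw [show (4 : ℝ) = 2 ^ 2 by norm_num, Real.log_pow]; norm_num
  rw [Real.log_div (by positivity) (by norm_num), h4] at h3
  linarith [Real.log_two_lt_d9]

lemma sum_inv_prime_floor_exp_le {u : ℝ} (hu : 1 ≤ u) :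
    ∑ p ∈ Finset.Ioc 0 ⌊Real.exp u⌋₊ with p.Prime, 1 / (p : ℝ) ^ 1 ≤ Real.log u + 6 := by
  simp only [pow_one]
  linarith [sum_inv_prime_le (two_le_floor_exp hu), log_log_floor_exp_le hu]

lemma sum_inv_prime_floor_exp_floor_exp_le {u v : ℝ} (hv : 1 ≤ v) (huv : v ≤ u) :
    ∑ p ∈ Finset.Ioc ⌊Real.exp v⌋₊ ⌊Real.exp u⌋₊ with p.Prime, 1 / (p : ℝ) ^ 1
      ≤ Real.log u - Real.log v + 7 := by
  simp only [pow_one]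
  linarith [sum_inv_prime_Ioc_le (two_le_floor_exp hv) (Nat.floor_mono (Real.exp_le_exp.2 huv)),
    log_log_floor_exp_le (hv.trans huv), log_sub_two_le_log_log_floor_exp hv]

lemma exists_norm_LFunction_le_exp_primePoly (hGRH : GRH) : ∃ C : ℝ, 1 ≤ C ∧ ∀ (q : ℕ) [NeZero q]
    (χ : DirichletCharacter ℂ q), χ ≠ 1 → ∀ (S y t : ℝ), 2 ≤ S → 1 ≤ y → |t| ≤ S →
    ‖DirichletCharacter.LFunction χ (1 / 2 + t * I)‖ ≤ Real.exp
      (‖primePoly χ y 1 ((Finset.Ioc 0 ⌊Real.exp y⌋₊).filter Nat.Prime) t‖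
        + ‖primePoly χ y 2 ((Finset.Ioc 0 ⌊Real.exp (y / 2)⌋₊).filter Nat.Prime) t‖
        + C + C * Real.log (q * S) / y) := by
  obtain ⟨C, hC, h⟩ := exists_norm_LFunction_le_exp hGRH
  obtain ⟨K, hK, hdec⟩ := exists_norm_logSum_sub_primePoly_le
  refine ⟨C + K + 1, by linarith, fun q _ χ hχ S y t hS hy ht => (h q χ hχ S y t hS hy ht).trans ?_⟩
  have hy0 : 0 < y := by linarith
  rw [Real.exp_le_exp]
  set w := logSum χ y (1 / 2 + t * I)
  set a := primePoly χ y 1 ((Finset.Ioc 0 ⌊Real.exp y⌋₊).filter Nat.Prime) t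
  set b := primePoly χ y 2 ((Finset.Ioc 0 ⌊Real.exp (y / 2)⌋₊).filter Nat.Prime) t
  have h1 : ‖w - a - b‖ ≤ K := hdec q χ y t hy0 _ _ (Nat.lt_floor_add_one _) (Nat.lt_floor_add_one _)
  have h2 : w.re ≤ ‖w‖ := Complex.re_le_norm w
  have h3 : ‖w‖ ≤ ‖w - a - b‖ + ‖a‖ + ‖b‖ := by
    calc ‖w‖ = ‖(w - a - b) + a + b‖ := by congr 1; ring
      _ ≤ _ := norm_add₃_le
  have hL : 0 ≤ Real.log (q * S) := by
    apply Real.log_nonneg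
    have : (1 : ℝ) ≤ q := by exact_mod_cast Nat.pos_of_ne_zero (NeZero.ne q)
    nlinarith
  have h4 : C * Real.log (q * S) / y ≤ (C + K + 1) * Real.log (q * S) / y := by
    gcongr
    linarith
  linarith

lemma norm_LFunction_le_exp_three_mul_log {q : ℕ} [NeZero q] {χ : DirichletCharacter ℂ q} (hχ : χ ≠ 1)
    {S t : ℝ} (hS : 2 ≤ S) (ht : |t| ≤ S) :
    ‖DirichletCharacter.LFunction χ (1 / 2 + t * I)‖ ≤ Real.exp (3 * Real.log (q * S)) := by
  have hq : (1 : ℝ) ≤ q := by exact_mod_cast Nat.pos_of_ne_zero (NeZero.ne q)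
  have hre : (1 / 2 + t * I : ℂ).re = 1 / 2 := by simp
  have h1 := norm_LFunction_le hχ (s := 1 / 2 + t * I) (by rw [hre]; norm_num)
  have h2 : ‖(1 / 2 + t * I : ℂ)‖ ≤ 1 / 2 + S := by
    refine (norm_add_le _ _).trans ?_
    rw [norm_mul, Complex.norm_I, Complex.norm_real, Real.norm_eq_abs]
    norm_num
    exact ht
  rw [hre] at h1
  have h3 : Real.exp (3 * Real.log (q * S)) = (q * S) ^ 3 := by
    rw [mul_comm, Real.exp_mul, Real.exp_log (by positivity)]
    norm_cast
  rw [h3]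
  have h4 : 2 ≤ q * S := by nlinarith
  calc _ ≤ q * ‖(1 / 2 + t * I : ℂ)‖ / (1 / 2) := h1
    _ ≤ q * (1 / 2 + S) / (1 / 2) := by gcongr
    _ = q + 2 * (q * S) := by ring
    _ ≤ 4 * (q * S) := by nlinarith
    _ ≤ (q * S) ^ 3 := by nlinarith [sq_nonneg (q * S - 2)]

lemma factorial_mul_pow_le {σ W b : ℝ} (hσ : 0 ≤ σ) (hW : 0 < W) {m : ℕ} (h : m * σ ≤ b * W ^ 2) :
    (1 / W) ^ (2 * m) * (m.factorial * σ ^ m) ≤ b ^ m := by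
  have h1 : (m.factorial : ℝ) ≤ (m : ℝ) ^ m := by exact_mod_cast m.factorial_le_pow
  calc (1 / W) ^ (2 * m) * (m.factorial * σ ^ m) ≤ (1 / W) ^ (2 * m) * ((m : ℝ) ^ m * σ ^ m) := by
        gcongr
    _ = (m * σ / W ^ 2) ^ m := by
        rw [pow_mul, ← mul_pow, ← mul_pow]
        congr 1
        field_simp
    _ ≤ b ^ m := by
        apply pow_le_pow_left₀ (by positivity)
        rwa [div_le_iff₀ (by positivity)]

lemma MeanLE.primePoly_div {q : ℕ} [NeZero q] {S y u σ W b : ℝ} (hS : 0 < S) (hy : 0 < y)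
    {e m a : ℕ} (he : e ≠ 0) (hσ0 : 0 ≤ σ)
    (hσ : ∑ p ∈ Finset.Ioc a ⌊Real.exp u⌋₊ with p.Prime, 1 / (p : ℝ) ^ e ≤ σ)
    (hu : 2 * m * (e * u) ≤ Real.log (q * S)) (hW : 0 < W) (hb : m * σ ≤ b * W ^ 2) :
    MeanLE q S (fun χ t => (1 / W) ^ (2 * m) *
      ‖primePoly χ y e ((Finset.Ioc a ⌊Real.exp u⌋₊).filter Nat.Prime) t‖ ^ (2 * m)) (3 * b ^ m) := by
  refine ((meanLE_primePoly hS hy he hσ hu).const_mul (c := (1 / W) ^ (2 * m)) (by positivity)).mono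
    hS.le ?_
  rw [mul_left_comm]
  exact mul_le_mul_of_nonneg_left (factorial_mul_pow_le hσ0 hW hb) (by norm_num)

lemma one_le_one_div_pow_mul_pow {W x : ℝ} (hW : 0 < W) (h : W ≤ x) (n : ℕ) :
    1 ≤ (1 / W) ^ n * x ^ n := by
  rw [← mul_pow]
  apply one_le_pow₀
  rwa [one_div_mul_eq_div, one_le_div hW]

lemma exp_le_sum_add_one {r : ℝ} (hr : 0 ≤ r) {J : ℕ} (hJ : 10 * r ≤ J) :
    Real.exp r ≤ ∑ j ∈ Finset.range (J + 1), r ^ j / j.factorial + 1 := by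
  have hs := Real.summable_pow_div_factorial r
  have hexp : Real.exp r = ∑' j : ℕ, r ^ j / j.factorial := by
    rw [Real.exp_eq_exp_ℝ, NormedSpace.exp_eq_tsum_div]
  rw [hexp, ← hs.sum_add_tsum_nat_add (J + 1)]
  have hg : Summable fun i : ℕ => (1 / 2 : ℝ) ^ (i + (J + 1)) :=
    (summable_nat_add_iff (J + 1)).2 summable_geometric_two
  have hterm : ∀ i : ℕ, r ^ (i + (J + 1)) / (i + (J + 1)).factorial ≤ (1 / 2 : ℝ) * (1 / 2 : ℝ) ^ i := by
    intro i
    set j := i + (J + 1) with hj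
    have h1 : r ≤ (j : ℝ) / 10 := by
      have : (J : ℝ) ≤ j := by exact_mod_cast (by omega : J ≤ j)
      linarith
    have h2 := Real.pow_div_factorial_le_exp (j : ℝ) (by positivity) j
    calc r ^ j / j.factorial ≤ ((j : ℝ) / 10) ^ j / j.factorial := by gcongr
      _ = (1 / 10) ^ j * ((j : ℝ) ^ j / j.factorial) := by rw [div_pow]; simp; ring
      _ ≤ (1 / 10) ^ j * Real.exp j := by gcongr
      _ = (Real.exp 1 / 10) ^ j := by
          rw [div_pow (Real.exp 1), ← Real.exp_nat_mul, mul_one, div_pow, one_pow]; ring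
      _ ≤ (1 / 2) ^ j := by
          have := Real.exp_one_lt_d9
          exact pow_le_pow_left₀ (by positivity) (by linarith) j
      _ ≤ (1 / 2) ^ (1 + i) := pow_le_pow_of_le_one (by norm_num) (by norm_num) (by omega)
      _ = _ := by rw [pow_add, pow_one]
  have hle := ((summable_nat_add_iff (J + 1)).2 hs).tsum_le_tsum hterm
    (summable_geometric_two.mul_left (1 / 2))
  rw [tsum_mul_left, tsum_geometric_two] at hle
  linarith

lemma exists_meanLE_large_values (hGRH : GRH) (k : ℕ) : ∃ A : ℝ, 1 ≤ A ∧ ∃ L₀ K : ℝ, 0 ≤ K ∧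
    ∀ (q : ℕ) [NeZero q] (S : ℝ), 2 ≤ S → L₀ ≤ Real.log (q * S) →
    ∃ F : DirichletCharacter ℂ q → ℝ → ℝ, (∀ χ t, 0 ≤ F χ t) ∧ MeanLE q S F K ∧
      ∀ χ, χ ≠ 1 → ∀ t : ℝ, |t| ≤ S →
      Real.exp (A * Real.log (Real.log (q * S))) < ‖DirichletCharacter.LFunction χ (1 / 2 + t * I)‖ →
      ‖DirichletCharacter.LFunction χ (1 / 2 + t * I)‖ ^ (2 * k) ≤ F χ t := by
  obtain ⟨C₁, hC₁, hL⟩ := exists_norm_LFunction_le_exp_primePoly hGRH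
  set C := C₁ + 3 with hC
  have hC0 : 0 < C := by linarith
  set A := 8 * Real.exp (8 * C * (2 * k + 1)) with hA
  have hA8 : 8 ≤ A := by
    have : 1 ≤ Real.exp (8 * C * (2 * k + 1)) := Real.one_le_exp (by positivity)
    linarith
  have hA0 : 0 < A := by linarith
  refine ⟨A, by linarith, Real.exp (Real.log (4 * C) + 6 + 4 * C + 1),
    12 * Real.exp (2 * k + 8 * C * (2 * k + 1)), by positivity, ?_⟩
  intro q _ S hS hΛ
  set Λ := Real.log (q * S) with hΛdef
  set l := Real.log Λ with hl
  have hΛ0 : 0 < Λ := (Real.exp_pos _).trans_le hΛ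
  have hlge : Real.log (4 * C) + 6 + 4 * C + 1 ≤ l := (Real.le_log_iff_exp_le hΛ0).2 hΛ
  have hlogC : 0 ≤ Real.log (4 * C) := Real.log_nonneg (by linarith)
  have hl1 : 1 ≤ l := by linarith
  have hl4C : 4 * C + 1 ≤ l := by linarith
  have hAl : 8 * l ≤ A * l := mul_le_mul_of_nonneg_right hA8 (by linarith)
  have hS0 : 0 < S := by linarith
  set V₀ := ⌊A * l⌋₊ with hV₀
  have hV₀le : ∀ V : ℕ, V₀ ≤ V → A * l - 1 < V := fun V hV =>
    (Nat.sub_one_lt_floor _).trans_le (by exact_mod_cast hV)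
  have hlevel : ∀ V ∈ Finset.Icc V₀ ⌊C * Λ⌋₊,
      4 * C ≤ (V : ℝ) ∧ A * l / 2 ≤ V ∧ 4 ≤ 4 * C * Λ / V ∧
      Real.log (4 * C * Λ / V) + 6 ≤ 2 * l := by
    intro V hV
    rw [Finset.mem_Icc] at hV
    have h1 := hV₀le V hV.1
    have h2 : (V : ℝ) ≤ C * Λ := (Nat.le_floor_iff (by positivity)).1 hV.2
    have hV1 : (1 : ℝ) ≤ V := by linarith
    refine ⟨by linarith, by linarith, ?_, ?_⟩
    · rw [le_div_iff₀ (by linarith)]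
      linarith
    · have h3 : Real.log (4 * C * Λ / V) ≤ Real.log (4 * C * Λ) := by
        apply Real.log_le_log (by positivity)
        exact div_le_self (by positivity) hV1
      rw [Real.log_mul (by positivity) (by positivity)] at h3
      linarith
  set G : ℕ → DirichletCharacter ℂ q → ℝ → ℝ := fun V χ t =>
    Real.exp (2 * k * (V + 1)) *
      ((1 / ((V : ℝ) / 4)) ^ (2 * ⌊(V : ℝ) / (8 * C)⌋₊) * ‖primePoly χ (4 * C * Λ / V) 1
        ((Finset.Ioc 0 ⌊Real.exp (4 * C * Λ / V)⌋₊).filter Nat.Prime) t‖ ^ (2 * ⌊(V : ℝ) / (8 * C)⌋₊) +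
      (1 / ((V : ℝ) / 4)) ^ (2 * ⌊(V : ℝ) / (8 * C)⌋₊) * ‖primePoly χ (4 * C * Λ / V) 2
        ((Finset.Ioc 0 ⌊Real.exp (4 * C * Λ / V / 2)⌋₊).filter Nat.Prime) t‖
          ^ (2 * ⌊(V : ℝ) / (8 * C)⌋₊)) with hG
  have hG0 : ∀ V χ t, 0 ≤ G V χ t := fun V χ t => by positivity
  refine ⟨fun χ t => ∑ V ∈ Finset.Icc V₀ ⌊C * Λ⌋₊, G V χ t,
    fun χ t => Finset.sum_nonneg fun V _ => hG0 V χ t, ?_, ?_⟩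
  · have hmean : ∀ V ∈ Finset.Icc V₀ ⌊C * Λ⌋₊, MeanLE q S (G V)
        (6 * Real.exp (2 * k + 8 * C * (2 * k + 1)) * (1 / 2 : ℝ) ^ V) := by
      intro V hV
      obtain ⟨hV4C, hVA, hy4, hσ⟩ := hlevel V hV
      have hV0 : (0 : ℝ) < V := by linarith
      set y := 4 * C * Λ / V with hy
      set m := ⌊(V : ℝ) / (8 * C)⌋₊ with hm
      have hmle : (m : ℝ) ≤ V / (8 * C) := Nat.floor_le (by positivity)
      have hmle' : (m : ℝ) ≤ V / 8 := hmle.trans (by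
        apply div_le_div_of_nonneg_left hV0.le (by norm_num); linarith)
      have hlen : 2 * m * y ≤ Λ := by
        calc 2 * m * y ≤ 2 * (V / (8 * C)) * y := by gcongr
          _ = Λ := by rw [hy]; field_simp; norm_num
      set b := Real.exp (-(8 * C * (2 * k + 1))) with hb
      have hAb : A * b = 8 := by
        rw [hA, hb, mul_assoc, ← Real.exp_add, add_neg_cancel, Real.exp_zero, mul_one]
      have hbound : (m : ℝ) * (2 * l) ≤ b * (V / 4) ^ 2 := by
        calc (m : ℝ) * (2 * l) ≤ V / 8 * (2 * l) := by gcongr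
          _ = V / 16 * (A * b * l / 2) := by rw [hAb]; ring
          _ = b * (V / 16) * (A * l / 2) := by ring
          _ ≤ b * (V / 16) * V := mul_le_mul_of_nonneg_left hVA (by positivity)
          _ = b * (V / 4) ^ 2 := by ring
      have hm1 := MeanLE.primePoly_div (q := q) (S := S) (y := y) (u := y) (σ := 2 * l)
        (W := (V : ℝ) / 4) (b := b) (e := 1) (m := m) (a := 0) hS0 (by linarith) one_ne_zero
        (by linarith) ((sum_inv_prime_floor_exp_le (by linarith)).trans hσ)
        (by rw [Nat.cast_one, one_mul]; exact hlen) (by positivity) hbound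
      have hm2 := MeanLE.primePoly_div (q := q) (S := S) (y := y) (u := y / 2) (σ := 2 * l)
        (W := (V : ℝ) / 4) (b := b) (e := 2) (m := m) (a := 0) hS0 (by linarith) two_ne_zero
        (by linarith) ((sum_inv_prime_sq_le _).trans (by linarith))
        (by rw [show ((2 : ℕ) : ℝ) * (y / 2) = y by push_cast; ring]; exact hlen) (by positivity) hbound
      refine ((hm1.add hm2).const_mul (c := Real.exp (2 * k * (V + 1))) (by positivity)).mono hS0.le ?_
      have hbm : b ^ m ≤ Real.exp (8 * C * (2 * k + 1)) * Real.exp (-((2 * k + 1) * V)) := by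
        rw [hb, ← Real.exp_nat_mul, ← Real.exp_add, Real.exp_le_exp]
        have h1 : (V : ℝ) / (8 * C) - 1 ≤ m := (Nat.sub_one_lt_floor _).le
        have h2 := mul_le_mul_of_nonneg_right h1 (by positivity : 0 ≤ 8 * C * (2 * (k : ℝ) + 1))
        have h3 : ((V : ℝ) / (8 * C) - 1) * (8 * C * (2 * (k : ℝ) + 1))
            = (2 * k + 1) * V - 8 * C * (2 * k + 1) := by field_simp
        linarith
      have hexpV : Real.exp (-(V : ℝ)) ≤ (1 / 2 : ℝ) ^ V := by
        rw [show -(V : ℝ) = V * (-1) by ring, Real.exp_nat_mul]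
        apply pow_le_pow_left₀ (Real.exp_pos _).le
        rw [Real.exp_neg, one_div]
        apply inv_anti₀ (by norm_num)
        linarith [Real.add_one_le_exp (1 : ℝ)]
      calc Real.exp (2 * k * (V + 1)) * (3 * b ^ m + 3 * b ^ m)
          = 6 * (Real.exp (2 * k * (V + 1)) * b ^ m) := by ring
        _ ≤ 6 * (Real.exp (2 * k * (V + 1)) *
            (Real.exp (8 * C * (2 * k + 1)) * Real.exp (-((2 * k + 1) * V)))) := by gcongr
        _ = 6 * Real.exp (2 * k + 8 * C * (2 * k + 1)) * Real.exp (-(V : ℝ)) := by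
            rw [← Real.exp_add, ← Real.exp_add, mul_assoc (6 : ℝ), ← Real.exp_add]
            congr 2
            ring
        _ ≤ _ := by gcongr
    refine (MeanLE.sum _ hmean).mono hS0.le ?_
    rw [← Finset.mul_sum]
    have hgeo : ∑ V ∈ Finset.Icc V₀ ⌊C * Λ⌋₊, (1 / 2 : ℝ) ^ V ≤ 2 := by
      exact (summable_geometric_two.sum_le_tsum _ fun _ _ => by positivity).trans_eq
        tsum_geometric_two
    calc _ ≤ 6 * Real.exp (2 * k + 8 * C * (2 * k + 1)) * 2 :=
          mul_le_mul_of_nonneg_left hgeo (by positivity)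
      _ = _ := by ring
  · intro χ hχ t ht hbig
    set N := ‖DirichletCharacter.LFunction χ (1 / 2 + t * I)‖ with hN
    have hN0 : 0 < N := (Real.exp_pos _).trans hbig
    have hlogN : A * l < Real.log N := (Real.lt_log_iff_exp_lt hN0).2 hbig
    have hlogN0 : 0 ≤ Real.log N := by linarith
    set V := ⌊Real.log N⌋₊ with hVdef
    have hVle : (V : ℝ) ≤ Real.log N := Nat.floor_le hlogN0
    have hVlt : Real.log N < V + 1 := Nat.lt_floor_add_one _
    have htriv : Real.log N ≤ C * Λ := by
      rw [Real.log_le_iff_le_exp hN0]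
      refine (norm_LFunction_le_exp_three_mul_log hχ hS ht).trans ?_
      rw [Real.exp_le_exp]
      exact mul_le_mul_of_nonneg_right (by linarith) hΛ0.le
    have hVmem : V ∈ Finset.Icc V₀ ⌊C * Λ⌋₊ :=
      Finset.mem_Icc.2 ⟨Nat.floor_mono hlogN.le, Nat.floor_mono htriv⟩
    refine le_trans ?_ (Finset.single_le_sum (f := fun V => G V χ t) (fun V _ => hG0 V χ t) hVmem)
    obtain ⟨hV4C, hVA, hy4, -⟩ := hlevel V hVmem
    have hV0 : (0 : ℝ) < V := by linarith
    have hb := hL q χ hχ S (4 * C * Λ / V) t hS (by linarith) ht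
    rw [← hN, ← Real.log_le_iff_le_exp hN0] at hb
    have hC₁y : C₁ * Λ / (4 * C * Λ / V) ≤ V / 4 := by
      calc C₁ * Λ / (4 * C * Λ / V) ≤ C * Λ / (4 * C * Λ / V) := by
            gcongr; linarith
        _ = V / 4 := by field_simp
    have hpow : N ^ (2 * k) ≤ Real.exp (2 * k * (V + 1)) := by
      calc N ^ (2 * k) = Real.exp (Real.log N) ^ (2 * k) := by rw [Real.exp_log hN0]
        _ = Real.exp (2 * k * Real.log N) := by rw [← Real.exp_nat_mul]; push_cast; rfl
        _ ≤ _ := by gcongr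
    refine hpow.trans ?_
    simp only [hG]
    apply le_mul_of_one_le_right (Real.exp_pos _).le
    set a₁ := ‖primePoly χ (4 * C * Λ / V) 1
        ((Finset.Ioc 0 ⌊Real.exp (4 * C * Λ / V)⌋₊).filter Nat.Prime) t‖
    set a₂ := ‖primePoly χ (4 * C * Λ / V) 2
        ((Finset.Ioc 0 ⌊Real.exp (4 * C * Λ / V / 2)⌋₊).filter Nat.Prime) t‖
    have hsum : (V : ℝ) / 2 ≤ a₁ + a₂ := by linarith
    rcases le_or_gt ((V : ℝ) / 4) a₁ with h | h
    · have := one_le_one_div_pow_mul_pow (by positivity) h (2 * ⌊(V : ℝ) / (8 * C)⌋₊)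
      have h0 : 0 ≤ (1 / ((V : ℝ) / 4)) ^ (2 * ⌊(V : ℝ) / (8 * C)⌋₊) * a₂ ^ (2 * ⌊(V : ℝ) / (8 * C)⌋₊) := by
        positivity
      linarith
    · have := one_le_one_div_pow_mul_pow (by positivity) (by linarith : (V : ℝ) / 4 ≤ a₂)
        (2 * ⌊(V : ℝ) / (8 * C)⌋₊)
      have h0 : 0 ≤ (1 / ((V : ℝ) / 4)) ^ (2 * ⌊(V : ℝ) / (8 * C)⌋₊) * a₁ ^ (2 * ⌊(V : ℝ) / (8 * C)⌋₊) := by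
        positivity
      linarith

lemma sq_sum_add_one_le (a : ℕ → ℝ) (J : ℕ) :
    (∑ j ∈ Finset.range (J + 1), a j + 1) ^ 2
      ≤ 2 * (J + 1) * ∑ j ∈ Finset.range (J + 1), a j ^ 2 + 2 := by
  have h := sq_sum_le_card_mul_sum_sq (s := Finset.range (J + 1)) (f := a)
  rw [Finset.card_range] at h
  push_cast at h
  nlinarith [sq_nonneg (∑ j ∈ Finset.range (J + 1), a j - 1)]

lemma meanLE_sum_primePoly {q : ℕ} [NeZero q] {S y u σ : ℝ} (hS : 0 < S) (hy : 0 < y) (hσ0 : 0 ≤ σ)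
    (hσ : ∑ p ∈ Finset.Ioc 0 ⌊Real.exp u⌋₊ with p.Prime, 1 / (p : ℝ) ^ 1 ≤ σ) {J : ℕ} (hu0 : 0 ≤ u)
    (hu : 2 * J * u ≤ Real.log (q * S)) (k : ℕ) :
    MeanLE q S (fun χ t => 2 * (J + 1) * ∑ j ∈ Finset.range (J + 1), (((k : ℝ) ^ (2 * j) / (j.factorial : ℝ) ^ 2)
        * ‖primePoly χ y 1 ((Finset.Ioc 0 ⌊Real.exp u⌋₊).filter Nat.Prime) t‖ ^ (2 * j)) + 2 * 1)
      (8 * (J + 1) * Real.exp (k ^ 2 * σ)) := by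
  have h1 : ∀ j ∈ Finset.range (J + 1), MeanLE q S (fun χ t => ((k : ℝ) ^ (2 * j) / (j.factorial : ℝ) ^ 2)
        * ‖primePoly χ y 1 ((Finset.Ioc 0 ⌊Real.exp u⌋₊).filter Nat.Prime) t‖ ^ (2 * j))
        (3 * ((k ^ 2 * σ) ^ j / j.factorial)) := by
    intro j hj
    have hjJ : (j : ℝ) ≤ J := by exact_mod_cast Nat.lt_succ_iff.1 (Finset.mem_range.1 hj)
    have hm := meanLE_primePoly (q := q) (S := S) (y := y) (u := u) (σ := σ) (e := 1) (m := j) (a := 0)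
      hS hy one_ne_zero hσ (by
        rw [Nat.cast_one, one_mul]
        refine le_trans ?_ hu
        gcongr)
    refine (hm.const_mul (c := (k : ℝ) ^ (2 * j) / (j.factorial : ℝ) ^ 2) (by positivity)).mono hS.le
      (le_of_eq ?_)
    have : (j.factorial : ℝ) ≠ 0 := by exact_mod_cast j.factorial_ne_zero
    rw [mul_pow, ← pow_mul]
    field_simp
  refine (((MeanLE.sum _ h1).const_mul (c := 2 * (J + 1)) (by positivity)).add
    (MeanLE.one.const_mul (c := 2) (by norm_num))).mono hS.le ?_
  rw [← Finset.mul_sum]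
  have h2 := Real.sum_le_exp_of_nonneg (by positivity : 0 ≤ (k : ℝ) ^ 2 * σ) (J + 1)
  have h3 : 1 ≤ Real.exp (k ^ 2 * σ) := Real.one_le_exp (by positivity)
  have h4 : (1 : ℝ) ≤ J + 1 := by linarith [(Nat.cast_nonneg J : (0 : ℝ) ≤ J)]
  have h5 := mul_le_mul_of_nonneg_left h2 (by positivity : 0 ≤ 6 * ((J : ℝ) + 1))
  nlinarith

lemma primePoly_Ioc_add {q : ℕ} (χ : DirichletCharacter ℂ q) (y : ℝ) (e : ℕ) {M N : ℕ} (h : M ≤ N)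
    (t : ℝ) :
    primePoly χ y e ((Finset.Ioc 0 N).filter Nat.Prime) t
      = primePoly χ y e ((Finset.Ioc 0 M).filter Nat.Prime) t
        + primePoly χ y e ((Finset.Ioc M N).filter Nat.Prime) t := by
  simp only [primePoly, Finset.sum_filter]
  exact (Finset.sum_Ioc_consecutive _ (Nat.zero_le M) h).symm

lemma pow_le_main_add_exceptional {N l A ε₁ C a₁ a₂ a₃ A₁ : ℝ} {k J m m' : ℕ} (hN : 0 ≤ N)
    (hNA : N ≤ Real.exp (A * l)) (hN' : N ≤ Real.exp (a₁ + a₂ + a₃ + C + ε₁ * l))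
    (hl : 0 < l) (hε₁ : 0 < ε₁) (hA₁ : 0 < A₁) (ha₁ : 0 ≤ a₁) (ha₂ : 0 ≤ a₂) (ha₃ : 0 ≤ a₃)
    (hJ : 10 * (k * (A₁ * l)) ≤ J) :
    N ^ (2 * k) ≤ Real.exp (2 * k * (3 * ε₁ * l + C)) *
        (2 * (J + 1) * ∑ j ∈ Finset.range (J + 1), (((k : ℝ) ^ (2 * j) / (j.factorial : ℝ) ^ 2)
          * a₁ ^ (2 * j)) + 2 * 1)
      + Real.exp (2 * k * (A * l)) * ((1 / (ε₁ * l)) ^ (2 * m) * a₂ ^ (2 * m)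
        + (1 / (ε₁ * l)) ^ (2 * m) * a₃ ^ (2 * m) + (1 / (A₁ * l)) ^ (2 * m') * a₁ ^ (2 * m')) := by
  have hmain0 : 0 ≤ Real.exp (2 * k * (3 * ε₁ * l + C)) *
        (2 * (J + 1) * ∑ j ∈ Finset.range (J + 1), (((k : ℝ) ^ (2 * j) / (j.factorial : ℝ) ^ 2)
          * a₁ ^ (2 * j)) + 2 * 1) := by positivity
  have he₁ : 0 ≤ (1 / (A₁ * l)) ^ (2 * m') * a₁ ^ (2 * m') := by positivity
  have he₂ : 0 ≤ (1 / (ε₁ * l)) ^ (2 * m) * a₂ ^ (2 * m) := by positivity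
  have he₃ : 0 ≤ (1 / (ε₁ * l)) ^ (2 * m) * a₃ ^ (2 * m) := by positivity
  have hpow : ∀ r : ℝ, N ≤ Real.exp r → N ^ (2 * k) ≤ Real.exp (2 * k * r) := by
    intro r hr
    calc N ^ (2 * k) ≤ Real.exp r ^ (2 * k) := pow_le_pow_left₀ hN hr _
      _ = _ := by rw [← Real.exp_nat_mul]; push_cast; rfl
  by_cases hgood : a₁ ≤ A₁ * l ∧ a₂ ≤ ε₁ * l ∧ a₃ ≤ ε₁ * l
  · obtain ⟨h1, h2, h3⟩ := hgood
    have h4 : N ≤ Real.exp (a₁ + (3 * ε₁ * l + C)) :=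
      hN'.trans (Real.exp_le_exp.2 (by linarith))
    have h5 : Real.exp (k * a₁) ≤ ∑ j ∈ Finset.range (J + 1), (k * a₁) ^ j / j.factorial + 1 := by
      apply exp_le_sum_add_one (by positivity)
      refine le_trans ?_ hJ
      gcongr
    have h6 : Real.exp (k * a₁) ^ 2 ≤ 2 * (J + 1) * ∑ j ∈ Finset.range (J + 1),
        (((k : ℝ) ^ (2 * j) / (j.factorial : ℝ) ^ 2) * a₁ ^ (2 * j)) + 2 * 1 := by
      refine (pow_le_pow_left₀ (Real.exp_pos _).le h5 2).trans ((sq_sum_add_one_le _ J).trans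
        (le_of_eq ?_))
      rw [mul_one]
      congr 2
      refine Finset.sum_congr rfl fun j _ => ?_
      rw [div_pow, mul_pow, mul_pow, ← pow_mul, ← pow_mul, mul_comm j 2]
      ring
    have h7 := mul_le_mul_of_nonneg_left h6 (Real.exp_pos (2 * k * (3 * ε₁ * l + C))).le
    have h8 : Real.exp (2 * k * (a₁ + (3 * ε₁ * l + C)))
        = Real.exp (2 * k * (3 * ε₁ * l + C)) * Real.exp (k * a₁) ^ 2 := by
      rw [← Real.exp_nat_mul, ← Real.exp_add]
      congr 1
      push_cast
      ring
    have h9 := hpow _ h4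
    rw [h8] at h9
    have h10 : 0 ≤ Real.exp (2 * k * (A * l)) * ((1 / (ε₁ * l)) ^ (2 * m) * a₂ ^ (2 * m)
        + (1 / (ε₁ * l)) ^ (2 * m) * a₃ ^ (2 * m) + (1 / (A₁ * l)) ^ (2 * m') * a₁ ^ (2 * m')) := by
      positivity
    linarith
  · have hone : 1 ≤ (1 / (ε₁ * l)) ^ (2 * m) * a₂ ^ (2 * m)
        + (1 / (ε₁ * l)) ^ (2 * m) * a₃ ^ (2 * m) + (1 / (A₁ * l)) ^ (2 * m') * a₁ ^ (2 * m') := by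
      rw [not_and_or, not_and_or, not_le, not_le, not_le] at hgood
      rcases hgood with h | h | h
      · linarith [one_le_one_div_pow_mul_pow (by positivity) h.le (2 * m')]
      · linarith [one_le_one_div_pow_mul_pow (by positivity) h.le (2 * m)]
      · linarith [one_le_one_div_pow_mul_pow (by positivity) h.le (2 * m)]
    have := le_mul_of_one_le_right (Real.exp_pos (2 * k * (A * l))).le hone
    linarith [hpow _ hNA]

set_option maxHeartbeats 1000000 in
lemma exists_meanLE_typical_values (hGRH : GRH) {k : ℕ} (hk : 1 ≤ k) {A ε : ℝ} (hA : 1 ≤ A) (hε : 0 < ε) :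
    ∃ L₀ K : ℝ, 0 ≤ K ∧
    ∀ (q : ℕ) [NeZero q] (S : ℝ), 2 ≤ S → L₀ ≤ Real.log (q * S) →
    ∃ F : DirichletCharacter ℂ q → ℝ → ℝ, (∀ χ t, 0 ≤ F χ t) ∧
      MeanLE q S F (K * Real.exp ((k ^ 2 + ε) * Real.log (Real.log (q * S)))) ∧
      ∀ χ, χ ≠ 1 → ∀ t : ℝ, |t| ≤ S →
      ‖DirichletCharacter.LFunction χ (1 / 2 + t * I)‖ ≤ Real.exp (A * Real.log (Real.log (q * S))) →
      ‖DirichletCharacter.LFunction χ (1 / 2 + t * I)‖ ^ (2 * k) ≤ F χ t := by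
  obtain ⟨C, hC, hL⟩ := exists_norm_LFunction_le_exp_primePoly hGRH
  have hk1 : (1 : ℝ) ≤ k := by exact_mod_cast hk
  have hk0 : (0 : ℝ) < k := by linarith
  obtain ⟨ε₁, hε₁, hε₁1, hε₁k⟩ : ∃ ε₁ : ℝ, 0 < ε₁ ∧ ε₁ ≤ 1 ∧ 6 * k * ε₁ ≤ ε / 2 := by
    refine ⟨min 1 (ε / (12 * k)), by positivity, min_le_left _ _, ?_⟩
    calc 6 * k * min 1 (ε / (12 * k)) ≤ 6 * k * (ε / (12 * k)) := by
          gcongr; exact min_le_right _ _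
      _ = ε / 2 := by field_simp; norm_num
  set B := C / ε₁ with hB
  have hB1 : 1 ≤ B := by rw [hB, one_le_div hε₁]; linarith
  have hB0 : 0 < B := by linarith
  have hCB : C = B * ε₁ := by rw [hB]; field_simp
  set A₁ := 2 * Real.exp (k * A) with hA₁
  have hA₁1 : 1 ≤ A₁ := by
    have : 1 ≤ Real.exp (k * A) := Real.one_le_exp (by positivity)
    linarith
  have hA₁0 : 0 < A₁ := by linarith
  have hkA₁ : 1 ≤ k * A₁ := one_le_mul_of_one_le_of_one_le hk1 hA₁1
  set θ := Real.exp (-(4 * k * A * B)) with hθ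
  obtain ⟨δ, hδ0, hδ2, hδθ⟩ : ∃ δ : ℝ, 0 < δ ∧ δ ≤ 1 / 2 ∧ δ ≤ θ * C * ε₁ :=
    ⟨min (1 / 2) (θ * C * ε₁), by positivity, min_le_left _ _, min_le_right _ _⟩
  set K₁ := 40 * k * A₁ * B with hK₁
  have hK₁1 : 1 ≤ K₁ := by
    have := one_le_mul_of_one_le_of_one_le hkA₁ hB1
    rw [hK₁]; linarith
  have hlogK₁ : 0 ≤ Real.log K₁ := Real.log_nonneg hK₁1
  refine ⟨Real.exp (B + 6 + 7 / δ + Real.log K₁ / δ),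
    192 * (k * A₁ / ε) * Real.exp (2 * k * C + 6 * k ^ 2) + 6 * Real.exp (4 * k * A * B)
      + 3 * Real.exp (2 * k * A), by positivity, ?_⟩
  intro q _ S hS hΛ
  set Λ := Real.log (q * S) with hΛdef
  set l := Real.log Λ with hl
  have hΛ0 : 0 < Λ := (Real.exp_pos _).trans_le hΛ
  have hlge : B + 6 + 7 / δ + Real.log K₁ / δ ≤ l := (Real.le_log_iff_exp_le hΛ0).2 hΛ
  have hΛl : Real.exp l = Λ := Real.exp_log hΛ0
  have h7δ : 0 < 7 / δ := by positivity
  have hlK : 0 ≤ Real.log K₁ / δ := by positivity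
  have hl6 : 6 ≤ l := by linarith
  have hl0 : 0 < l := by linarith
  have hlB : B ≤ l := by linarith
  have hδl : 7 ≤ δ * l := by
    have : 7 / δ ≤ l := by linarith
    rw [div_le_iff₀ hδ0] at this
    linarith
  have hR : K₁ ≤ Real.exp (δ * l) := by
    rw [← Real.log_le_iff_le_exp (by linarith)]
    have : Real.log K₁ / δ ≤ l := by linarith
    rw [div_le_iff₀ hδ0] at this
    linarith
  have hS0 : 0 < S := by linarith
  set R := Real.exp (δ * l) with hRdef
  have hR1 : 1 ≤ R := hK₁1.trans hR
  have hR0 : 0 < R := by linarith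
  set y := B * Λ / l with hy
  have hy0 : 0 < y := by positivity
  set u := y / R with hu
  have hu0 : 0 < u := by positivity
  have hu1 : 1 ≤ u := by
    rw [hu, one_le_div hR0, hy, le_div_iff₀ hl0]
    have h1 : R ≤ Real.exp (l / 2) := Real.exp_le_exp.2 (by
      linarith [mul_le_mul_of_nonneg_right hδ2 hl0.le])
    have h2 : l ≤ Real.exp (l / 2) := by
      have h3 := Real.add_one_le_exp (l / 4)
      have h4 : Real.exp (l / 2) = Real.exp (l / 4) ^ 2 := by
        rw [← Real.exp_nat_mul]; congr 1; push_cast; ring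
      have h5 := pow_le_pow_left₀ (by positivity) h3 2
      rw [h4]
      linarith [sq_nonneg (l / 4 - 1)]
    calc R * l ≤ Real.exp (l / 2) * Real.exp (l / 2) := mul_le_mul h1 h2 hl0.le (Real.exp_pos _).le
      _ = Λ := by rw [← Real.exp_add, add_halves, hΛl]
      _ ≤ B * Λ := le_mul_of_one_le_left hΛ0.le hB1
  have huy : u ≤ y := div_le_self hy0.le hR1
  have hy1 : 1 ≤ y := hu1.trans huy
  have hylog : Real.log y ≤ l := by
    apply Real.log_le_log hy0
    rw [hy, div_le_iff₀ hl0, mul_comm Λ]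
    exact mul_le_mul_of_nonneg_right hlB hΛ0.le
  have hulog : Real.log u ≤ Real.log y := Real.log_le_log hu0 huy
  have hlogyu : Real.log y - Real.log u = δ * l := by
    rw [hu, Real.log_div hy0.ne' hR0.ne', hRdef, Real.log_exp]; ring
  set J := ⌈10 * (k * (A₁ * l))⌉₊ with hJ
  have hJge : 10 * (k * (A₁ * l)) ≤ J := Nat.le_ceil _
  have hkAl : 1 ≤ k * A₁ * l := one_le_mul_of_one_le_of_one_le hkA₁ (by linarith)
  have hJle : (J : ℝ) + 1 ≤ 12 * (k * A₁ * l) := by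
    have := Nat.ceil_lt_add_one (by positivity : 0 ≤ 10 * (k * (A₁ * l)))
    rw [← hJ] at this
    linarith
  set m := ⌊l / (2 * B)⌋₊ with hm
  set m' := ⌊l⌋₊ with hm'
  have hmle : (m : ℝ) ≤ l / (2 * B) := Nat.floor_le (by positivity)
  have hm'le : (m' : ℝ) ≤ l := Nat.floor_le hl0.le
  have hlenJ : 2 * J * u ≤ Λ := by
    calc 2 * J * u ≤ 2 * (20 * (k * A₁ * l)) * u := by gcongr; linarith
      _ = K₁ / R * Λ := by rw [hu, hy, hK₁]; field_simp; norm_num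
      _ ≤ 1 * Λ := by gcongr; rwa [div_le_one hR0]
      _ = Λ := one_mul _
  have hlenm' : 2 * m' * u ≤ Λ := by
    refine le_trans ?_ hlenJ
    have : (m' : ℝ) ≤ J := by
      have := mul_le_mul_of_nonneg_right hkA₁ hl0.le
      linarith
    gcongr
  have hlenm : 2 * m * y ≤ Λ := by
    calc 2 * m * y ≤ 2 * (l / (2 * B)) * y := by gcongr
      _ = Λ := by rw [hy]; field_simp
  have hσ₁ : ∑ p ∈ Finset.Ioc 0 ⌊Real.exp u⌋₊ with p.Prime, 1 / (p : ℝ) ^ 1 ≤ l + 6 :=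
    (sum_inv_prime_floor_exp_le hu1).trans (by linarith)
  have hσ₂ : ∑ p ∈ Finset.Ioc ⌊Real.exp u⌋₊ ⌊Real.exp y⌋₊ with p.Prime, 1 / (p : ℝ) ^ 1
      ≤ 2 * (δ * l) := (sum_inv_prime_floor_exp_floor_exp_le hu1 huy).trans (by linarith)
  have hbound : (m : ℝ) * (2 * (δ * l)) ≤ θ * (ε₁ * l) ^ 2 := by
    calc (m : ℝ) * (2 * (δ * l)) ≤ l / (2 * B) * (2 * (δ * l)) := by gcongr
      _ = δ * (l ^ 2 / B) := by field_simp
      _ ≤ θ * C * ε₁ * (l ^ 2 / B) := by gcongr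
      _ = θ * (ε₁ * l) ^ 2 := by rw [hCB]; field_simp
  have hbound' : (m' : ℝ) * (2 * l) ≤ Real.exp (-(2 * k * A)) * (A₁ * l) ^ 2 := by
    have h1 : Real.exp (-(2 * k * A)) * (A₁ * l) ^ 2 = 4 * l ^ 2 := by
      have h2 : Real.exp (-(2 * k * A)) * Real.exp (k * A) ^ 2 = 1 := by
        rw [← Real.exp_nat_mul, ← Real.exp_add, ← Real.exp_zero]
        congr 1
        push_cast
        ring
      rw [hA₁]
      linear_combination 4 * l ^ 2 * h2
    rw [h1]
    linarith [mul_le_mul_of_nonneg_right hm'le hl0.le, sq_nonneg l]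
  have hmain := (meanLE_sum_primePoly (q := q) (S := S) (y := y) (u := u) (σ := l + 6) hS0 hy0
    (by linarith) hσ₁ hu0.le hlenJ k).const_mul (c := Real.exp (2 * k * (3 * ε₁ * l + C))) (by positivity)
  have he₂ := MeanLE.primePoly_div (q := q) (S := S) (y := y) (u := y) (σ := 2 * (δ * l))
    (W := ε₁ * l) (b := θ) (e := 1) (m := m) hS0 hy0 one_ne_zero (by positivity) hσ₂
    (by rw [Nat.cast_one, one_mul]; exact hlenm) (by positivity) hbound
  have he₃ := MeanLE.primePoly_div (q := q) (S := S) (y := y) (u := y / 2) (σ := 2 * (δ * l))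
    (W := ε₁ * l) (b := θ) (e := 2) (m := m) (a := 0) hS0 hy0 two_ne_zero (by positivity)
    ((sum_inv_prime_sq_le _).trans (by linarith))
    (by rw [show ((2 : ℕ) : ℝ) * (y / 2) = y by push_cast; ring]; exact hlenm) (by positivity) hbound
  have he₁ := MeanLE.primePoly_div (q := q) (S := S) (y := y) (u := u) (σ := 2 * l)
    (W := A₁ * l) (b := Real.exp (-(2 * k * A))) (e := 1) (m := m') hS0 hy0 one_ne_zero (by positivity)
    (hσ₁.trans (by linarith)) (by rw [Nat.cast_one, one_mul]; exact hlenm') (by positivity) hbound'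
  have hexc := ((he₂.add he₃).add he₁).const_mul (c := Real.exp (2 * k * (A * l))) (by positivity)
  refine ⟨_, ?_, (hmain.add hexc).mono hS0.le ?_, ?_⟩
  · intro χ t
    positivity
  · set E := Real.exp ((k ^ 2 + ε) * l) with hE
    have hE1 : 1 ≤ E := Real.one_le_exp (by positivity)
    have h1 : Real.exp (2 * k * (3 * ε₁ * l + C)) * (8 * (J + 1) * Real.exp (k ^ 2 * (l + 6)))
        ≤ 192 * (k * A₁ / ε) * Real.exp (2 * k * C + 6 * k ^ 2) * E := by
      have h2 : l ≤ 2 / ε * Real.exp (ε * l / 2) := by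
        have := Real.add_one_le_exp (ε * l / 2)
        calc l = 2 / ε * (ε * l / 2) := by field_simp
          _ ≤ _ := by gcongr; linarith
      have h3 : Real.exp (2 * k * (3 * ε₁ * l + C)) ≤ Real.exp (ε * l / 2 + 2 * k * C) := by
        rw [Real.exp_le_exp]
        have := mul_le_mul_of_nonneg_right hε₁k hl0.le
        linarith
      have h4 : (J : ℝ) + 1 ≤ 12 * (k * A₁ * (2 / ε * Real.exp (ε * l / 2))) :=
        hJle.trans (by gcongr)
      calc _ ≤ Real.exp (ε * l / 2 + 2 * k * C) * (8 * (12 * (k * A₁ * (2 / ε * Real.exp (ε * l / 2))))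
            * Real.exp (k ^ 2 * (l + 6))) := by gcongr
        _ = 192 * (k * A₁ / ε) * (Real.exp (ε * l / 2 + 2 * k * C) * Real.exp (ε * l / 2)
            * Real.exp (k ^ 2 * (l + 6))) := by ring
        _ = 192 * (k * A₁ / ε) * (Real.exp (2 * k * C + 6 * k ^ 2) * E) := by
            rw [hE, ← Real.exp_add, ← Real.exp_add, ← Real.exp_add]
            congr 2
            ring
        _ = _ := by ring
    have h5 : Real.exp (2 * k * (A * l)) * θ ^ m ≤ Real.exp (4 * k * A * B) := by
      rw [hθ, ← Real.exp_nat_mul, ← Real.exp_add, Real.exp_le_exp]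
      have h6 : l / (2 * B) - 1 ≤ m := (Nat.sub_one_lt_floor _).le
      have h7 := mul_le_mul_of_nonneg_right h6 (by positivity : 0 ≤ 4 * k * A * B)
      have h8 : (l / (2 * B) - 1) * (4 * k * A * B) = 2 * k * (A * l) - 4 * k * A * B := by
        field_simp; ring
      linarith
    have h9 : Real.exp (2 * k * (A * l)) * Real.exp (-(2 * k * A)) ^ m' ≤ Real.exp (2 * k * A) := by
      rw [← Real.exp_nat_mul, ← Real.exp_add, Real.exp_le_exp]
      have h6 : l - 1 ≤ m' := (Nat.sub_one_lt_floor _).le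
      have h7 := mul_le_mul_of_nonneg_right h6 (by positivity : 0 ≤ 2 * k * A)
      linarith
    have h10 : 6 * Real.exp (4 * k * A * B) + 3 * Real.exp (2 * k * A)
        ≤ (6 * Real.exp (4 * k * A * B) + 3 * Real.exp (2 * k * A)) * E :=
      le_mul_of_one_le_right (by positivity) hE1
    linarith
  · intro χ hχ t ht hsmall
    refine pow_le_main_add_exceptional (norm_nonneg _) hsmall ?_ hl0 hε₁ hA₁0 (norm_nonneg _)
      (norm_nonneg _) (norm_nonneg _) hJge
    refine (hL q χ hχ S y t hS hy1 ht).trans (Real.exp_le_exp.2 ?_)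
    have h1 : C * Λ / y = ε₁ * l := by rw [hy, hCB]; field_simp
    rw [h1, primePoly_Ioc_add χ y 1 (Nat.floor_mono (Real.exp_le_exp.2 huy)) t]
    gcongr
    exact norm_add_le _ _

lemma charMoment_le_of_meanLE {q : ℕ} [NeZero q] {k : ℕ} {S B : ℝ} (hS : 0 ≤ S)
    {F : DirichletCharacter ℂ q → ℝ → ℝ} (hF0 : ∀ χ t, 0 ≤ F χ t) (hF : MeanLE q S F B)
    (h : ∀ χ, χ ≠ 1 → ∀ t : ℝ, |t| ≤ S →
      ‖DirichletCharacter.LFunction χ (1 / 2 + t * I)‖ ^ (2 * k) ≤ F χ t) :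
    charMoment k q S ≤ B * (Nat.totient q * S) := by
  rw [charMoment, dif_pos (NeZero.ne q), tsum_fintype]
  refine (Finset.sum_le_sum fun χ _ => ?_).trans hF.2
  split_ifs with hχ
  · refine intervalIntegral.integral_mono_on hS ?_ ((hF.1 χ).intervalIntegrable 0 S) fun t ht => ?_
    · have hc : Continuous fun t : ℝ => (1 / 2 + t * I : ℂ) := by fun_prop
      exact ((((DirichletCharacter.differentiable_LFunction hχ).continuous.comp hc).norm).pow
        _).intervalIntegrable 0 S
    · exact h χ hχ t (by rw [abs_of_nonneg ht.1]; exact ht.2)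
  · exact intervalIntegral.integral_nonneg hS fun t _ => hF0 χ t

/-- conditional (GRH) bound for `2k`-th moments of Dirichlet
L-functions to a single modulus `q`. -/
theorem moment_bound_GRH (hGRH : GRH) (k : ℕ) (hk : 2 ≤ k) (ε : ℝ) (hε : 0 < ε) :
    ∃ C : ℝ, ∀ S : ℝ, 2 ≤ S → ∀ q : ℕ, 1 ≤ q →
      charMoment k q S ≤
        C * (Nat.totient q : ℝ) * S * (Real.log ((q : ℝ) * S)) ^ ((k^2 : ℝ) + ε) := by
  obtain ⟨A, hA, L₁, K₁, hK₁, h₁⟩ := exists_meanLE_large_values hGRH k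
  obtain ⟨L₂, K₂, hK₂, h₂⟩ := exists_meanLE_typical_values hGRH (by omega : 1 ≤ k) hA hε
  set L₀ := max 1 (max L₁ L₂) with hL₀
  have hlog2 : 0 < Real.log 2 := Real.log_pos one_lt_two
  set K₃ := Real.exp (3 * L₀) ^ (2 * k) / Real.log 2 ^ ((k : ℝ) ^ 2 + ε) with hK₃
  have hK₃0 : 0 ≤ K₃ := by positivity
  refine ⟨K₁ + K₂ + K₃, fun S hS q hq => ?_⟩
  have : NeZero q := ⟨by omega⟩
  have hq1 : (1 : ℝ) ≤ q := by exact_mod_cast hq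
  have hS0 : 0 ≤ S := by linarith
  set Λ := Real.log (q * S) with hΛ
  have hΛ2 : Real.log 2 ≤ Λ := Real.log_le_log two_pos (by nlinarith)
  have hΛ0 : 0 < Λ := hlog2.trans_le hΛ2
  set E := Λ ^ ((k : ℝ) ^ 2 + ε) with hE
  have hE0 : 0 < E := Real.rpow_pos_of_pos hΛ0 _
  suffices h : ∃ B ≤ (K₁ + K₂ + K₃) * E, ∃ F : DirichletCharacter ℂ q → ℝ → ℝ,
      (∀ χ t, 0 ≤ F χ t) ∧ MeanLE q S F B ∧ ∀ χ, χ ≠ 1 → ∀ t : ℝ, |t| ≤ S →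
        ‖DirichletCharacter.LFunction χ (1 / 2 + t * I)‖ ^ (2 * k) ≤ F χ t by
    obtain ⟨B, hB, F, hF0, hF, hLF⟩ := h
    have := charMoment_le_of_meanLE hS0 hF0 (hF.mono hS0 hB) hLF
    linarith
  rcases le_or_gt L₀ Λ with hlarge | hsmall
  · have hΛ1 : 1 ≤ Λ := (le_max_left _ _).trans hlarge
    have hE1 : 1 ≤ E := Real.one_le_rpow hΛ1 (by positivity)
    obtain ⟨F₁, hF₁0, hF₁, hb₁⟩ := h₁ q S hS
      (((le_max_left _ _).trans (le_max_right _ _)).trans hlarge)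
    obtain ⟨F₂, hF₂0, hF₂, hb₂⟩ := h₂ q S hS
      (((le_max_right _ _).trans (le_max_right _ _)).trans hlarge)
    have hEexp : Real.exp (((k : ℝ) ^ 2 + ε) * Real.log Λ) = E := by
      rw [hE, Real.rpow_def_of_pos hΛ0, mul_comm]
    rw [hEexp] at hF₂
    refine ⟨K₁ + K₂ * E, ?_, _, fun χ t => add_nonneg (hF₁0 χ t) (hF₂0 χ t), hF₁.add hF₂,
      fun χ hχ t ht => ?_⟩
    · linarith [le_mul_of_one_le_right hK₁ hE1, mul_nonneg hK₃0 hE0.le]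
    · rcases le_or_gt (‖DirichletCharacter.LFunction χ (1 / 2 + t * I)‖) (Real.exp (A * Real.log Λ))
        with h | h
      · linarith [hb₂ χ hχ t ht h, hF₁0 χ t]
      · linarith [hb₁ χ hχ t ht h, hF₂0 χ t]
  · refine ⟨_, ?_, _, fun χ t => ?_, MeanLE.one.const_mul (c := Real.exp (3 * L₀) ^ (2 * k))
      (by positivity), fun χ hχ t ht => ?_⟩
    · have hEle : Real.log 2 ^ ((k : ℝ) ^ 2 + ε) ≤ E :=
        Real.rpow_le_rpow hlog2.le hΛ2 (by positivity)
      have h0 : 0 < Real.log 2 ^ ((k : ℝ) ^ 2 + ε) := Real.rpow_pos_of_pos hlog2 _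
      calc Real.exp (3 * L₀) ^ (2 * k) * 1 = K₃ * Real.log 2 ^ ((k : ℝ) ^ 2 + ε) := by
            rw [hK₃]; field_simp
        _ ≤ K₃ * E := mul_le_mul_of_nonneg_left hEle hK₃0
        _ ≤ _ := mul_le_mul_of_nonneg_right (by linarith) hE0.le
    · positivity
    · rw [mul_one]
      refine pow_le_pow_left₀ (norm_nonneg _)
        ((norm_LFunction_le_exp_three_mul_log hχ hS ht).trans (Real.exp_le_exp.2 ?_)) _
      exact mul_le_mul_of_nonneg_left hsmall.le (by norm_num)
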